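/- arXiv:math/0604163 — 3 statements merged into one kernel-verified Lean document; each statement's English description precedes it below -/
import Mathlib

section
/- Let D be a nonsquare integer with D ≡ 0 or 1 (mod 4). Then the number of primes p ≤ x with χ_D(p) = 1, multiplied by (log x)/x, tends to 1/2 as x → ∞. -/
open Filter Real

/-- The value of the quadratic character `χ_D` at a prime `p`: the Legendre symbol `(D/p)`
for odd primes `p`, and at `p = 2` it is `0` if `D` is even, `1` if `D ≡ 1 (mod 8)` and
`-1` if `D ≡ 5 (mod 8)`. (At non-primes the value of this auxiliary function is irrelevant.) -/
noncomputable def chiDp (D : ℤ) (p : ℕ) : ℤ :=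
  if p = 2 then (if 2 ∣ D then 0 else if D % 8 = 1 then 1 else -1)
  else if h : p.Prime then @legendreSym p ⟨h⟩ D else 0

section Tauberian

open MeasureTheory Set Topology

lemma fejer_eq_integral (x : ℝ) :
    ∫ y in (-1:ℝ)..1, ((1 - |y| : ℝ) : ℂ) * Complex.exp (x * y * Complex.I) = ((sinc (x / 2) ^ 2 : ℝ) : ℂ) := by
  have hc : Continuous fun y : ℝ ↦ ((1 - |y| : ℝ) : ℂ) * Complex.exp (x * y * Complex.I) := by
    fun_prop
  rw [← intervalIntegral.integral_add_adjacent_intervals (b := 0)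
    (hc.intervalIntegrable _ _) (hc.intervalIntegrable _ _)]
  have hl : ∫ y in (-1:ℝ)..0, ((1 - |y| : ℝ) : ℂ) * Complex.exp (x * y * Complex.I) =
      ∫ y in (-1:ℝ)..0, (1 + y : ℂ) * Complex.exp ((x * Complex.I) * y) := by
    refine intervalIntegral.integral_congr fun y hy ↦ ?_
    rw [uIcc_of_le (by norm_num)] at hy
    simp only [abs_of_nonpos hy.2]
    push_cast
    ring_nf
  have hr : ∫ y in (0:ℝ)..1, ((1 - |y| : ℝ) : ℂ) * Complex.exp (x * y * Complex.I) =
      ∫ y in (0:ℝ)..1, (1 - y : ℂ) * Complex.exp ((x * Complex.I) * y) := by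
    refine intervalIntegral.integral_congr fun y hy ↦ ?_
    rw [uIcc_of_le (by norm_num)] at hy
    simp only [abs_of_nonneg hy.1]
    push_cast
    ring_nf
  rw [hl, hr]
  rcases eq_or_ne x 0 with rfl | hx
  · have h1 : ∫ y in (-1:ℝ)..0, (1 + y : ℂ) = ((∫ y in (-1:ℝ)..0, (1 + y : ℝ) : ℝ) : ℂ) := by
      rw [← intervalIntegral.integral_ofReal]; simp
    have h2 : ∫ y in (0:ℝ)..1, (1 - y : ℂ) = ((∫ y in (0:ℝ)..1, (1 - y : ℝ) : ℝ) : ℂ) := by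
      rw [← intervalIntegral.integral_ofReal]; simp
    simp only [Complex.ofReal_zero, zero_mul, Complex.exp_zero, mul_one, h1, h2]
    rw [intervalIntegral.integral_add (by simp) (by simp),
      intervalIntegral.integral_sub (by simp) (by simp)]
    norm_num
  set a : ℂ := x * Complex.I with ha
  have ha0 : a ≠ 0 := by simp [ha, hx]
  have hexp (y : ℝ) : HasDerivAt (fun y : ℝ ↦ Complex.exp (a * y)) (Complex.exp (a * y) * a) y := by
    simpa using ((hasDerivAt_id (y : ℂ)).const_mul a).cexp.comp_ofReal
  have hid (y : ℝ) : HasDerivAt (fun y : ℝ ↦ (y : ℂ)) 1 y := by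
    simpa using (hasDerivAt_id (y : ℂ)).comp_ofReal
  have h1 := intervalIntegral.integral_eq_sub_of_hasDerivAt (a := -1) (b := 0)
    (f := fun y : ℝ ↦ (1 + y : ℂ) * Complex.exp (a * y) / a - Complex.exp (a * y) / a ^ 2)
    (f' := fun y : ℝ ↦ (1 + y : ℂ) * Complex.exp (a * y)) (fun y _ ↦ by
      convert! ((((hid y).const_add 1).mul (hexp y)).div_const a).sub ((hexp y).div_const (a ^ 2))
        using 1
      field_simp
      ring) (by apply Continuous.intervalIntegrable; fun_prop)
  have h2 := intervalIntegral.integral_eq_sub_of_hasDerivAt (a := 0) (b := 1)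
    (f := fun y : ℝ ↦ (1 - y : ℂ) * Complex.exp (a * y) / a + Complex.exp (a * y) / a ^ 2)
    (f' := fun y : ℝ ↦ (1 - y : ℂ) * Complex.exp (a * y)) (fun y _ ↦ by
      convert! ((((hid y).const_sub 1).mul (hexp y)).div_const a).add ((hexp y).div_const (a ^ 2))
        using 1
      field_simp
      ring) (by apply Continuous.intervalIntegrable; fun_prop)
  rw [h1, h2, sinc_of_ne_zero (by positivity)]
  have hcos : Complex.exp a + Complex.exp (-a) = 2 - 4 * (sin (x / 2) : ℂ) ^ 2 := by
    have h := Complex.two_cos (x : ℂ)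
    rw [← ha, neg_mul, ← ha] at h
    rw [← h]
    have h' : cos x = 1 - 2 * sin (x / 2) ^ 2 := by
      rw [← Real.cos_sq_add_sin_sq (x / 2)]
      conv_lhs => rw [show x = 2 * (x / 2) by ring, Real.cos_two_mul']
      ring
    rw [← Complex.ofReal_cos, h']
    push_cast
    ring
  have ha2 : a ^ 2 = -(x : ℂ) ^ 2 := by rw [ha, mul_pow, Complex.I_sq]; ring
  have hx' : (x : ℂ) ≠ 0 := by exact_mod_cast hx
  push_cast
  simp only [mul_zero, mul_one, Complex.exp_zero, mul_neg]
  rw [show (4:ℂ) * (sin (x / 2) : ℂ) ^ 2 = 4 * Complex.sin (x / 2) ^ 2 by push_cast; rfl] at hcos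
  rw [div_pow, div_pow, ha2]
  field_simp
  linear_combination -a * hcos

lemma laplace_fejer {g : ℝ → ℝ} (hg : Measurable g) {B : ℝ} (hB : ∀ t, |g t| ≤ B) {ε : ℝ}
    (hε : 0 < ε) (c u : ℝ) :
    ((∫ t in Ioi (0:ℝ), g t * exp (-ε * t) * sinc (c * (u - t) / 2) ^ 2 : ℝ) : ℂ) =
      ∫ y in (-1:ℝ)..1, ((1 - |y| : ℝ) : ℂ) * Complex.exp (c * u * y * Complex.I) *
        ∫ t in Ioi (0:ℝ), (g t : ℂ) * Complex.exp (-(ε + c * y * Complex.I) * t) := by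
  have hint : Integrable (Function.uncurry fun (y t : ℝ) ↦ (g t : ℂ) * Complex.exp (-ε * t) *
      (((1 - |y| : ℝ) : ℂ) * Complex.exp ((c * (u - t) : ℝ) * y * Complex.I)))
      ((volume.restrict (uIoc (-1) 1)).prod (volume.restrict (Ioi (0:ℝ)))) := by
    have h1 : Integrable (fun _ : ℝ ↦ (1 : ℝ)) (volume.restrict (uIoc (-1) 1)) := by
      rw [uIoc_of_le (by norm_num)]
      exact integrableOn_const (by simp)
    have h2 : Integrable (fun t : ℝ ↦ B * exp (-ε * t)) (volume.restrict (Ioi (0:ℝ))) :=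
      (integrableOn_exp_mul_Ioi (by linarith) 0).const_mul B
    refine (h1.mul_prod h2).mono' ?_ ?_
    · apply Measurable.aestronglyMeasurable
      unfold Function.uncurry
      fun_prop
    · have : ∀ᵐ z ∂((volume.restrict (uIoc (-1:ℝ) 1)).prod (volume.restrict (Ioi (0:ℝ)))),
          z ∈ (uIoc (-1:ℝ) 1) ×ˢ (Ioi (0:ℝ)) := by
        rw [Measure.prod_restrict]
        exact ae_restrict_mem (measurableSet_uIoc.prod measurableSet_Ioi)
      filter_upwards [this] with ⟨y, t⟩ ⟨hy, ht⟩
      rw [uIoc_of_le (by norm_num)] at hy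
      simp only [Function.uncurry, norm_mul, Complex.norm_real, norm_eq_abs]
      have e1 : ‖Complex.exp (-ε * t)‖ = exp (-ε * t) := by
        rw [Complex.norm_exp]; norm_num
      have e2 : ‖Complex.exp ((c * (u - t) : ℝ) * y * Complex.I)‖ = 1 := by
        rw [← Complex.ofReal_mul, Complex.norm_exp_ofReal_mul_I]
      rw [e1, e2, mul_one, one_mul]
      have h3 : abs (1 - |y|) ≤ 1 := by
        have := abs_nonneg y
        have : |y| ≤ 1 := abs_le.2 ⟨hy.1.le, hy.2⟩
        rw [abs_le]; constructor <;> linarith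
      have h4 := hB t
      calc |g t| * exp (-ε * t) * abs (1 - |y|) ≤ |g t| * exp (-ε * t) * 1 := by gcongr
        _ ≤ B * exp (-ε * t) := by rw [mul_one]; gcongr
  have hswap := intervalIntegral_integral_swap (a := -1) (b := 1) hint
  rw [← integral_complex_ofReal]
  calc _ = ∫ t in Ioi (0:ℝ), ∫ y in (-1:ℝ)..1, (g t : ℂ) * Complex.exp (-ε * t) *
      (((1 - |y| : ℝ) : ℂ) * Complex.exp ((c * (u - t) : ℝ) * y * Complex.I)) := by
        congr 1 with t
        rw [intervalIntegral.integral_const_mul, fejer_eq_integral]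
        push_cast
        ring
    _ = _ := by
        rw [← hswap]
        congr 1 with y
        rw [← integral_const_mul]
        congr 1 with t
        have e : Complex.exp (-ε * t) * Complex.exp ((c * (u - t) : ℝ) * y * Complex.I) =
            Complex.exp (c * u * y * Complex.I) *
              Complex.exp (-(ε + c * y * Complex.I) * t) := by
          rw [← Complex.exp_add, ← Complex.exp_add]
          push_cast
          ring_nf
        linear_combination (g t : ℂ) * ((1 - |y| : ℝ) : ℂ) * e
lemma integrable_fejer : Integrable fun x : ℝ ↦ sinc (x / 2) ^ 2 := by
  have h : Integrable fun x : ℝ ↦ 8 * (1 + x ^ 2)⁻¹ := integrable_inv_one_add_sq.const_mul 8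
  refine h.mono' (by fun_prop) (ae_of_all _ fun x ↦ ?_)
  rw [norm_of_nonneg (sq_nonneg _), ← div_eq_mul_inv, le_div_iff₀ (by positivity)]
  have h1 : sinc (x / 2) ^ 2 ≤ 1 := by
    rw [sq_le_one_iff_abs_le_one]
    exact abs_sinc_le_one _
  have h2 : sinc (x / 2) ^ 2 * x ^ 2 ≤ 4 := by
    rcases eq_or_ne x 0 with rfl | hx
    · simp
    · rw [sinc_of_ne_zero (by positivity)]
      field_simp
      nlinarith [Real.sin_sq_le_one (x / 2)]
  nlinarith

lemma integral_fejer_pos : 0 < ∫ x : ℝ, sinc (x / 2) ^ 2 := by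
  refine integral_pos_of_integrable_nonneg_nonzero (x := 0) (by fun_prop) integrable_fejer
    (fun x ↦ sq_nonneg _) (by simp)

lemma integrable_fejer_comp {c : ℝ} (hc : c ≠ 0) (u : ℝ) :
    Integrable fun t : ℝ ↦ sinc (c * (u - t) / 2) ^ 2 :=
  (integrable_fejer.comp_mul_left' hc).comp_sub_left u

lemma fejer_conv_eq {g : ℝ → ℝ} (hg : Measurable g) {B : ℝ} (hB : ∀ t, |g t| ≤ B) {H : ℂ → ℂ}
    (hH : ContinuousOn H {s | 0 ≤ s.re})
    (hgH : ∀ s : ℂ, 0 < s.re → ∫ t in Ioi (0:ℝ), (g t : ℂ) * Complex.exp (-s * t) = H s)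
    {c : ℝ} (hc : c ≠ 0) (u : ℝ) :
    ((∫ t in Ioi (0:ℝ), g t * sinc (c * (u - t) / 2) ^ 2 : ℝ) : ℂ) =
      ∫ y in (-1:ℝ)..1, ((1 - |y| : ℝ) : ℂ) * Complex.exp (c * u * y * Complex.I) *
        H (c * y * Complex.I) := by
  have hB0 : 0 ≤ B := (abs_nonneg _).trans (hB 0)
  have hl : Tendsto (fun ε : ℝ ↦
      ((∫ t in Ioi (0:ℝ), g t * exp (-ε * t) * sinc (c * (u - t) / 2) ^ 2 : ℝ) : ℂ)) (𝓝[>] 0)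
      (𝓝 ((∫ t in Ioi (0:ℝ), g t * sinc (c * (u - t) / 2) ^ 2 : ℝ) : ℂ)) := by
    refine (Complex.continuous_ofReal.tendsto _).comp ?_
    refine tendsto_integral_filter_of_dominated_convergence
      (fun t ↦ B * sinc (c * (u - t) / 2) ^ 2) (.of_forall fun ε ↦ ?_) ?_
      ((integrable_fejer_comp hc u).integrableOn.const_mul B) (ae_of_all _ fun t ↦ ?_)
    · apply Measurable.aestronglyMeasurable
      fun_prop
    · filter_upwards [self_mem_nhdsWithin] with ε hε
      filter_upwards [ae_restrict_mem measurableSet_Ioi] with t ht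
      rw [norm_mul, norm_mul, norm_of_nonneg (sq_nonneg (sinc _)), norm_of_nonneg (exp_pos _).le,
        norm_eq_abs]
      have h1 : exp (-ε * t) ≤ 1 := by
        rw [exp_le_one_iff]
        have := mul_pos (mem_Ioi.1 hε) (mem_Ioi.1 ht)
        linarith
      have := hB t
      calc _ ≤ B * 1 * sinc (c * (u - t) / 2) ^ 2 := by gcongr
        _ = _ := by ring
    · have : Continuous fun ε : ℝ ↦ g t * exp (-ε * t) * sinc (c * (u - t) / 2) ^ 2 := by fun_prop
      simpa using (this.tendsto 0).mono_left nhdsWithin_le_nhds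
  have hr : Tendsto (fun ε : ℝ ↦
      ∫ y in (-1:ℝ)..1, ((1 - |y| : ℝ) : ℂ) * Complex.exp (c * u * y * Complex.I) *
        H (ε + c * y * Complex.I)) (𝓝[>] 0)
      (𝓝 (∫ y in (-1:ℝ)..1, ((1 - |y| : ℝ) : ℂ) * Complex.exp (c * u * y * Complex.I) *
        H (c * y * Complex.I))) := by
    have hcont : ContinuousOn (fun p : ℝ × ℝ ↦ H (p.1 + c * p.2 * Complex.I)) (Ici 0 ×ˢ univ) :=
      hH.comp (by fun_prop) fun p hp ↦ by simpa using hp.1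
    obtain ⟨C, hC⟩ := (isCompact_Icc.prod isCompact_Icc).exists_bound_of_continuousOn
      (hcont.mono (Set.prod_mono (show Icc (0:ℝ) 1 ⊆ Ici 0 from Icc_subset_Ici_self) (subset_univ (Icc (-1) 1))))
    refine intervalIntegral.tendsto_integral_filter_of_dominated_convergence (fun _ ↦ C)
      ?_ ?_ (by simp) (ae_of_all _ fun y hy ↦ ?_)
    · filter_upwards [self_mem_nhdsWithin] with ε hε
      apply Continuous.aestronglyMeasurable
      refine Continuous.mul (by fun_prop) ?_
      exact hcont.comp_continuous (f := fun y : ℝ ↦ (ε, y)) (by fun_prop)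
        fun y ↦ ⟨(mem_Ioi.1 hε).le, mem_univ _⟩
    · have : Ioo (0:ℝ) 1 ∈ 𝓝[>] (0:ℝ) := Ioo_mem_nhdsGT (by norm_num)
      filter_upwards [this] with ε hε
      refine ae_of_all _ fun y hy ↦ ?_
      rw [uIoc_of_le (by norm_num)] at hy
      have h1 := hC (ε, y) ⟨⟨hε.1.le, hε.2.le⟩, hy.1.le, hy.2⟩
      have h2 : ‖Complex.exp (c * u * y * Complex.I)‖ = 1 := by
        rw [← Complex.ofReal_mul, ← Complex.ofReal_mul, Complex.norm_exp_ofReal_mul_I]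
      rw [norm_mul, norm_mul, h2, mul_one, Complex.norm_real, norm_eq_abs]
      have h3 : abs (1 - |y|) ≤ 1 := by
        have := abs_nonneg y
        have : |y| ≤ 1 := abs_le.2 ⟨hy.1.le, hy.2⟩
        rw [abs_le]; constructor <;> linarith
      calc _ ≤ 1 * C := mul_le_mul h3 h1 (norm_nonneg _) zero_le_one
        _ = C := one_mul C
    · refine Tendsto.const_mul _ ?_
      have := (hcont (0, y) ⟨self_mem_Ici, mem_univ _⟩).tendsto.comp
        (f := fun ε : ℝ ↦ (ε, y)) (x := 𝓝[>] 0) (by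
          rw [tendsto_nhdsWithin_iff]
          refine ⟨?_, ?_⟩
          · exact ((Continuous.prodMk_left y).tendsto 0).mono_left nhdsWithin_le_nhds
          · filter_upwards [self_mem_nhdsWithin] with ε hε using ⟨(mem_Ioi.1 hε).le, mem_univ _⟩)
      simpa [Function.comp_def] using this
  refine tendsto_nhds_unique_of_eventuallyEq hl hr ?_
  filter_upwards [self_mem_nhdsWithin] with ε hε
  rw [laplace_fejer hg hB hε]
  congr 1 with y
  rw [hgH _ (by simpa using hε)]

lemma fejer_conv_tendsto_zero {g : ℝ → ℝ} (hg : Measurable g) {B : ℝ} (hB : ∀ t, |g t| ≤ B)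
    {H : ℂ → ℂ} (hH : ContinuousOn H {s | 0 ≤ s.re})
    (hgH : ∀ s : ℂ, 0 < s.re → ∫ t in Ioi (0:ℝ), (g t : ℂ) * Complex.exp (-s * t) = H s)
    {c : ℝ} (hc : 0 < c) :
    Tendsto (fun u ↦ ∫ t in Ioi (0:ℝ), g t * sinc (c * (u - t) / 2) ^ 2) atTop (𝓝 0) := by
  have hw : Tendsto (fun u : ℝ ↦ -(c * u / (2 * π))) atTop (cocompact ℝ) :=
    (tendsto_neg_atTop_atBot.comp ((tendsto_id.const_mul_atTop hc).atTop_div_const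
      (by positivity))).mono_right atBot_le_cocompact
  have h := (Real.tendsto_integral_exp_smul_cocompact ((Ioc (-1:ℝ) 1).indicator fun y ↦
    ((1 - |y| : ℝ) : ℂ) * H (c * y * Complex.I))).comp hw
  have h' : Tendsto (fun u ↦
      ((∫ t in Ioi (0:ℝ), g t * sinc (c * (u - t) / 2) ^ 2 : ℝ) : ℂ)) atTop (𝓝 0) := by
    refine h.congr fun u ↦ ?_
    rw [fejer_conv_eq hg hB hH hgH hc.ne', intervalIntegral.integral_of_le (by norm_num),
      ← integral_indicator measurableSet_Ioc]
    refine integral_congr_ae (ae_of_all _ fun y ↦ ?_)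
    simp only [indicator]
    split_ifs
    · rw [Circle.smul_def, Real.fourierChar_apply, smul_eq_mul]
      rw [← mul_assoc, mul_comm (Complex.exp _)]
      congr 3
      push_cast
      field_simp
    · simp
  simpa [Function.comp_def] using (Complex.continuous_re.tendsto 0).comp h'

lemma fejer_conv_tendsto {f : ℝ → ℝ} (hf : Measurable f) {M : ℝ} (hM : ∀ t, |f t| ≤ M) {A : ℝ}
    {G : ℂ → ℂ} (hG : ContinuousOn G {s | 0 ≤ s.re})
    (hfG : ∀ s : ℂ, 0 < s.re →
      ∫ t in Ioi (0:ℝ), (f t : ℂ) * Complex.exp (-s * t) = G s + A / s)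
    {c : ℝ} (hc : 0 < c) :
    Tendsto (fun u ↦ ∫ t in Ioi (0:ℝ), f t * sinc (c * (u - t) / 2) ^ 2) atTop
      (𝓝 (A * ∫ t, sinc (c * t / 2) ^ 2)) := by
  have hKi (u : ℝ) := (integrable_fejer_comp hc.ne' u)
  have hfi (u : ℝ) : Integrable fun t ↦ f t * sinc (c * (u - t) / 2) ^ 2 :=
    (hKi u).bdd_mul hf.aestronglyMeasurable (ae_of_all _ hM)
  have h0 : Tendsto (fun u ↦ ∫ t in Ioi (0:ℝ), (f t - A) * sinc (c * (u - t) / 2) ^ 2) atTop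
      (𝓝 0) := by
    refine fejer_conv_tendsto_zero (hf.sub_const A) (B := M + |A|)
      (fun t ↦ (abs_sub _ _).trans (by gcongr; exact hM t)) hG (fun s hs ↦ ?_) hc
    have hi : IntegrableOn (fun t : ℝ ↦ Complex.exp (-s * t)) (Ioi 0) :=
      integrableOn_exp_mul_complex_Ioi (by simpa using hs) 0
    have hs0 : s ≠ 0 := fun h ↦ by simp [h] at hs
    push_cast
    simp_rw [sub_mul]
    rw [integral_sub ?_ (hi.const_mul _), hfG s hs, integral_const_mul,
      integral_exp_mul_complex_Ioi (by simpa using hs)]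
    · simp
      field_simp
      simp
    · exact hi.bdd_mul (c := M) (by fun_prop) (ae_of_all _ fun t ↦ by simpa using hM t)
  have h1 : Tendsto (fun u ↦ ∫ t in Ioi (0:ℝ), sinc (c * (u - t) / 2) ^ 2) atTop
      (𝓝 (∫ t, sinc (c * t / 2) ^ 2)) := by
    have e (u : ℝ) : ∫ t in Ioi (0:ℝ), sinc (c * (u - t) / 2) ^ 2 =
        ∫ t in Iio u, sinc (c * t / 2) ^ 2 := by
      rw [← integral_indicator measurableSet_Ioi, ← integral_indicator measurableSet_Iio,
        ← integral_sub_left_eq_self _ volume u]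
      congr 1 with t
      simp [indicator]
    simp_rw [e]
    exact (aecover_Iio tendsto_id).integral_tendsto_of_countably_generated
      (by simpa using (integrable_fejer_comp hc.ne' 0).comp_neg)
  have h2 := h0.add (h1.const_mul A)
  rw [zero_add] at h2
  refine h2.congr fun u ↦ ?_
  rw [← integral_const_mul, ← integral_add]
  · congr 1 with t
    ring
  · simp_rw [sub_mul]
    exact ((hfi u).sub ((hKi u).const_mul A)).integrableOn
  · exact ((hKi u).const_mul A).integrableOn

lemma exists_fejer_mass_ge {η : ℝ} (hη : 0 < η) :
    ∃ c > 0, (1 - η) * ∫ t, sinc (c * t / 2) ^ 2 ≤ ∫ t in (-η)..η, sinc (c * t / 2) ^ 2 := by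
  have h := intervalIntegral_tendsto_integral integrable_fejer tendsto_neg_atTop_atBot tendsto_id
  have hlt : (1 - η) * ∫ t : ℝ, sinc (t / 2) ^ 2 < ∫ t : ℝ, sinc (t / 2) ^ 2 := by
    nlinarith [integral_fejer_pos]
  obtain ⟨a, ha, ha0⟩ := ((h.eventually_const_lt hlt).and (eventually_gt_atTop 0)).exists
  have hc : 0 < a / η := by positivity
  refine ⟨a / η, hc, ?_⟩
  rw [Measure.integral_comp_mul_left (fun t ↦ sinc (t / 2) ^ 2),
    intervalIntegral.integral_comp_mul_left (fun t ↦ sinc (t / 2) ^ 2) hc.ne', abs_of_pos (by positivity)]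
  rw [mul_neg, div_mul_cancel₀ _ hη.ne', smul_eq_mul, smul_eq_mul, mul_left_comm]
  gcongr
  exact ha.le

lemma integral_fejer_comp_pos {c : ℝ} (hc : 0 < c) : 0 < ∫ t, sinc (c * t / 2) ^ 2 := by
  rw [Measure.integral_comp_mul_left (fun t ↦ sinc (t / 2) ^ 2), abs_of_pos (by positivity),
    smul_eq_mul]
  exact mul_pos (by positivity) integral_fejer_pos

section

variable {f : ℝ → ℝ} {M : ℝ}

lemma measurable_of_monotone_mul_exp (hmono : Monotone fun t ↦ f t * exp t) : Measurable f := by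
  have : f = fun t ↦ (f t * exp t) * exp (-t) := by
    ext t
    rw [mul_assoc, ← exp_add, add_neg_cancel, exp_zero, mul_one]
  rw [this]
  exact hmono.measurable.mul (by fun_prop)

lemma le_mul_exp_of_monotone_mul_exp (hf0 : ∀ t, 0 ≤ f t) (hmono : Monotone fun t ↦ f t * exp t)
    {s t δ : ℝ} (hst : s ≤ t) (hδ : t - s ≤ δ) : f s ≤ f t * exp δ := by
  have h1 : f s * exp s ≤ f t * exp t := hmono hst
  have h2 : exp t ≤ exp δ * exp s := by
    rw [← exp_add, exp_le_exp]
    linarith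
  have h3 : f s * exp s ≤ f t * exp δ * exp s := by
    rw [mul_assoc]
    exact h1.trans (mul_le_mul_of_nonneg_left h2 (hf0 t))
  exact le_of_mul_le_mul_right h3 (exp_pos s)

lemma mul_mass_le_fejer_conv (hf0 : ∀ t, 0 ≤ f t) (hM : ∀ t, f t ≤ M)
    (hmono : Monotone fun t ↦ f t * exp t) {c : ℝ} (hc : 0 < c) {η u : ℝ} (hη : 0 < η)
    (hu : 0 < u) :
    f u * (∫ t in (-η)..η, sinc (c * t / 2) ^ 2) ≤
      exp (2 * η) * ∫ t in Ioi (0:ℝ), f t * sinc (c * (u + η - t) / 2) ^ 2 := by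
  have hf := measurable_of_monotone_mul_exp hmono
  have hfi (u : ℝ) : Integrable fun t ↦ f t * sinc (c * (u - t) / 2) ^ 2 :=
    (integrable_fejer_comp hc.ne' u).bdd_mul hf.aestronglyMeasurable
      (ae_of_all _ fun t ↦ by rw [norm_of_nonneg (hf0 t)]; exact hM t)
  have h := intervalIntegral.integral_comp_sub_left (a := u) (b := u + 2 * η)
    (fun t ↦ sinc (c * t / 2) ^ 2) (u + η)
  rw [show u + η - (u + 2 * η) = -η by ring, show u + η - u = η by ring] at h
  rw [← h, intervalIntegral.integral_of_le (by linarith), ← integral_const_mul,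
    ← integral_const_mul]
  refine (setIntegral_mono_on ?_ ((hfi (u + η)).const_mul _).integrableOn
    measurableSet_Ioc fun t ht ↦ ?_).trans (setIntegral_mono_set (s := Ioc u (u + 2 * η)) ?_ ?_ ?_)
  · exact ((integrable_fejer_comp hc.ne' _).const_mul _).integrableOn
  · rw [← mul_assoc, mul_comm (exp _)]
    gcongr
    exact le_mul_exp_of_monotone_mul_exp hf0 hmono ht.1.le (by linarith [ht.2])
  · exact ((hfi (u + η)).const_mul _).integrableOn
  · exact ae_of_all _ fun t ↦ mul_nonneg (exp_pos _).le (mul_nonneg (hf0 t) (sq_nonneg _))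
  · exact LE.le.eventuallyLE fun t ht ↦ hu.trans (mem_Ioc.1 ht).1

lemma fejer_conv_le (hf0 : ∀ t, 0 ≤ f t) (hM : ∀ t, f t ≤ M)
    (hmono : Monotone fun t ↦ f t * exp t) {c : ℝ} (hc : 0 < c) {η : ℝ} (u : ℝ) (hη : 0 < η) :
    ∫ t in Ioi (0:ℝ), f t * sinc (c * (u - η - t) / 2) ^ 2 ≤
      f u * exp (2 * η) * (∫ t in (-η)..η, sinc (c * t / 2) ^ 2) +
      M * ((∫ t, sinc (c * t / 2) ^ 2) - ∫ t in (-η)..η, sinc (c * t / 2) ^ 2) := by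
  have hf := measurable_of_monotone_mul_exp hmono
  have hKi := integrable_fejer_comp hc.ne' (u - η)
  have hfi : Integrable fun t ↦ f t * sinc (c * (u - η - t) / 2) ^ 2 :=
    hKi.bdd_mul hf.aestronglyMeasurable
      (ae_of_all _ fun t ↦ by rw [norm_of_nonneg (hf0 t)]; exact hM t)
  have h := intervalIntegral.integral_comp_sub_left (a := u - 2 * η) (b := u)
    (fun t ↦ sinc (c * t / 2) ^ 2) (u - η)
  rw [show u - η - (u - 2 * η) = η by ring, show u - η - u = -η by ring] at h
  rw [← h, intervalIntegral.integral_of_le (by linarith),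
    ← integral_sub_left_eq_self (fun t ↦ sinc (c * t / 2) ^ 2) volume (u - η),
    ← setIntegral_compl measurableSet_Ioc hKi, ← integral_const_mul, ← integral_const_mul]
  refine (setIntegral_le_integral hfi (ae_of_all _ fun t ↦ mul_nonneg (hf0 t) (sq_nonneg _))).trans ?_
  rw [← integral_add_compl measurableSet_Ioc hfi]
  refine add_le_add (setIntegral_mono_on hfi.integrableOn (hKi.const_mul _).integrableOn
    measurableSet_Ioc fun t ht ↦ ?_) (integral_mono hfi.integrableOn (hKi.const_mul _).integrableOn
    fun t ↦ ?_)
  · gcongr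
    exact le_mul_exp_of_monotone_mul_exp hf0 hmono ht.2 (by linarith [ht.1])
  · dsimp only
    gcongr
    exact hM t

end

theorem tendsto_of_laplace_continuousOn {f : ℝ → ℝ} (hf0 : ∀ t, 0 ≤ f t) {M : ℝ}
    (hM : ∀ t, f t ≤ M) (hmono : Monotone fun t ↦ f t * exp t) {A : ℝ} {G : ℂ → ℂ}
    (hG : ContinuousOn G {s | 0 ≤ s.re})
    (hfG : ∀ s : ℂ, 0 < s.re →
      ∫ t in Ioi (0:ℝ), (f t : ℂ) * Complex.exp (-s * t) = G s + A / s) :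
    Tendsto f atTop (𝓝 A) := by
  have hM0 : 0 ≤ M := (hf0 0).trans (hM 0)
  have hconv {c : ℝ} (hc : 0 < c) := fejer_conv_tendsto (measurable_of_monotone_mul_exp hmono)
    (M := M) (fun t ↦ by rw [abs_of_nonneg (hf0 t)]; exact hM t) hG hfG hc
  have hup {η : ℝ} (hη : 0 < η) (hη1 : η < 1) :
      ∀ᶠ u in atTop, f u ≤ exp (2 * η) * (A + η) / (1 - η) := by
    obtain ⟨c, hc, hmass⟩ := exists_fejer_mass_ge hη
    have hJ := integral_fejer_comp_pos hc
    set J := ∫ t, sinc (c * t / 2) ^ 2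
    have h1 : A * J < (A + η) * J := by nlinarith
    have h2 := (tendsto_atTop_add_const_right atTop η tendsto_id).eventually
      ((hconv hc).eventually_lt_const h1)
    filter_upwards [h2, eventually_gt_atTop 0] with u hu hu0
    have h3 := mul_mass_le_fejer_conv hf0 hM hmono hc hη hu0
    rw [le_div_iff₀ (by linarith)]
    refine le_of_mul_le_mul_right ?_ hJ
    calc f u * (1 - η) * J ≤ f u * ∫ t in (-η)..η, sinc (c * t / 2) ^ 2 := by
          rw [mul_assoc]; exact mul_le_mul_of_nonneg_left hmass (hf0 u)
      _ ≤ _ := h3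
      _ ≤ exp (2 * η) * ((A + η) * J) := by gcongr; exact hu.le
      _ = _ := by ring
  have hlo {η : ℝ} (hη : 0 < η) :
      ∀ᶠ u in atTop, (A - η - M * η) * exp (-(2 * η)) ≤ f u := by
    obtain ⟨c, hc, hmass⟩ := exists_fejer_mass_ge hη
    have hJ := integral_fejer_comp_pos hc
    set J := ∫ t, sinc (c * t / 2) ^ 2 with hJdef
    have hle : ∫ t in (-η)..η, sinc (c * t / 2) ^ 2 ≤ J := by
      rw [intervalIntegral.integral_of_le (by linarith)]
      exact setIntegral_le_integral (by simpa using (integrable_fejer_comp hc.ne' 0).comp_neg)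
        (ae_of_all _ fun t ↦ sq_nonneg _)
    have h1 : (A - η) * J < A * J := by nlinarith
    have h2 := (tendsto_atTop_add_const_right atTop (-η) tendsto_id).eventually
      ((hconv hc).eventually_const_lt h1)
    filter_upwards [h2] with u hu
    simp only [id, ← sub_eq_add_neg] at hu
    have h3 := fejer_conv_le hf0 hM hmono hc u hη
    rw [exp_neg, ← div_eq_mul_inv, div_le_iff₀ (exp_pos _)]
    refine le_of_mul_le_mul_right ?_ hJ
    have h4 : f u * exp (2 * η) * (∫ t in (-η)..η, sinc (c * t / 2) ^ 2) ≤
        f u * exp (2 * η) * J :=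
      mul_le_mul_of_nonneg_left hle (mul_nonneg (hf0 u) (exp_pos _).le)
    have h5 : M * (J - ∫ t in (-η)..η, sinc (c * t / 2) ^ 2) ≤ M * (η * J) :=
      mul_le_mul_of_nonneg_left (by linarith) hM0
    linarith
  rw [tendsto_order]
  refine ⟨fun a ha ↦ ?_, fun a ha ↦ ?_⟩
  · have hc : ContinuousAt (fun η : ℝ ↦ (A - η - M * η) * exp (-(2 * η))) 0 := by fun_prop
    have := (hc.tendsto.mono_left (nhdsWithin_le_nhds (s := Ioi 0))).eventually_const_lt
      (u := a) (by simpa using ha)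
    obtain ⟨η, h1, h2⟩ := (this.and self_mem_nhdsWithin).exists
    filter_upwards [hlo h2] with u hu using h1.trans_le hu
  · have hc : ContinuousAt (fun η : ℝ ↦ exp (2 * η) * (A + η) / (1 - η)) 0 := by
      apply ContinuousAt.div <;> first | fun_prop | simp
    have := (hc.tendsto.mono_left (nhdsWithin_le_nhds (s := Ioi 0))).eventually_lt_const
      (u := a) (by simpa using ha)
    obtain ⟨η, h1, h2⟩ := (this.and (Ioo_mem_nhdsGT zero_lt_one)).exists
    filter_upwards [hup h2.1 h2.2] with u hu using hu.trans_lt h1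

theorem tendsto_sum_div_of_LSeries_continuousOn {a : ℕ → ℝ} (ha : ∀ n, 0 ≤ a n) {C : ℝ}
    (hC : ∀ x : ℝ, 0 ≤ x → ∑ k ∈ Finset.Icc 1 ⌊x⌋₊, a k ≤ C * x) {A : ℝ} {F : ℂ → ℂ}
    (hF : ContinuousOn F {s | 1 ≤ s.re})
    (hFL : EqOn F (fun s ↦ LSeries (fun n ↦ (a n : ℂ)) s - A / (s - 1)) {s | 1 < s.re}) :
    Tendsto (fun x : ℝ ↦ (∑ k ∈ Finset.Icc 1 ⌊x⌋₊, a k) / x) atTop (𝓝 A) := by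
  set S : ℝ → ℝ := fun x ↦ ∑ k ∈ Finset.Icc 1 ⌊x⌋₊, a k with hS
  have hS0 (x : ℝ) : 0 ≤ S x := Finset.sum_nonneg fun k _ ↦ ha k
  have hSmono : Monotone S := fun x y hxy ↦ Finset.sum_le_sum_of_subset_of_nonneg
    (Finset.Icc_subset_Icc_right (Nat.floor_mono hxy)) fun k _ _ ↦ ha k
  have hO : (fun n : ℕ ↦ ∑ k ∈ Finset.Icc 1 n, a k) =O[atTop] fun n ↦ (n : ℝ) ^ (1 : ℝ) := by
    refine Asymptotics.IsBigO.of_bound C (.of_forall fun n ↦ ?_)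
    have := hC n n.cast_nonneg
    rw [Nat.floor_natCast] at this
    rw [rpow_one, norm_of_nonneg (Finset.sum_nonneg fun k _ ↦ ha k),
      norm_of_nonneg n.cast_nonneg]
    exact this
  have hlap (s : ℂ) (hs : 0 < s.re) :
      ∫ t in Ioi (0:ℝ), ((S (exp t) * exp (-t) : ℝ) : ℂ) * Complex.exp (-s * t) =
        (F (s + 1) - A) / (s + 1) + A / s := by
    have hs0 : s ≠ 0 := fun h ↦ by simp [h] at hs
    have hs1 : s + 1 ≠ 0 := fun h ↦ by
      have := congrArg Complex.re h
      simp at this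
      linarith
    have hL := LSeries_eq_mul_integral_of_nonneg a zero_le_one (s := s + 1) (by simpa using hs)
      hO ha
    have hFs := hFL (x := s + 1) (by simpa using hs)
    have himg : exp '' Ioi 0 = Ioi 1 := by
      ext x
      constructor
      · rintro ⟨t, ht, rfl⟩
        exact one_lt_exp_iff.2 ht
      · intro hx
        exact ⟨log x, log_pos hx, exp_log (zero_lt_one.trans hx)⟩
    have hcv := integral_image_eq_integral_abs_deriv_smul (s := Ioi 0) measurableSet_Ioi
      (fun x _ ↦ (Real.hasDerivAt_exp x).hasDerivWithinAt) exp_injective.injOn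
      (fun x : ℝ ↦ (S x : ℂ) * (x : ℂ) ^ (-(s + 1 + 1)))
    rw [himg] at hcv
    have hSc (t : ℝ) : (S t : ℂ) = ∑ k ∈ Finset.Icc 1 ⌊t⌋₊, (a k : ℂ) := by simp [hS]
    simp_rw [← hSc] at hL
    have e : ∫ t in Ioi (0:ℝ), ((S (exp t) * exp (-t) : ℝ) : ℂ) * Complex.exp (-s * t) =
        ∫ x in Ioi (0:ℝ), |exp x| • ((S (exp x) : ℂ) * (exp x : ℂ) ^ (-(s + 1 + 1))) := by
      congr 1 with t
      rw [abs_of_pos (exp_pos t), Complex.real_smul, Complex.ofReal_exp,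
        Complex.cpow_def_of_ne_zero (Complex.exp_ne_zero _), ← Complex.ofReal_exp,
        ← Complex.ofReal_log (exp_pos t).le, log_exp]
      push_cast
      rw [mul_left_comm, ← Complex.exp_add, mul_assoc, ← Complex.exp_add]
      ring_nf
    rw [e, ← hcv, eq_div_of_mul_eq hs1 ((mul_comm _ _).trans hL.symm), hFs]
    simp only [add_sub_cancel_right]
    field_simp
    ring
  have key := tendsto_of_laplace_continuousOn (f := fun t ↦ S (exp t) * exp (-t)) (M := C)
    (G := fun s ↦ (F (s + 1) - A) / (s + 1)) (A := A)
    (fun t ↦ mul_nonneg (hS0 _) (exp_pos _).le) (fun t ↦ ?_) ?_ ?_ hlap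
  · refine (key.comp tendsto_log_atTop).congr' ?_
    filter_upwards [eventually_gt_atTop 0] with x hx
    simp [exp_log hx, exp_neg, div_eq_mul_inv, hS]
  · rw [exp_neg, ← div_eq_mul_inv, div_le_iff₀ (exp_pos t)]
    exact hC _ (exp_pos t).le
  · have : (fun t ↦ S (exp t) * exp (-t) * exp t) = fun t ↦ S (exp t) := by
      ext t
      rw [mul_assoc, ← exp_add, neg_add_cancel, exp_zero, mul_one]
    rw [this]
    exact hSmono.comp exp_monotone
  · refine ContinuousOn.div ((hF.comp (by fun_prop) fun s hs ↦ ?_).sub continuousOn_const)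
      (by fun_prop) fun s hs h ↦ ?_
    · simpa using hs
    · have := congrArg Complex.re h
      simp at this hs
      linarith

theorem tendsto_card_mul_log_div_of_sum_log {P : ℕ → Prop} [DecidablePred P] {A : ℝ}
    (h : Tendsto (fun x : ℝ ↦ (∑ p ∈ (Finset.Ioc 0 ⌊x⌋₊ : Finset ℕ) with P p, log p) / x) atTop (𝓝 A)) :
    Tendsto (fun x : ℝ ↦ ((Finset.Ioc 0 ⌊x⌋₊).filter P).card * log x / x) atTop (𝓝 A) := by
  have hlo {x : ℝ} (hx : 1 ≤ x) : (∑ p ∈ (Finset.Ioc 0 ⌊x⌋₊ : Finset ℕ) with P p, log p) / x ≤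
      ((Finset.Ioc 0 ⌊x⌋₊).filter P).card * log x / x := by
    gcongr
    rw [← nsmul_eq_mul]
    refine Finset.sum_le_card_nsmul _ _ _ fun p hp ↦ ?_
    simp only [Finset.mem_filter, Finset.mem_Ioc] at hp
    gcongr
    · exact_mod_cast hp.1.1
    · exact (Nat.le_floor_iff (by linarith)).1 hp.1.2
  have hup {δ : ℝ} (hδ : δ ∈ Ioo 0 1) {x : ℝ} (hx : 1 ≤ x) :
      ((Finset.Ioc 0 ⌊x⌋₊).filter P).card * log x / x ≤
      (∑ p ∈ (Finset.Ioc 0 ⌊x⌋₊ : Finset ℕ) with P p, log p) / x / (1 - δ) + log x / x ^ δ := by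
    have hx0 : 0 < x := by linarith
    have h1 : ((((Finset.Ioc 0 ⌊x⌋₊).filter P).card : ℝ) - x ^ (1 - δ)) * ((1 - δ) * log x) ≤
        ∑ p ∈ (Finset.Ioc 0 ⌊x⌋₊ : Finset ℕ) with P p, log p := by
      set T := ((Finset.Ioc 0 ⌊x⌋₊).filter P).filter fun p : ℕ ↦ x ^ (1 - δ) < p
      have hcard : (((Finset.Ioc 0 ⌊x⌋₊).filter P).card : ℝ) - x ^ (1 - δ) ≤ T.card := by
        rw [← Finset.card_filter_add_card_filter_not (fun p : ℕ ↦ x ^ (1 - δ) < p)]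
        have : ((((Finset.Ioc 0 ⌊x⌋₊).filter P).filter fun p : ℕ ↦ ¬ x ^ (1 - δ) < p).card : ℝ) ≤
            x ^ (1 - δ) := by
          refine le_trans ?_ (Nat.floor_le (rpow_nonneg hx0.le _))
          rw [← Nat.card_Ioc 0 ⌊x ^ (1 - δ)⌋₊ |>.trans (Nat.sub_zero _)]
          norm_cast
          refine Finset.card_le_card fun p hp ↦ ?_
          simp only [Finset.mem_filter, Finset.mem_Ioc, not_lt] at hp ⊢
          exact ⟨hp.1.1.1, Nat.le_floor hp.2⟩
        push_cast
        linarith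
      have hlog : 0 ≤ (1 - δ) * log x := mul_nonneg (by linarith [hδ.2]) (log_nonneg hx)
      refine (mul_le_mul_of_nonneg_right hcard hlog).trans ?_
      rw [← nsmul_eq_mul]
      refine (Finset.card_nsmul_le_sum T (fun p : ℕ ↦ log p) _ fun p hp ↦ ?_).trans
        (Finset.sum_le_sum_of_subset_of_nonneg (Finset.filter_subset _ _) fun p hp _ ↦ ?_)
      · rw [← log_rpow hx0]
        exact log_le_log (rpow_pos_of_pos hx0 _) (Finset.mem_filter.1 hp).2.le
      · exact log_natCast_nonneg p
    have hδ1 : 0 < 1 - δ := by linarith [hδ.2]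
    rw [rpow_sub hx0, rpow_one] at h1
    have hxd : 0 < x ^ δ := rpow_pos_of_pos hx0 _
    rw [div_div, ← sub_le_iff_le_add, le_div_iff₀ (by positivity)]
    calc _ = _ := ?_
      _ ≤ _ := h1
    field_simp
  rw [tendsto_order]
  refine ⟨fun b hb ↦ ?_, fun b hb ↦ ?_⟩
  · filter_upwards [h.eventually_const_lt hb, eventually_ge_atTop 1] with x hx hx1
    exact hx.trans_le (hlo hx1)
  · have hc : ContinuousAt (fun δ : ℝ ↦ A / (1 - δ)) 0 := by
      apply ContinuousAt.div <;> first | fun_prop | simp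
    have := (hc.tendsto.mono_left (nhdsWithin_le_nhds (s := Ioi 0))).eventually_lt_const
      (u := b) (by simpa using hb)
    obtain ⟨δ, h1, h2⟩ := (this.and (Ioo_mem_nhdsGT zero_lt_one)).exists
    have h3 := (h.div_const (1 - δ)).add
      (isLittleO_log_rpow_atTop h2.1).tendsto_div_nhds_zero
    rw [add_zero] at h3
    filter_upwards [h3.eventually_lt_const h1, eventually_ge_atTop 1] with x hx hx1
    exact (hup h2 hx1).trans_lt hx

section PrimesInAP

open ArithmeticFunction.vonMangoldt Chebyshev

lemma residueClass_le_vonMangoldt {q : ℕ} (a : ZMod q) (n : ℕ) :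
    residueClass a n ≤ ArithmeticFunction.vonMangoldt n :=
  indicator_le_self' (fun _ _ ↦ ArithmeticFunction.vonMangoldt_nonneg) n

variable {q : ℕ} [NeZero q] {a : ZMod q}

theorem tendsto_sum_residueClass_div (ha : IsUnit a) :
    Tendsto (fun x : ℝ ↦ (∑ k ∈ Finset.Icc 1 ⌊x⌋₊, residueClass a k) / x) atTop
      (𝓝 (q.totient : ℝ)⁻¹) := by
  refine tendsto_sum_div_of_LSeries_continuousOn (residueClass_nonneg a) (C := log 4 + 4)
    (fun x hx ↦ ?_) (continuousOn_LFunctionResidueClassAux a) fun s hs ↦ ?_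
  · exact (Finset.sum_le_sum fun n _ ↦ residueClass_le_vonMangoldt a n).trans
      (psi_le_const_mul_self hx)
  · simpa using eqOn_LFunctionResidueClassAux ha hs

theorem tendsto_sum_log_prime_residueClass_div (ha : IsUnit a) :
    Tendsto (fun x : ℝ ↦ (∑ p ∈ (Finset.Ioc 0 ⌊x⌋₊ : Finset ℕ) with Nat.Prime p ∧ (p : ZMod q) = a, log p) / x)
      atTop (𝓝 (q.totient : ℝ)⁻¹) := by
  obtain ⟨C, hC⟩ := psi_sub_theta_le_mul_sqrt
  have hsplit (x : ℝ) : ∑ k ∈ Finset.Icc 1 ⌊x⌋₊, residueClass a k =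
      (∑ p ∈ (Finset.Ioc 0 ⌊x⌋₊ : Finset ℕ) with Nat.Prime p ∧ (p : ZMod q) = a, log p) +
        ∑ k ∈ Finset.Ioc 0 ⌊x⌋₊ with ¬ k.Prime, residueClass a k := by
    change ∑ k ∈ Finset.Ioc 0 ⌊x⌋₊, residueClass a k = _
    rw [← Finset.sum_filter_add_sum_filter_not _ Nat.Prime, ← Finset.filter_filter,
      Finset.sum_filter (fun p : ℕ ↦ (p : ZMod q) = a)]
    congr 1
    refine Finset.sum_congr rfl fun p hp ↦ ?_
    rw [residueClass, indicator_apply]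
    simp [ArithmeticFunction.vonMangoldt_apply_prime (Finset.mem_filter.1 hp).2]
  have hrest : Tendsto (fun x : ℝ ↦
      (∑ k ∈ Finset.Ioc 0 ⌊x⌋₊ with ¬ k.Prime, residueClass a k) / x) atTop (𝓝 0) := by
    have hlim : Tendsto (fun x : ℝ ↦ C * (√x)⁻¹) atTop (𝓝 0) := by
      simpa using (tendsto_inv_atTop_zero.comp tendsto_sqrt_atTop).const_mul C
    refine tendsto_of_tendsto_of_tendsto_of_le_of_le' tendsto_const_nhds hlim ?_ ?_
    · filter_upwards [eventually_gt_atTop 0] with x hx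
      exact div_nonneg (Finset.sum_nonneg fun k _ ↦ residueClass_nonneg a k) hx.le
    · filter_upwards [eventually_gt_atTop 0] with x hx
      rw [div_le_iff₀ hx]
      calc _ ≤ ∑ k ∈ Finset.Ioc 0 ⌊x⌋₊ with ¬ k.Prime, ArithmeticFunction.vonMangoldt k :=
            Finset.sum_le_sum fun n _ ↦ residueClass_le_vonMangoldt a n
        _ ≤ C * √x := by rw [← psi_sub_theta_eq_sum_not_prime]; exact hC x
        _ = C * (√x)⁻¹ * x := by
            have := sqrt_pos.2 hx
            field_simp
            rw [sq_sqrt hx.le]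
  have := (tendsto_sum_residueClass_div ha).sub hrest
  rw [sub_zero] at this
  refine this.congr fun x ↦ ?_
  rw [hsplit]
  ring

theorem tendsto_card_prime_residueClass (ha : IsUnit a) :
    Tendsto (fun x : ℝ ↦
        ((Finset.Ioc 0 ⌊x⌋₊).filter fun p : ℕ ↦ p.Prime ∧ (p : ZMod q) = a).card * log x / x)
      atTop (𝓝 (q.totient : ℝ)⁻¹) :=
  tendsto_card_mul_log_div_of_sum_log (tendsto_sum_log_prime_residueClass_div ha)

end PrimesInAP

end Tauberian

section QuadraticCharacter

open NumberTheorySymbols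

lemma jacobiSym_sq_mul {s n : ℕ} (hsn : s.Coprime n) (d : ℤ) :
    J((s : ℤ) ^ 2 * d | n) = J(d | n) := by
  rw [jacobiSym.mul_left, jacobiSym.sq_one' (by simpa using hsn), one_mul]

lemma exists_jacobiSym_eq_neg_one_of_odd_prime {s l : ℕ} (hl : l.Prime) (hl2 : l ≠ 2) (c : ℤ)
    (hlc : ¬ l ∣ c.natAbs) (hs : s ≠ 0) :
    ∃ n : ℕ, n.Coprime (4 * (s ^ 2 * l * c.natAbs)) ∧ J((s : ℤ) ^ 2 * (l * c) | n) = -1 := by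
  have : Fact l.Prime := ⟨hl⟩
  obtain ⟨r, hr⟩ := FiniteField.exists_nonsquare (F := ZMod l) (by rwa [ZMod.ringChar_zmod_n])
  set m := c.natAbs with hm
  have hm0 : m ≠ 0 := fun h ↦ hlc (h ▸ dvd_zero l)
  set B := 4 * (s ^ 2 * l * m) with hB
  have hB0 : B ≠ 0 := by positivity [hl.ne_zero]
  have hcop : l.Coprime (ordCompl[l] B) := Nat.coprime_ordCompl hl hB0
  have hl4 : l.Coprime 4 := by
    rw [show 4 = 2 ^ 2 by norm_num]
    exact ((Nat.coprime_primes hl Nat.prime_two).mpr hl2).pow_right 2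
  have hdvd : 4 * m ∣ ordCompl[l] B := by
    have h1 : 4 * m ∣ l ^ B.factorization l * ordCompl[l] B := by
      rw [Nat.ordProj_mul_ordCompl_eq_self]
      exact ⟨s ^ 2 * l, by rw [hB]; ring⟩
    refine Nat.Coprime.dvd_of_dvd_mul_left (Nat.Coprime.pow_right _ ?_) h1
    exact (hl4.mul_right ((Nat.Prime.coprime_iff_not_dvd hl).mpr hlc)).symm
  obtain ⟨n, hnl, hnN⟩ := Nat.chineseRemainder hcop r.val 1
  have hnr : (n : ZMod l) = r := by
    rw [(ZMod.natCast_eq_natCast_iff _ _ _).mpr hnl, ZMod.natCast_zmod_val]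
  have hn4m : n ≡ 1 [MOD 4 * m] := hnN.of_dvd hdvd
  have hn4 : n % 4 = 1 := hn4m.of_dvd (dvd_mul_right _ _)
  have hnodd : Odd n := Nat.odd_iff.mpr (by omega)
  have hnB : n.Coprime B := by
    rw [← Nat.ordProj_mul_ordCompl_eq_self B l]
    refine Nat.Coprime.mul_right (Nat.Coprime.pow_right _ ?_) ?_
    · refine ((Nat.Prime.coprime_iff_not_dvd hl).mpr fun h ↦ hr ?_).symm
      rw [← hnr, (ZMod.natCast_eq_zero_iff _ _).mpr h]
      exact IsSquare.zero
    · have := hnN.gcd_eq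
      simpa [Nat.Coprime] using this
  refine ⟨n, hnB, ?_⟩
  have hsn : s.Coprime n := (hnB.coprime_dvd_right ⟨4 * s * l * m, by rw [hB]; ring⟩).symm
  rw [jacobiSym_sq_mul hsn, jacobiSym.mul_left, jacobiSym.mod_right c hnodd, ← hm,
    show n % (4 * m) = 1 from ?_, jacobiSym.one_right, mul_one,
    jacobiSym.quadratic_reciprocity_one_mod_four' (hl.odd_of_ne_two hl2) hn4,
    ZMod.nonsquare_iff_jacobiSym_eq_neg_one]
  · simpa [hnr] using hr
  · exact Eq.trans hn4m (Nat.mod_eq_of_lt (by omega))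

lemma exists_jacobiSym_eq_neg_one_of_prime {s : ℕ} (hs : s ≠ 0) {d : ℤ}
    (hd : d = -1 ∨ d = 2 ∨ d = -2) :
    ∃ n : ℕ, n.Coprime (4 * (s ^ 2 * d.natAbs)) ∧ J((s : ℤ) ^ 2 * d | n) = -1 := by
  have hd0 : d.natAbs ≠ 0 := by rcases hd with rfl | rfl | rfl <;> norm_num
  have hB0 : 4 * (s ^ 2 * d.natAbs) ≠ 0 := by positivity
  obtain ⟨a, ha, hJ⟩ : ∃ a : ℕ, a.Coprime 8 ∧ ∀ p : ℕ, Odd p → p ≡ a [MOD 8] → J(d | p) = -1 := by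
    rcases hd with rfl | rfl | rfl
    · refine ⟨3, by norm_num, fun p hp h ↦ ?_⟩
      rw [jacobiSym.at_neg_one hp]
      exact ZMod.χ₄_nat_three_mod_four (h.of_dvd (by norm_num : 4 ∣ 8))
    · refine ⟨3, by norm_num, fun p hp h ↦ ?_⟩
      rw [jacobiSym.at_two hp, ZMod.χ₈_nat_mod_eight, h]
      decide
    · refine ⟨5, by norm_num, fun p hp h ↦ ?_⟩
      rw [jacobiSym.at_neg_two hp, ZMod.χ₈'_nat_eq_if_mod_eight, h, Nat.odd_iff.mp hp]
      decide
  obtain ⟨p, hpB, hp, hpa⟩ :=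
    Nat.forall_exists_prime_gt_and_modEq (4 * (s ^ 2 * d.natAbs)) (by norm_num : 8 ≠ 0) ha
  have hcop : p.Coprime (4 * (s ^ 2 * d.natAbs)) :=
    Nat.coprime_of_lt_prime hB0 hpB hp
  refine ⟨p, hcop, ?_⟩
  have hsp : s.Coprime p := (hcop.coprime_dvd_right ⟨4 * s * d.natAbs, by ring⟩).symm
  rw [jacobiSym_sq_mul hsp]
  exact hJ p (hp.odd_of_ne_two (by have := Nat.pos_of_ne_zero hB0; omega)) hpa

lemma exists_jacobiSym_eq_neg_one {D : ℤ} (hD : ¬ ∃ m : ℤ, D = m ^ 2) :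
    ∃ n : ℕ, n.Coprime (4 * D.natAbs) ∧ J(D | n) = -1 := by
  have hD0 : D.natAbs ≠ 0 := fun h ↦ hD ⟨0, by simpa using h⟩
  obtain ⟨e, s, he, hs, hes, hsq⟩ := Nat.sq_mul_squarefree_of_pos (Nat.pos_of_ne_zero hD0)
  obtain ⟨d, hde, hDd⟩ : ∃ d : ℤ, d.natAbs = e ∧ D = (s : ℤ) ^ 2 * d := by
    have hc : ((s : ℤ) ^ 2 * e) = D.natAbs := by exact_mod_cast hes
    rcases Int.natAbs_eq D with h | h
    · exact ⟨e, by simp, by rw [hc]; exact h⟩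
    · exact ⟨-e, by simp, by rw [mul_neg, hc]; exact h⟩
  by_cases hl : ∃ l : ℕ, l.Prime ∧ l ≠ 2 ∧ l ∣ e
  · obtain ⟨l, hlp, hl2, hle⟩ := hl
    obtain ⟨c, rfl⟩ : (l : ℤ) ∣ d := Int.natCast_dvd.mpr (hde ▸ hle)
    have hlc : ¬ l ∣ c.natAbs := by
      rintro ⟨k, hk⟩
      rw [Int.natAbs_mul, hk, Int.natAbs_natCast] at hde
      exact hlp.not_isUnit (hsq l ⟨k, by rw [← hde]; ring⟩)
    obtain ⟨n, hn, hJ⟩ := exists_jacobiSym_eq_neg_one_of_odd_prime hlp hl2 c hlc hs.ne'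
    refine ⟨n, ?_, hDd ▸ hJ⟩
    rwa [hDd, Int.natAbs_mul, Int.natAbs_mul, Int.natAbs_pow, Int.natAbs_natCast,
      Int.natAbs_natCast, ← mul_assoc (s ^ 2)]
  · push Not at hl
    have he2 : e ∣ 2 := by
      rw [← Nat.prod_primeFactors_of_squarefree hsq]
      refine (Finset.prod_dvd_prod_of_subset e.primeFactors {2} id fun l hl' ↦ ?_).trans (by simp)
      by_contra h
      rw [Nat.mem_primeFactors] at hl'
      exact hl l hl'.1 (by simpa using h) hl'.2.1
    have hd : d = -1 ∨ d = 2 ∨ d = -2 := by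
      rcases (Nat.dvd_prime Nat.prime_two).mp he2 with h | h
      · rcases Int.natAbs_eq_iff.mp (hde.trans h) with h' | h'
        · exact (hD ⟨s, by rw [hDd, h']; simp⟩).elim
        · exact Or.inl (by simpa using h')
      · exact Or.inr (by simpa using Int.natAbs_eq_iff.mp (hde.trans h))
    obtain ⟨n, hn, hJ⟩ := exists_jacobiSym_eq_neg_one_of_prime hs.ne' hd
    refine ⟨n, ?_, hDd ▸ hJ⟩
    rwa [hDd, Int.natAbs_mul, Int.natAbs_pow, Int.natAbs_natCast]

lemma odd_val_units {q : ℕ} (hq : 2 ∣ q) (u : (ZMod q)ˣ) : Odd (u : ZMod q).val :=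
  Nat.coprime_two_right.mp ((ZMod.val_coe_unit_coprime u).coprime_dvd_right hq)

lemma jacobiSym_val_units_mul {D : ℤ} (u v : (ZMod (4 * D.natAbs))ˣ) :
    J(D | ((u * v : (ZMod (4 * D.natAbs))ˣ) : ZMod (4 * D.natAbs)).val) =
      J(D | (u : ZMod (4 * D.natAbs)).val) * J(D | (v : ZMod (4 * D.natAbs)).val) := by
  have h2 : 2 ∣ 4 * D.natAbs := ⟨2 * D.natAbs, by ring⟩
  have hu := odd_val_units h2 u
  have hv := odd_val_units h2 v
  rw [Units.val_mul, ZMod.val_mul, ← jacobiSym.mod_right D (hu.mul hv),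
    jacobiSym.mul_right' D hu.pos.ne' hv.pos.ne']

lemma jacobiSym_val_units_eq_one_or {D : ℤ} (u : (ZMod (4 * D.natAbs))ˣ) :
    J(D | (u : ZMod (4 * D.natAbs)).val) = 1 ∨ J(D | (u : ZMod (4 * D.natAbs)).val) = -1 :=
  jacobiSym.eq_one_or_neg_one
    ((ZMod.val_coe_unit_coprime u).coprime_dvd_right (dvd_mul_left _ _)).symm

lemma two_mul_card_jacobiSym_eq_one {D : ℤ} [NeZero (4 * D.natAbs)]
    (hD : ¬ ∃ m : ℤ, D = m ^ 2) :
    2 * (Finset.univ.filter fun u : (ZMod (4 * D.natAbs))ˣ ↦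
      J(D | (u : ZMod (4 * D.natAbs)).val) = 1).card = (4 * D.natAbs).totient := by
  obtain ⟨n, hn, hJ⟩ := exists_jacobiSym_eq_neg_one hD
  have hb : J(D | (ZMod.unitOfCoprime n hn : ZMod (4 * D.natAbs)).val) = -1 := by
    have hno : Odd n := Nat.coprime_two_right.mp
      (hn.coprime_dvd_right ⟨2 * D.natAbs, by ring⟩)
    rw [ZMod.coe_unitOfCoprime, ZMod.val_natCast, ← jacobiSym.mod_right D hno, hJ]
  rw [← ZMod.card_units_eq_totient, ← Finset.card_univ,
    ← Finset.card_filter_add_card_filter_not (s := Finset.univ)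
      (fun u : (ZMod (4 * D.natAbs))ˣ ↦ J(D | (u : ZMod (4 * D.natAbs)).val) = 1), two_mul,
    add_right_inj]
  refine Finset.card_equiv (Equiv.mulLeft (ZMod.unitOfCoprime n hn)) fun u ↦ ?_
  simp only [Finset.mem_filter, Finset.mem_univ, true_and, Equiv.coe_mulLeft,
    jacobiSym_val_units_mul, hb]
  rcases jacobiSym_val_units_eq_one_or u with h | h <;> simp [h]

end QuadraticCharacter

lemma chiDp_eq_one_iff {D : ℤ} [NeZero (4 * D.natAbs)] {p : ℕ} (hp : p.Prime) (hp2 : p ≠ 2) :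
    chiDp D p = 1 ↔ ∃ u : (ZMod (4 * D.natAbs))ˣ,
      jacobiSym D (u : ZMod (4 * D.natAbs)).val = 1 ∧ (p : ZMod (4 * D.natAbs)) = u := by
  have : Fact p.Prime := ⟨hp⟩
  have hodd := hp.odd_of_ne_two hp2
  rw [chiDp, if_neg hp2, dif_pos hp, jacobiSym.legendreSym.to_jacobiSym]
  constructor
  · intro h
    have hgcd : D.gcd p = 1 := by
      by_contra hne
      have := jacobiSym.eq_zero_iff_not_coprime.mpr hne
      omega
    have hcop : p.Coprime (4 * D.natAbs) := by
      refine Nat.Coprime.mul_right ?_ (Nat.Coprime.symm (by simpa [Int.gcd] using hgcd))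
      exact (Nat.coprime_two_right.mpr hodd).pow_right 2
    refine ⟨ZMod.unitOfCoprime p hcop, ?_, by simp⟩
    rwa [ZMod.coe_unitOfCoprime, ZMod.val_natCast, ← jacobiSym.mod_right D hodd]
  · rintro ⟨u, hu, hpu⟩
    rwa [← hpu, ZMod.val_natCast, ← jacobiSym.mod_right D hodd] at hu

lemma tendsto_card_prime_jacobiSym {D : ℤ} [NeZero (4 * D.natAbs)]
    (hD : ¬ ∃ m : ℤ, D = m ^ 2) :
    Tendsto (fun x : ℝ ↦ ((Finset.Ioc 0 ⌊x⌋₊).filter fun p : ℕ ↦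
        p.Prime ∧ ∃ u : (ZMod (4 * D.natAbs))ˣ,
          jacobiSym D (u : ZMod (4 * D.natAbs)).val = 1 ∧
            (p : ZMod (4 * D.natAbs)) = u).card * log x / x) atTop (nhds (1 / 2)) := by
  classical
  set U := Finset.univ.filter fun u : (ZMod (4 * D.natAbs))ˣ ↦
    jacobiSym D (u : ZMod (4 * D.natAbs)).val = 1 with hU
  have key := tendsto_finsetSum U fun u _ ↦
    tendsto_card_prime_residueClass (q := 4 * D.natAbs) u.isUnit
  have hlim : ∑ _u ∈ U, ((4 * D.natAbs).totient : ℝ)⁻¹ = 1 / 2 := by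
    have h2 : (2 * U.card : ℝ) = (4 * D.natAbs).totient := by
      exact_mod_cast two_mul_card_jacobiSym_eq_one hD
    have hpos : (0 : ℝ) < (4 * D.natAbs).totient := by
      exact_mod_cast Nat.totient_pos.mpr (NeZero.pos _)
    rw [Finset.sum_const, nsmul_eq_mul, ← div_eq_mul_inv, div_eq_div_iff hpos.ne' two_ne_zero]
    linarith
  rw [hlim] at key
  refine key.congr fun x ↦ ?_
  rw [← Finset.sum_div, ← Finset.sum_mul, ← Nat.cast_sum, ← Finset.card_biUnion]
  · congr! 4
    ext p
    simp only [Finset.mem_biUnion, Finset.mem_filter, hU, Finset.mem_univ, true_and]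
    tauto
  · intro u _ v _ huv
    refine Finset.disjoint_left.mpr fun p hpu hpv ↦ huv (Units.ext ?_)
    rw [← (Finset.mem_filter.mp hpu).2.2, (Finset.mem_filter.mp hpv).2.2]

theorem stmt9 (D : ℤ) (hns : ¬ ∃ m : ℤ, D = m ^ 2) (hdisc : D % 4 = 0 ∨ D % 4 = 1) :
    Tendsto (fun x : ℝ =>
        (Set.ncard {p : ℕ | p.Prime ∧ (p : ℝ) ≤ x ∧ chiDp D p = 1} : ℝ) * Real.log x / x)
      atTop (nhds (1 / 2)) := by
  have : NeZero (4 * D.natAbs) :=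
    ⟨mul_ne_zero four_ne_zero fun h ↦ hns ⟨0, by simpa using h⟩⟩
  have key := tendsto_card_prime_jacobiSym hns
  have herr : Tendsto (fun x : ℝ ↦ log x / x) atTop (nhds 0) :=
    isLittleO_log_id_atTop.tendsto_div_nhds_zero
  have key' := key.add herr
  rw [add_zero] at key'
  set A : ℝ → Finset ℕ := fun x ↦ (Finset.Ioc 0 ⌊x⌋₊).filter fun p : ℕ ↦
    p.Prime ∧ ∃ u : (ZMod (4 * D.natAbs))ˣ, jacobiSym D (u : ZMod (4 * D.natAbs)).val = 1 ∧
      (p : ZMod (4 * D.natAbs)) = u with hA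
  have hmem : ∀ {x : ℝ}, 1 ≤ x → ∀ {p : ℕ}, p ≠ 2 →
      (p ∈ A x ↔ p ∈ {p : ℕ | p.Prime ∧ (p : ℝ) ≤ x ∧ chiDp D p = 1}) := by
    intro x hx p hp2
    simp only [hA, Finset.mem_filter, Finset.mem_Ioc, Set.mem_ofPred_eq,
      Nat.le_floor_iff (zero_le_one.trans hx)]
    constructor
    · rintro ⟨⟨-, hpx⟩, hp, h⟩
      exact ⟨hp, hpx, (chiDp_eq_one_iff hp hp2).mpr h⟩
    · rintro ⟨hp, hpx, h⟩
      exact ⟨⟨hp.pos, hpx⟩, hp, (chiDp_eq_one_iff hp hp2).mp h⟩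
  have h2 : ∀ x, 2 ∉ A x := by
    intro x h
    obtain ⟨-, -, u, -, hu⟩ := Finset.mem_filter.mp h
    have hc := (ZMod.isUnit_iff_coprime 2 (4 * D.natAbs)).mp (hu ▸ u.isUnit)
    exact absurd (hc.coprime_dvd_right ⟨2 * D.natAbs, by ring⟩ : Nat.Coprime 2 2) (by norm_num)
  refine tendsto_of_tendsto_of_tendsto_of_le_of_le' key key' ?_ ?_ <;>
    filter_upwards [eventually_ge_atTop 1] with x hx
  all_goals
    have hfin : {p : ℕ | p.Prime ∧ (p : ℝ) ≤ x ∧ chiDp D p = 1} ⊆ (insert 2 (A x) : Finset ℕ) := by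
      intro p hp
      by_cases hp2 : p = 2
      · simp [hp2]
      · simp [(hmem hx hp2).mpr hp]
    have hlog := log_nonneg hx
  · have : (A x).card ≤ {p : ℕ | p.Prime ∧ (p : ℝ) ≤ x ∧ chiDp D p = 1}.ncard := by
      rw [← Set.ncard_coe_finset]
      exact Set.ncard_le_ncard
        (fun p hp ↦ (hmem hx (by rintro rfl; exact h2 x hp)).mp hp)
        ((Finset.finite_toSet _).subset hfin)
    gcongr
  · have : {p : ℕ | p.Prime ∧ (p : ℝ) ≤ x ∧ chiDp D p = 1}.ncard ≤ (A x).card + 1 := by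
      refine (Set.ncard_le_ncard hfin (Finset.finite_toSet _)).trans ?_
      rw [Set.ncard_coe_finset]
      exact Finset.card_insert_le _ _
    rw [← add_div, ← add_one_mul]
    gcongr
    exact_mod_cast this
end

section
/- Let D be a nonsquare integer with D ≡ 0 or 1 (mod 4). For every integer m ≥ 0 there is a constant C_m such that for all x ≥ 2, |#{p ≤ x : p prime, χ_D(p) = 1} - (1/2)·∫_2^x dt/log t| ≤ C_m·x/(log x)^m. -/
open Filter Real

/-- The half-strips `1 < re s ≤ 3`, `1 ≤ |im s|`. -/
def stripRegion : Set ℂ := {s | 1 < s.re ∧ s.re ≤ 3 ∧ 1 ≤ |s.im|}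

/-- A logarithmic measure of the height of `s`. -/
noncomputable def logHeight (s : ℂ) : ℝ := Real.log (|s.im| + 10)

lemma two_le_log_ten : (2 : ℝ) ≤ Real.log 10 := by
  rw [Real.le_log_iff_exp_le (by norm_num)]
  have := Real.exp_one_lt_d9
  have h : Real.exp 2 = Real.exp 1 * Real.exp 1 := by rw [← Real.exp_add]; norm_num
  rw [h]; nlinarith [Real.exp_pos 1]

lemma two_le_logHeight (s : ℂ) : 2 ≤ logHeight s :=
  two_le_log_ten.trans (Real.log_le_log (by norm_num) (by linarith [abs_nonneg s.im]))

lemma one_le_logHeight (s : ℂ) : 1 ≤ logHeight s := by linarith [two_le_logHeight s]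

/-- `f` is bounded by a power of the logarithm of the height on `stripRegion`. -/
def PolyLogBdd (f : ℂ → ℂ) : Prop :=
  ∃ C : ℝ, ∃ B : ℕ, 0 ≤ C ∧ ∀ s ∈ stripRegion, ‖f s‖ ≤ C * logHeight s ^ B

namespace PolyLogBdd

variable {f g : ℂ → ℂ}

lemma congr (hf : PolyLogBdd f) (h : ∀ s ∈ stripRegion, g s = f s) : PolyLogBdd g := by
  obtain ⟨C, B, hC, H⟩ := hf
  exact ⟨C, B, hC, fun s hs ↦ by rw [h s hs]; exact H s hs⟩

lemma const (c : ℂ) : PolyLogBdd fun _ ↦ c := ⟨‖c‖, 0, norm_nonneg _, by simp⟩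

lemma mul (hf : PolyLogBdd f) (hg : PolyLogBdd g) : PolyLogBdd fun s ↦ f s * g s := by
  obtain ⟨C, B, hC, H⟩ := hf
  obtain ⟨C', B', hC', H'⟩ := hg
  refine ⟨C * C', B + B', by positivity, fun s hs ↦ ?_⟩
  have := one_le_logHeight s
  calc ‖f s * g s‖ = ‖f s‖ * ‖g s‖ := norm_mul _ _
    _ ≤ (C * logHeight s ^ B) * (C' * logHeight s ^ B') := by
      gcongr
      · exact H s hs
      · exact H' s hs
    _ = _ := by ring

lemma add (hf : PolyLogBdd f) (hg : PolyLogBdd g) : PolyLogBdd fun s ↦ f s + g s := by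
  obtain ⟨C, B, hC, H⟩ := hf
  obtain ⟨C', B', hC', H'⟩ := hg
  refine ⟨C + C', B + B', by positivity, fun s hs ↦ ?_⟩
  have := one_le_logHeight s
  calc ‖f s + g s‖ ≤ ‖f s‖ + ‖g s‖ := norm_add_le _ _
    _ ≤ C * logHeight s ^ B + C' * logHeight s ^ B' := add_le_add (H s hs) (H' s hs)
    _ ≤ C * logHeight s ^ (B + B') + C' * logHeight s ^ (B + B') := by
      gcongr <;> omega
    _ = _ := by ring

lemma neg (hf : PolyLogBdd f) : PolyLogBdd fun s ↦ -f s := by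
  obtain ⟨C, B, hC, H⟩ := hf
  exact ⟨C, B, hC, fun s hs ↦ by rw [norm_neg]; exact H s hs⟩

lemma sum {ι : Type*} (t : Finset ι) {F : ι → ℂ → ℂ} (h : ∀ i ∈ t, PolyLogBdd (F i)) :
    PolyLogBdd fun s ↦ ∑ i ∈ t, F i s := by
  classical
  induction t using Finset.induction_on with
  | empty => simpa using const 0
  | insert a t ha ih =>
    simp only [Finset.sum_insert ha]
    exact (h a (by simp)).add (ih fun i hi ↦ h i (by simp [hi]))

end PolyLogBdd

lemma isOpen_one_lt_re : IsOpen {s : ℂ | 1 < s.re} :=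
  isOpen_lt continuous_const Complex.continuous_re

lemma contDiffAt_of_differentiableOn_half_plane {f : ℂ → ℂ} {s : ℂ} {n : WithTop ℕ∞}
    (hf : DifferentiableOn ℂ f {s | 1 < s.re}) (hs : 1 < s.re) : ContDiffAt ℂ n f s :=
  (hf.analyticAt (isOpen_one_lt_re.mem_nhds hs)).contDiffAt

lemma PolyLogBdd.iteratedDeriv_mul_of_le {f g : ℂ → ℂ} {n : ℕ}
    (df : DifferentiableOn ℂ f {s | 1 < s.re}) (dg : DifferentiableOn ℂ g {s | 1 < s.re})
    (hf : ∀ k ≤ n, PolyLogBdd (iteratedDeriv k f)) (hg : ∀ k ≤ n, PolyLogBdd (iteratedDeriv k g)) :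
    ∀ k ≤ n, PolyLogBdd (iteratedDeriv k (f * g)) := fun k hk ↦ by
  refine PolyLogBdd.congr (PolyLogBdd.sum (Finset.range (k + 1))
    (F := fun i s ↦ k.choose i * iteratedDeriv i f s * iteratedDeriv (k - i) g s)
    fun i hi ↦ ((PolyLogBdd.const _).mul (hf i ?_)).mul (hg (k - i) (by omega))) fun s hs ↦ ?_
  · rw [Finset.mem_range] at hi; omega
  · exact iteratedDeriv_mul (contDiffAt_of_differentiableOn_half_plane df hs.1)
      (contDiffAt_of_differentiableOn_half_plane dg hs.1)

/-- `f` is holomorphic on `1 < re s` with all derivatives of polylogarithmic growth. -/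
def IsTame (f : ℂ → ℂ) : Prop :=
  DifferentiableOn ℂ f {s | 1 < s.re} ∧ ∀ k, PolyLogBdd (iteratedDeriv k f)

lemma iteratedDeriv_congr_half_plane {f g : ℂ → ℂ} (h : ∀ s : ℂ, 1 < s.re → f s = g s) (k : ℕ)
    {s : ℂ} (hs : 1 < s.re) : iteratedDeriv k f s = iteratedDeriv k g s :=
  Filter.EventuallyEq.iteratedDeriv_eq k
    (Filter.eventually_of_mem (isOpen_one_lt_re.mem_nhds hs) h)

namespace IsTame

variable {f g : ℂ → ℂ}

lemma congr (hf : IsTame f) (h : ∀ s : ℂ, 1 < s.re → g s = f s) : IsTame g :=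
  ⟨hf.1.congr h, fun k ↦ (hf.2 k).congr fun _ hs ↦ iteratedDeriv_congr_half_plane h k hs.1⟩

lemma deriv (hf : IsTame f) : IsTame (deriv f) :=
  ⟨hf.1.deriv isOpen_one_lt_re, fun k ↦ by rw [← iteratedDeriv_succ']; exact hf.2 (k + 1)⟩

lemma mul (hf : IsTame f) (hg : IsTame g) : IsTame (f * g) :=
  ⟨hf.1.mul hg.1, fun k ↦ PolyLogBdd.iteratedDeriv_mul_of_le hf.1 hg.1 (fun i _ ↦ hf.2 i)
    (fun i _ ↦ hg.2 i) k le_rfl⟩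

lemma neg (hf : IsTame f) : IsTame (-f) :=
  ⟨hf.1.neg, fun k ↦ (hf.2 k).neg.congr fun _ _ ↦ by rw [iteratedDeriv_neg]⟩

lemma add (hf : IsTame f) (hg : IsTame g) : IsTame (f + g) :=
  ⟨hf.1.add hg.1, fun k ↦ ((hf.2 k).add (hg.2 k)).congr fun _ hs ↦
    iteratedDeriv_add (contDiffAt_of_differentiableOn_half_plane hf.1 hs.1)
      (contDiffAt_of_differentiableOn_half_plane hg.1 hs.1)⟩

lemma const_mul (hf : IsTame f) (c : ℂ) : IsTame (fun s ↦ c * f s) :=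
  ⟨hf.1.const_mul c, fun k ↦ ((PolyLogBdd.const c).mul (hf.2 k)).congr fun _ _ ↦
    iteratedDeriv_const_mul_field c f⟩

lemma inv (hf : IsTame f) (h0 : ∀ s : ℂ, 1 < s.re → f s ≠ 0) (h : PolyLogBdd (f⁻¹)) :
    IsTame f⁻¹ := by
  have dfi : DifferentiableOn ℂ f⁻¹ {s | 1 < s.re} := hf.1.inv h0
  refine ⟨dfi, fun k ↦ ?_⟩
  suffices ∀ n, ∀ k ≤ n, PolyLogBdd (iteratedDeriv k f⁻¹) from this k k le_rfl
  intro n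
  induction n with
  | zero => intro k hk; obtain rfl : k = 0 := by omega
            simpa using h
  | succ n ih =>
    intro k hk
    rcases Nat.lt_or_ge k (n + 1) with hk' | hk'
    · exact ih k (by omega)
    obtain rfl : k = n + 1 := by omega
    rw [iteratedDeriv_succ']
    have h1 := PolyLogBdd.iteratedDeriv_mul_of_le hf.deriv.neg.1 dfi
      (fun i _ ↦ hf.deriv.neg.2 i) ih
    have h2 := PolyLogBdd.iteratedDeriv_mul_of_le (hf.deriv.neg.1.mul dfi) dfi h1 ih n le_rfl
    refine h2.congr fun s hs ↦ iteratedDeriv_congr_half_plane (fun s hs ↦ ?_) n hs.1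
    have := hf.1.differentiableAt (isOpen_one_lt_re.mem_nhds hs)
    rw [deriv_inv'' this (h0 s hs)]
    simp [div_eq_mul_inv, pow_two, mul_assoc]

end IsTame

section PartialSums

variable {f : ℕ → ℂ} {c : ℂ} {K : ℝ}

/-- The increment from `M` to `u` of the error term in `∑ k ≤ u, f k = c * u + error`. -/
noncomputable def errorTail (f : ℕ → ℂ) (c : ℂ) (M : ℕ) (u : ℝ) : ℂ :=
  if (M : ℝ) ≤ u then
    (∑ k ∈ Finset.Icc 1 ⌊u⌋₊, f k - c * u) - (∑ k ∈ Finset.Icc 1 M, f k - c * M)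
  else 0

lemma measurable_errorTail (M : ℕ) : Measurable (errorTail f c M) := by
  unfold errorTail
  refine Measurable.ite (measurableSet_le measurable_const measurable_id) ?_ measurable_const
  refine Measurable.sub (Measurable.sub ?_ ?_) measurable_const
  · exact (measurable_from_nat (f := fun n ↦ ∑ k ∈ Finset.Icc 1 n, f k)).comp Nat.measurable_floor
  · exact measurable_const.mul Complex.measurable_ofReal

lemma norm_errorTail_le (hK : ∀ n : ℕ, ‖∑ k ∈ Finset.Icc 1 n, f k - c * n‖ ≤ K) (M : ℕ) (u : ℝ) :
    ‖errorTail f c M u‖ ≤ 2 * K + ‖c‖ := by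
  have hK0 : 0 ≤ K := (norm_nonneg _).trans (hK 0)
  unfold errorTail
  split_ifs with h
  · have hu : 0 ≤ u := M.cast_nonneg.trans h
    have e : (∑ k ∈ Finset.Icc 1 ⌊u⌋₊, f k - c * u) - (∑ k ∈ Finset.Icc 1 M, f k - c * M)
        = (∑ k ∈ Finset.Icc 1 ⌊u⌋₊, f k - c * ⌊u⌋₊) - (∑ k ∈ Finset.Icc 1 M, f k - c * M)
          - c * ((u - ⌊u⌋₊ : ℝ) : ℂ) := by push_cast; ring
    rw [e]
    have h1 : ‖c * ((u - ⌊u⌋₊ : ℝ) : ℂ)‖ ≤ ‖c‖ := by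
      rw [norm_mul, Complex.norm_real, Real.norm_eq_abs, abs_of_nonneg
        (by linarith [Nat.floor_le hu])]
      exact mul_le_of_le_one_right (norm_nonneg _) (by linarith [Nat.lt_floor_add_one u])
    calc _ ≤ _ := norm_sub_le _ _
      _ ≤ _ := add_le_add (norm_sub_le _ _) h1
      _ ≤ _ := by linarith [hK M, hK ⌊u⌋₊]
  · rw [norm_zero]; positivity

lemma errorTail_of_lt {M : ℕ} {u : ℝ} (h : u < M) : errorTail f c M u = 0 := if_neg h.not_ge

lemma locallyIntegrableOn_errorTail (hK : ∀ n : ℕ, ‖∑ k ∈ Finset.Icc 1 n, f k - c * n‖ ≤ K)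
    (M : ℕ) : MeasureTheory.LocallyIntegrableOn (errorTail f c M) (Set.Ioi 0) :=
  ((MeasureTheory.locallyIntegrable_const (2 * K + ‖c‖ : ℝ)).mono
    (measurable_errorTail M).aestronglyMeasurable (MeasureTheory.ae_of_all _ fun u ↦
      (norm_errorTail_le hK M u).trans (le_abs_self _))).locallyIntegrableOn _

lemma errorTail_isBigO_top (hK : ∀ n : ℕ, ‖∑ k ∈ Finset.Icc 1 n, f k - c * n‖ ≤ K) (M : ℕ) :
    errorTail f c M =O[atTop] (fun x : ℝ ↦ x ^ (-(0 : ℝ))) :=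
  Asymptotics.isBigO_of_le' (c := 2 * K + ‖c‖) _ fun u ↦ by
    simpa using norm_errorTail_le hK M u

lemma errorTail_isBigO_zero {M : ℕ} (hM : 1 ≤ M) (b : ℝ) :
    errorTail f c M =O[nhdsWithin 0 (Set.Ioi 0)] (fun x : ℝ ↦ x ^ (-b)) := by
  refine Asymptotics.IsBigO.of_bound 0 ?_
  filter_upwards [nhdsWithin_le_nhds (Iio_mem_nhds zero_lt_one)] with u hu
  rw [errorTail_of_lt (lt_of_lt_of_le hu (by exact_mod_cast hM))]; simp

lemma mellinConvergent_errorTail (hK : ∀ n : ℕ, ‖∑ k ∈ Finset.Icc 1 n, f k - c * n‖ ≤ K)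
    {M : ℕ} (hM : 1 ≤ M) {s : ℂ} (hs : 0 < s.re) : MellinConvergent (errorTail f c M) (-s) :=
  mellinConvergent_of_isBigO_rpow (locallyIntegrableOn_errorTail hK M)
    (errorTail_isBigO_top hK M) (by simpa using hs) (errorTail_isBigO_zero hM (-s.re - 1))
    (by simp)

lemma differentiableAt_mellin_errorTail
    (hK : ∀ n : ℕ, ‖∑ k ∈ Finset.Icc 1 n, f k - c * n‖ ≤ K)
    {M : ℕ} (hM : 1 ≤ M) {s : ℂ} (hs : 0 < s.re) :
    DifferentiableAt ℂ (fun z ↦ mellin (errorTail f c M) (-z)) s := by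
  have h : DifferentiableAt ℂ (mellin (errorTail f c M)) (-s) :=
    mellin_differentiableAt_of_isBigO_rpow (locallyIntegrableOn_errorTail hK M)
      (errorTail_isBigO_top hK M) (by simpa using hs) (errorTail_isBigO_zero hM (-s.re - 1))
      (by simp)
  exact DifferentiableAt.comp (g := mellin (errorTail f c M)) (f := fun z ↦ -z) s h (by fun_prop)

lemma norm_mellin_errorTail_le (hK : ∀ n : ℕ, ‖∑ k ∈ Finset.Icc 1 n, f k - c * n‖ ≤ K)
    {M : ℕ} (hM : 1 ≤ M) {s : ℂ} (hs : 0 < s.re) :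
    ‖mellin (errorTail f c M) (-s)‖ ≤ (2 * K + ‖c‖) * ((M : ℝ) ^ (-s.re) / s.re) := by
  have hM0 : (0 : ℝ) < M := by exact_mod_cast hM
  have e : mellin (errorTail f c M) (-s) =
      ∫ t in Set.Ioi (M : ℝ), (t : ℂ) ^ (-s - 1) • errorTail f c M t := by
    unfold mellin
    rw [← MeasureTheory.integral_Ici_eq_integral_Ioi (x := (M : ℝ))]
    refine MeasureTheory.setIntegral_eq_of_subset_of_forall_sdiff_eq_zero measurableSet_Ioi
      (Set.Ici_subset_Ioi.2 hM0) fun x hx ↦ ?_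
    rw [errorTail_of_lt (by simpa using hx.2), smul_zero]
  have hi := integral_Ioi_rpow_of_lt (a := -s.re - 1) (by linarith) hM0
  have e2 : (M : ℝ) ^ (-s.re) / s.re = ∫ t in Set.Ioi (M : ℝ), t ^ (-s.re - 1) := by
    rw [hi, sub_add_cancel, neg_div_neg_eq]
  rw [e, e2, ← MeasureTheory.integral_const_mul]
  refine MeasureTheory.norm_integral_le_of_norm_le
    ((integrableOn_Ioi_rpow_of_lt (by linarith) hM0).const_mul _) ?_
  refine (MeasureTheory.ae_restrict_iff' measurableSet_Ioi).2
    (MeasureTheory.ae_of_all _ fun t ht ↦ ?_)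
  have ht0 : 0 < t := hM0.trans ht
  rw [norm_smul, Complex.norm_cpow_eq_rpow_re_of_pos ht0, mul_comm]
  simp only [Complex.sub_re, Complex.neg_re, Complex.one_re]
  gcongr
  exact norm_errorTail_le hK M t

lemma LSeries_eq_sum_add_mellin (hf : ∀ n, ‖f n‖ ≤ 1)
    (hK : ∀ n : ℕ, ‖∑ k ∈ Finset.Icc 1 n, f k - c * n‖ ≤ K)
    {M : ℕ} (hM : 1 ≤ M) {s : ℂ} (hs : 1 < s.re) :
    LSeries f s = ∑ n ∈ Finset.Icc 1 M, f n * (n : ℂ) ^ (-s) + c * ((M : ℂ) ^ (1 - s) / (s - 1)) +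
      s * mellin (errorTail f c M) (-s) := by
  have hM0 : (0 : ℝ) < M := by exact_mod_cast hM
  have hs0 : s ≠ 0 := fun h ↦ by simp [h] at hs; linarith
  have hs1 : s - 1 ≠ 0 := fun h ↦ by rw [sub_eq_zero.1 h] at hs; simp at hs
  set g : ℕ → ℂ := fun n ↦ if n ≤ M then 0 else f n with hg
  set h : ℕ → ℂ := fun n ↦ if n ≤ M then f n else 0 with hh
  have hfgh : f = h + g := by
    ext n; simp only [hg, hh, Pi.add_apply]; split_ifs <;> simp
  have hgs : LSeriesSummable g s := LSeriesSummable_of_bounded_of_one_lt_re (m := 1)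
    (fun n _ ↦ by simp only [hg]; split_ifs <;> simp [hf]) hs
  have hhs : LSeriesSummable h s := LSeriesSummable_of_bounded_of_one_lt_re (m := 1)
    (fun n _ ↦ by simp only [hh]; split_ifs <;> simp [hf]) hs
  have e1 : LSeries h s = ∑ n ∈ Finset.Icc 1 M, f n * (n : ℂ) ^ (-s) := by
    unfold LSeries
    rw [tsum_eq_sum (s := Finset.Icc 1 M)]
    · refine Finset.sum_congr rfl fun n hn ↦ ?_
      rw [Finset.mem_Icc] at hn
      rw [LSeries.term_of_ne_zero (by omega), Complex.cpow_neg, div_eq_mul_inv]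
      simp [hh, hn.2]
    · intro n hn
      rw [Finset.mem_Icc] at hn
      rcases eq_or_ne n 0 with rfl | hn0
      · simp
      · rw [LSeries.term_of_ne_zero hn0]
        simp [hh, show ¬ n ≤ M by omega]
  have hsum : ∀ n : ℕ, ∑ k ∈ Finset.Icc 1 n, g k =
      if M ≤ n then ∑ k ∈ Finset.Icc 1 n, f k - ∑ k ∈ Finset.Icc 1 M, f k else 0 := by
    intro n
    split_ifs with hn
    · rw [← Finset.sum_sdiff_eq_sub (Finset.Icc_subset_Icc_right hn)]
      rw [← Finset.sum_subset (s₁ := Finset.Icc 1 n \ Finset.Icc 1 M) Finset.sdiff_subset]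
      · refine Finset.sum_congr rfl fun k hk ↦ ?_
        simp only [Finset.mem_sdiff, Finset.mem_Icc] at hk
        simp [hg, show ¬ k ≤ M by omega]
      · intro k hk hk'
        simp only [Finset.mem_sdiff, Finset.mem_Icc] at hk hk'
        simp [hg, show k ≤ M by omega]
    · refine Finset.sum_eq_zero fun k hk ↦ ?_
      rw [Finset.mem_Icc] at hk
      simp [hg, show k ≤ M by omega]
  have e2 : LSeries g s = s * ∫ t in Set.Ioi (1 : ℝ), (∑ k ∈ Finset.Icc 1 ⌊t⌋₊, g k) *
      (t : ℂ) ^ (-(s + 1)) := by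
    refine LSeries_eq_mul_integral' g zero_le_one hs ?_
    refine Asymptotics.IsBigO.of_bound 1 (Filter.Eventually.of_forall fun n ↦ ?_)
    rw [Real.norm_of_nonneg (Finset.sum_nonneg fun _ _ ↦ norm_nonneg _)]
    refine (Finset.sum_le_sum (g := fun _ ↦ (1 : ℝ)) fun k _ ↦ ?_).trans (by simp)
    simp only [hg]; split_ifs <;> simp [hf]
  have e3 : ∫ t in Set.Ioi (1 : ℝ), (∑ k ∈ Finset.Icc 1 ⌊t⌋₊, g k) * (t : ℂ) ^ (-(s + 1)) =
      ∫ t in Set.Ioi (0 : ℝ), ((t : ℂ) ^ (-s - 1) • errorTail f c M t +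
        (Set.Ioi (M : ℝ)).indicator
          (fun t : ℝ ↦ c * ((t : ℂ) ^ (-s) - M * (t : ℂ) ^ (-s - 1))) t) := by
    have : ∀ t ∈ Set.Ioi (0 : ℝ), ((t : ℂ) ^ (-s - 1) • errorTail f c M t +
        (Set.Ioi (M : ℝ)).indicator (fun t : ℝ ↦ c * ((t : ℂ) ^ (-s) - M * (t : ℂ) ^ (-s - 1))) t)
        = (∑ k ∈ Finset.Icc 1 ⌊t⌋₊, g k) * (t : ℂ) ^ (-(s + 1)) := by
      intro t ht
      have ht0 : (t : ℂ) ≠ 0 := by exact_mod_cast (ne_of_gt ht)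
      have ep : (t : ℂ) ^ (-s) = t * (t : ℂ) ^ (-s - 1) := by
        rw [Complex.cpow_sub _ _ ht0, Complex.cpow_one]; field_simp
      rw [hsum, show -(s + 1) = -s - 1 by ring, smul_eq_mul]
      rcases lt_trichotomy t M with h1 | h1 | h1
      · rw [errorTail_of_lt h1, Set.indicator_of_notMem (by simpa using h1.le),
          if_neg (by rw [Nat.le_floor_iff (le_of_lt ht)]; exact h1.not_ge)]
        simp
      · rw [Set.indicator_of_notMem (by simp [h1])]
        simp [errorTail, h1]
      · rw [Set.indicator_of_mem (by simpa using h1),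
          if_pos (by rw [Nat.le_floor_iff (le_of_lt ht)]; exact h1.le), errorTail, if_pos h1.le, ep]
        ring
    rw [MeasureTheory.setIntegral_congr_fun measurableSet_Ioi this,
      ← MeasureTheory.integral_Ici_eq_integral_Ioi (x := (1 : ℝ))]
    refine (MeasureTheory.setIntegral_eq_of_subset_of_forall_sdiff_eq_zero measurableSet_Ioi
      (Set.Ici_subset_Ioi.2 zero_lt_one) fun t ht ↦ ?_).symm
    have : ⌊t⌋₊ = 0 := Nat.floor_eq_zero.2 (by simpa using ht.2)
    simp [this]
  have i1 : MeasureTheory.IntegrableOn (fun t : ℝ ↦ (t : ℂ) ^ (-s)) (Set.Ioi M) :=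
    integrableOn_Ioi_cpow_of_lt (by simpa using hs) hM0
  have i2 : MeasureTheory.IntegrableOn (fun t : ℝ ↦ (t : ℂ) ^ (-s - 1)) (Set.Ioi M) :=
    integrableOn_Ioi_cpow_of_lt (by simp; linarith) hM0
  have i3 := (i1.sub (i2.const_mul (M : ℂ))).const_mul c
  have e4 : ∫ t in Set.Ioi (0 : ℝ), (Set.Ioi (M : ℝ)).indicator
      (fun t : ℝ ↦ c * ((t : ℂ) ^ (-s) - M * (t : ℂ) ^ (-s - 1))) t
      = c * ((M : ℂ) ^ (1 - s) / (s - 1) - (M : ℂ) ^ (1 - s) / s) := by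
    rw [MeasureTheory.setIntegral_indicator measurableSet_Ioi,
      Set.inter_eq_right.2 (Set.Ioi_subset_Ioi hM0.le), MeasureTheory.integral_const_mul,
      MeasureTheory.integral_sub i1 (i2.const_mul _), MeasureTheory.integral_const_mul,
      integral_Ioi_cpow_of_lt (by simpa using hs) hM0,
      integral_Ioi_cpow_of_lt (by simp; linarith) hM0]
    have hMc : (M : ℂ) ≠ 0 := by exact_mod_cast hM0.ne'
    have : (M : ℂ) ^ (1 - s) = M * (M : ℂ) ^ (-s) := by
      rw [sub_eq_add_neg, Complex.cpow_add _ _ hMc, Complex.cpow_one]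
    have h3 : -s + 1 ≠ 0 := fun h ↦ hs1 (by linear_combination -h)
    simp only [Complex.ofReal_natCast, sub_add_cancel]
    rw [show -s + 1 = 1 - s by ring, this, ← neg_sub s 1, neg_div_neg_eq, neg_div_neg_eq]
    ring
  rw [hfgh, LSeries_add hhs hgs, ← hfgh, e1, e2, e3, MeasureTheory.integral_add, e4]
  · unfold mellin
    field_simp
    ring
  · exact mellinConvergent_errorTail hK hM (by linarith)
  · exact (MeasureTheory.integrable_indicator_iff measurableSet_Ioi).2
      (MeasureTheory.IntegrableOn.mono_measure i3 MeasureTheory.Measure.restrict_le_self)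

end PartialSums

section TameLSeries

variable {f : ℕ → ℂ} {c : ℂ} {K : ℝ}

/-- The continuation of `LSeries f` to `0 < re s`, obtained by summing the first `M` terms. -/
noncomputable def approxLSeries (f : ℕ → ℂ) (c : ℂ) (M : ℕ) (s : ℂ) : ℂ :=
  ∑ n ∈ Finset.Icc 1 M, f n * (n : ℂ) ^ (-s) + c * ((M : ℂ) ^ (1 - s) / (s - 1)) +
      s * mellin (errorTail f c M) (-s)

lemma differentiableAt_approxLSeries
    (hK : ∀ n : ℕ, ‖∑ k ∈ Finset.Icc 1 n, f k - c * n‖ ≤ K)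
    {M : ℕ} (hM : 1 ≤ M) {s : ℂ} (hs : 0 < s.re) (hs1 : s ≠ 1) :
    DifferentiableAt ℂ (approxLSeries f c M) s := by
  unfold approxLSeries
  have h1 := differentiableAt_mellin_errorTail hK hM hs
  have h2 : ∀ n ∈ Finset.Icc 1 M, DifferentiableAt ℂ (fun s ↦ f n * (n : ℂ) ^ (-s)) s := by
    intro n hn
    have : (n : ℂ) ≠ 0 := by
      rw [Finset.mem_Icc] at hn
      exact_mod_cast (by omega : n ≠ 0)
    exact (differentiableAt_id.neg.const_cpow (Or.inl this)).const_mul _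
  have hMc : (M : ℂ) ≠ 0 := by exact_mod_cast (by omega : M ≠ 0)
  have h3 : DifferentiableAt ℂ (fun s ↦ c * ((M : ℂ) ^ (1 - s) / (s - 1))) s := by
    have ha : DifferentiableAt ℂ (fun s ↦ (M : ℂ) ^ (1 - s)) s :=
      DifferentiableAt.const_cpow (by fun_prop) (Or.inl hMc)
    have hb : DifferentiableAt ℂ (fun s : ℂ ↦ s - 1) s := by fun_prop
    exact (ha.fun_div hb (sub_ne_zero.2 hs1)).const_mul c
  exact ((DifferentiableAt.fun_sum h2).add h3).add (differentiableAt_id.mul h1)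

lemma norm_approxLSeries_le (hf : ∀ n, ‖f n‖ ≤ 1)
    (hK : ∀ n : ℕ, ‖∑ k ∈ Finset.Icc 1 n, f k - c * n‖ ≤ K)
    {M : ℕ} (hM : 1 ≤ M) {s : ℂ} (hs : 1 / 2 ≤ s.re) (hs1 : 1 / 2 ≤ ‖s - 1‖) (hsM : ‖s‖ ≤ M)
    (hsr : (1 - s.re) * Real.log M ≤ 1) :
    ‖approxLSeries f c M s‖ ≤
      Real.exp 1 * (1 + Real.log M) + 2 * Real.exp 1 * ‖c‖ + 2 * Real.exp 1 * (2 * K + ‖c‖) := by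
  have hK0 : 0 ≤ K := (norm_nonneg _).trans (hK 0)
  have hM0 : (0 : ℝ) < M := by exact_mod_cast hM
  have key : ∀ n : ℕ, 1 ≤ n → n ≤ M → (n : ℝ) ^ (1 - s.re) ≤ Real.exp 1 := by
    intro n h1 h2
    have hn0 : (0 : ℝ) < n := by exact_mod_cast h1
    rw [Real.rpow_def_of_pos hn0, Real.exp_le_exp]
    have hl : Real.log n ≤ Real.log M := Real.log_le_log hn0 (by exact_mod_cast h2)
    have hl0 : 0 ≤ Real.log n := Real.log_natCast_nonneg n
    rcases le_total 0 (1 - s.re) with h | h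
    · nlinarith
    · nlinarith
  have b1 : ‖∑ n ∈ Finset.Icc 1 M, f n * (n : ℂ) ^ (-s)‖ ≤ Real.exp 1 * (1 + Real.log M) := by
    calc _ ≤ ∑ n ∈ Finset.Icc 1 M, Real.exp 1 * (n : ℝ)⁻¹ := by
          refine norm_sum_le_of_le _ fun n hn ↦ ?_
          rw [Finset.mem_Icc] at hn
          have hn0 : (0 : ℝ) < n := by exact_mod_cast hn.1
          rw [norm_mul, Complex.norm_natCast_cpow_of_pos (by omega), Complex.neg_re]
          have : (n : ℝ) ^ (-s.re) = (n : ℝ) ^ (1 - s.re) * (n : ℝ)⁻¹ := by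
            rw [← Real.rpow_neg_one, ← Real.rpow_add hn0]; congr 1; ring
          rw [this]
          calc _ ≤ 1 * (_ * (n : ℝ)⁻¹) := by
                gcongr
                · exact hf n
                · exact key n hn.1 hn.2
            _ = _ := one_mul _
      _ = Real.exp 1 * (harmonic M : ℝ) := by
          rw [harmonic_eq_sum_Icc]; push_cast; rw [Finset.mul_sum]
      _ ≤ _ := by gcongr; exact harmonic_le_one_add_log M
  have b2 : ‖c * ((M : ℂ) ^ (1 - s) / (s - 1))‖ ≤ 2 * Real.exp 1 * ‖c‖ := by
    rw [norm_mul, norm_div, Complex.norm_natCast_cpow_of_pos (by omega), Complex.sub_re,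
      Complex.one_re, mul_comm]
    gcongr
    rw [div_le_iff₀ (by linarith)]
    nlinarith [key M hM le_rfl, Real.exp_pos 1]
  have b3 : ‖s * mellin (errorTail f c M) (-s)‖ ≤ 2 * Real.exp 1 * (2 * K + ‖c‖) := by
    rw [norm_mul]
    calc _ ≤ (M : ℝ) * ((2 * K + ‖c‖) * ((M : ℝ) ^ (-s.re) / s.re)) := by
          gcongr
          exact norm_mellin_errorTail_le hK hM (by linarith)
      _ = (2 * K + ‖c‖) * ((M : ℝ) ^ (1 - s.re) / s.re) := by
          rw [sub_eq_add_neg, Real.rpow_add hM0, Real.rpow_one]; ring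
      _ ≤ (2 * K + ‖c‖) * (2 * Real.exp 1) := by
          gcongr
          rw [div_le_iff₀ (by linarith)]
          nlinarith [key M hM le_rfl, Real.exp_pos 1]
      _ = _ := mul_comm _ _
  exact (norm_add₃_le).trans (add_le_add_three b1 b2 b3)

lemma isTame_LSeries (hf : ∀ n, ‖f n‖ ≤ 1)
    (hK : ∀ n : ℕ, ‖∑ k ∈ Finset.Icc 1 n, f k - c * n‖ ≤ K) : IsTame (LSeries f) := by
  have hK0 : 0 ≤ K := (norm_nonneg _).trans (hK 0)
  constructor
  · have := LSeries_differentiableOn f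
    refine this.mono fun s hs ↦ ?_
    refine lt_of_le_of_lt (LSeries.abscissaOfAbsConv_le_of_le_const ⟨1, fun n _ ↦ hf n⟩) ?_
    exact_mod_cast hs
  intro k
  set C₁ := Real.exp 1 * 3 + 2 * Real.exp 1 * ‖c‖ + 2 * Real.exp 1 * (2 * K + ‖c‖) with hC₁
  refine ⟨k.factorial * C₁ * 2 ^ k, k + 1, by positivity, fun s hs ↦ ?_⟩
  obtain ⟨h1, h3, ht⟩ := hs
  have hl2 := two_le_logHeight s
  set ℓ := logHeight s with hℓ
  set T := |s.im| + 10 with hT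
  have hT0 : 11 ≤ T := by linarith
  set M := ⌈T⌉₊ with hMdef
  have hTM : T ≤ M := Nat.le_ceil T
  have hMT : (M : ℝ) < T + 1 := Nat.ceil_lt_add_one (by linarith)
  have hM : 1 ≤ M := by
    have : (0 : ℝ) < M := by linarith
    exact_mod_cast this
  have hlM : Real.log M ≤ 2 * ℓ := by
    have : Real.log M ≤ Real.log (T ^ 2) := Real.log_le_log (by linarith) (by nlinarith)
    rwa [Real.log_pow] at this
  have hlM0 : 0 ≤ Real.log M := Real.log_natCast_nonneg M
  set r : ℝ := 1 / (2 * ℓ) with hr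
  have hr0 : 0 < r := by positivity
  have hr4 : r ≤ 1 / 4 := by
    rw [hr]; exact one_div_le_one_div_of_le (by norm_num) (by linarith)
  have hrl : r * (2 * ℓ) = 1 := by rw [hr]; field_simp
  have geo : ∀ z ∈ Metric.closedBall s r, 1 - r ≤ z.re ∧ 1 / 2 ≤ ‖z - 1‖ ∧ ‖z‖ ≤ M := by
    intro z hz
    rw [Metric.mem_closedBall, dist_eq_norm] at hz
    have hre := abs_le.1 ((Complex.abs_re_le_norm (z - s)).trans hz)
    have him := (Complex.abs_im_le_norm (z - s)).trans hz
    rw [Complex.sub_re] at hre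
    rw [Complex.sub_im] at him
    refine ⟨by linarith [hre.1], ?_, ?_⟩
    · have := Complex.abs_im_le_norm (z - 1)
      rw [Complex.sub_im, Complex.one_im, sub_zero] at this
      have h5 : |s.im| ≤ |z.im| + |z.im - s.im| := by
        have := abs_sub_abs_le_abs_sub s.im z.im
        rw [abs_sub_comm] at this; linarith
      linarith
    · have h6 : ‖z‖ ≤ ‖s‖ + r := by
        have := norm_add_le s (z - s)
        rw [add_sub_cancel] at this; linarith
      have h7 := Complex.norm_le_abs_re_add_abs_im s
      rw [abs_of_pos (by linarith : 0 < s.re)] at h7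
      linarith
  have heq : iteratedDeriv k (LSeries f) s = iteratedDeriv k (approxLSeries f c M) s :=
    iteratedDeriv_congr_half_plane (fun z hz ↦ LSeries_eq_sum_add_mellin hf hK hM hz) k h1
  rw [heq]
  have hd : DiffContOnCl ℂ (approxLSeries f c M) (Metric.ball s r) := by
    refine DifferentiableOn.diffContOnCl_ball (U := Metric.closedBall s r) (fun z hz ↦ ?_) le_rfl
    obtain ⟨g1, g2, -⟩ := geo z hz
    refine (differentiableAt_approxLSeries hK hM (by linarith) fun h ↦ ?_).differentiableWithinAt
    rw [h] at g2; norm_num at g2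
  have hb : ∀ z ∈ Metric.sphere s r, ‖approxLSeries f c M z‖ ≤ C₁ * ℓ := by
    intro z hz
    obtain ⟨g1, g2, g3⟩ := geo z (Metric.sphere_subset_closedBall hz)
    refine (norm_approxLSeries_le hf hK hM (by linarith) g2 g3 ?_).trans ?_
    · nlinarith
    · have e0 := Real.exp_pos 1
      have e1 : Real.exp 1 * (1 + Real.log M) ≤ Real.exp 1 * (3 * ℓ) := by gcongr; linarith
      have e2 : 2 * Real.exp 1 * ‖c‖ ≤ 2 * Real.exp 1 * ‖c‖ * ℓ :=
        le_mul_of_one_le_right (by positivity) (by linarith)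
      have e3 : 2 * Real.exp 1 * (2 * K + ‖c‖) ≤ 2 * Real.exp 1 * (2 * K + ‖c‖) * ℓ :=
        le_mul_of_one_le_right (by positivity) (by linarith)
      rw [hC₁]; linarith
  refine (Complex.norm_iteratedDeriv_le_of_forall_mem_sphere_norm_le k hr0 hd hb).trans
    (le_of_eq ?_)
  have hrk : r ^ k * (2 ^ k * ℓ ^ k) = 1 := by
    rw [← mul_pow, ← mul_pow, hrl, one_pow]
  rw [div_eq_iff (by positivity), pow_succ]
  linear_combination (-(k.factorial : ℝ) * C₁ * ℓ) * hrk

end TameLSeries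

section Periodic

lemma exists_norm_sum_sub_le {N : ℕ} [NeZero N] (χ : DirichletCharacter ℂ N) :
    ∃ c : ℂ, ∃ K : ℝ, ∀ n : ℕ, ‖∑ k ∈ Finset.Icc (1 : ℕ) n, χ ((k : ℕ) : ZMod N) - c * n‖ ≤ K := by
  have hN : (N : ℂ) ≠ 0 := by exact_mod_cast NeZero.ne N
  set S : ℕ → ℂ := fun n ↦ ∑ k ∈ Finset.Icc (1 : ℕ) n, χ ((k : ℕ) : ZMod N) with hS
  set c : ℂ := S N / N with hc
  have hsucc : ∀ n, S (n + 1) = S n + χ ((n + 1 : ℕ) : ZMod N) := fun n ↦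
    Finset.sum_Icc_succ_top (by omega) _
  have hper : ∀ n, S (n + N) = S n + S N := by
    intro n
    induction n with
    | zero => simp [hS]
    | succ n ih =>
      rw [show n + 1 + N = (n + N) + 1 by ring, hsucc, ih, hsucc]
      have : ((n + N + 1 : ℕ) : ZMod N) = ((n + 1 : ℕ) : ZMod N) := by push_cast; simp
      rw [this]; ring
  have hE : Function.Periodic (fun n ↦ S n - c * n) N := by
    intro n
    simp only [hper, hc]
    push_cast
    field_simp
    ring
  refine ⟨c, ∑ i ∈ Finset.range N, ‖S i - c * i‖, fun n ↦ ?_⟩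
  have h := hE.map_mod_nat n
  simp only [hS] at h ⊢
  rw [← h]
  exact Finset.single_le_sum
    (f := fun i ↦ ‖∑ k ∈ Finset.Icc (1 : ℕ) i, χ ((k : ℕ) : ZMod N) - c * i‖)
    (fun _ _ ↦ norm_nonneg _)
    (Finset.mem_range.2 (Nat.mod_lt _ (NeZero.pos N)))

lemma isTame_LSeries_dirichletCharacter {N : ℕ} [NeZero N] (χ : DirichletCharacter ℂ N) :
    IsTame (LSeries fun n ↦ χ n) := by
  obtain ⟨c, K, h⟩ := exists_norm_sum_sub_le χ
  exact isTame_LSeries (fun n ↦ χ.norm_le_one _) h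

lemma isTame_LSeries_one : IsTame (LSeries 1) := by
  refine isTame_LSeries (c := 1) (K := 0) (fun n ↦ by simp) fun n ↦ by simp

end Periodic

section LowerBound

lemma exists_norm_LSeries_one_add_le {N : ℕ} [NeZero N] (χ : DirichletCharacter ℂ N) :
    ∃ C : ℝ, ∀ x : ℝ, 0 < x → x ≤ 2 → ‖LSeries (fun n ↦ χ n) (1 + x)‖ ≤ C / x := by
  obtain ⟨c, K, hK⟩ := exists_norm_sum_sub_le χ
  have hK0 : 0 ≤ K := (norm_nonneg _).trans (hK 0)
  have hf : ∀ n : ℕ, ‖(fun n : ℕ ↦ χ n) n‖ ≤ 1 := fun n ↦ χ.norm_le_one _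
  refine ⟨2 + ‖c‖ + 6 * (2 * K + ‖c‖), fun x hx hx2 ↦ ?_⟩
  have hre : ((1 : ℂ) + x).re = 1 + x := by simp
  have hn : ‖(1 : ℂ) + x‖ = 1 + x := by
    rw [← Complex.ofReal_one, ← Complex.ofReal_add, Complex.norm_real, Real.norm_eq_abs,
      abs_of_pos (by linarith)]
  rw [LSeries_eq_sum_add_mellin hf hK le_rfl (by rw [hre]; linarith)]
  have h1 : ‖∑ n ∈ Finset.Icc 1 1, χ (n : ℕ) * (n : ℂ) ^ (-((1 : ℂ) + x))‖ ≤ 2 / x := by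
    have : 1 ≤ 2 / x := by rw [le_div_iff₀ hx]; linarith
    simpa using this
  have h2 : ‖c * (((1 : ℕ) : ℂ) ^ (1 - ((1 : ℂ) + x)) / ((1 : ℂ) + x - 1))‖ ≤ ‖c‖ / x := by
    rw [add_sub_cancel_left, Nat.cast_one, Complex.one_cpow, norm_mul, norm_div, norm_one,
      Complex.norm_real, Real.norm_eq_abs, abs_of_pos hx, mul_one_div]
  have h3 : ‖((1 : ℂ) + x) * mellin (errorTail (fun n ↦ χ n) c 1) (-((1 : ℂ) + x))‖ ≤
      6 * (2 * K + ‖c‖) / x := by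
    have := norm_mellin_errorTail_le hK le_rfl (s := (1 : ℂ) + x) (by rw [hre]; linarith)
    rw [Nat.cast_one, Real.one_rpow, hre] at this
    rw [norm_mul, hn, le_div_iff₀ hx]
    have h4 : (1 + x) * ‖mellin (errorTail (fun n ↦ χ n) c 1) (-((1 : ℂ) + x))‖ ≤
        2 * K + ‖c‖ := by
      calc _ ≤ (1 + x) * ((2 * K + ‖c‖) * (1 / (1 + x))) := by gcongr
        _ = _ := by field_simp
    nlinarith [norm_nonneg c, norm_nonneg (mellin (errorTail (fun n ↦ χ n) c 1) (-((1 : ℂ) + x)))]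
  refine norm_add₃_le.trans ((add_le_add_three h1 h2 h3).trans (le_of_eq ?_))
  ring

lemma polyLogBdd_inv_LSeries {N : ℕ} [NeZero N] (χ : DirichletCharacter ℂ N) :
    PolyLogBdd (LSeries fun n ↦ χ n)⁻¹ := by
  obtain ⟨A₁, h1⟩ := exists_norm_LSeries_one_add_le (1 : DirichletCharacter ℂ N)
  obtain ⟨A₂, B₂, -, h2⟩ := (isTame_LSeries_dirichletCharacter (χ ^ 2)).2 0
  obtain ⟨A₃, B₃, -, h3⟩ := (isTame_LSeries_dirichletCharacter χ).2 1
  have hdiff := (isTame_LSeries_dirichletCharacter χ).1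
  set A : ℝ := max 1 (max A₁ (max (A₂ * 2 ^ B₂) A₃)) with hA
  have hA1 : 1 ≤ A := le_max_left _ _
  have hAA₁ : A₁ ≤ A := (le_max_left _ _).trans (le_max_right _ _)
  have hAA₂ : A₂ * 2 ^ B₂ ≤ A :=
    (le_max_left _ _).trans ((le_max_right _ _).trans (le_max_right _ _))
  have hAA₃ : A₃ ≤ A :=
    (le_max_right _ _).trans ((le_max_right _ _).trans (le_max_right _ _))
  have hA₂0 : 0 ≤ A₂ := by
    have hm : (2 + Complex.I) ∈ stripRegion := by constructor <;> norm_num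
    have h := (norm_nonneg _).trans (h2 _ hm)
    have := one_le_logHeight (2 + Complex.I)
    exact nonneg_of_mul_nonneg_left h (by positivity)
  set B := max B₂ B₃ with hB
  have hL2 : ∀ s ∈ stripRegion, ∀ z ∈ stripRegion, z.im = 2 * s.im →
      ‖LSeries (fun n ↦ (χ ^ 2) n) z‖ ≤ A * logHeight s ^ B := by
    intro s hs z hz him
    have hl := one_le_logHeight s
    have hl2 : logHeight z ≤ 2 * logHeight s := by
      unfold logHeight
      rw [him, abs_mul, abs_two]
      have : Real.log (2 * |s.im| + 10) ≤ Real.log ((|s.im| + 10) ^ 2) :=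
        Real.log_le_log (by positivity) (by nlinarith [abs_nonneg s.im])
      rwa [Real.log_pow] at this
    have hlz := one_le_logHeight z
    calc _ ≤ A₂ * logHeight z ^ B₂ := by simpa using h2 z hz
      _ ≤ A₂ * (2 * logHeight s) ^ B₂ := by gcongr
      _ = (A₂ * 2 ^ B₂) * logHeight s ^ B₂ := by ring
      _ ≤ A * logHeight s ^ B := by
        gcongr
        exact le_max_left _ _
  have hL' : ∀ s ∈ stripRegion, ‖deriv (LSeries fun n ↦ χ n) s‖ ≤ A * logHeight s ^ B := by
    intro s hs
    have hl := one_le_logHeight s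
    calc _ ≤ A₃ * logHeight s ^ B₃ := by simpa using h3 s hs
      _ ≤ A * logHeight s ^ B := by
        gcongr
        exact le_max_right _ _
  refine ⟨16 * A ^ 7, 4 * B, by positivity, fun s hs ↦ ?_⟩
  obtain ⟨hs1, hs3, hst⟩ := hs
  have hl := one_le_logHeight s
  set ℓ := logHeight s with hℓ
  have hℓB : 1 ≤ ℓ ^ B := one_le_pow₀ hl
  set P : ℝ := A * ℓ ^ B with hP
  have hP1 : 1 ≤ P := one_le_mul_of_one_le_of_one_le hA1 hℓB
  set pt : ℝ → ℂ := fun x ↦ 1 + x + Complex.I * s.im with hpt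
  have hptre : ∀ x, (pt x).re = 1 + x := fun x ↦ by simp [hpt]
  have hptim : ∀ x, (pt x).im = s.im := fun x ↦ by simp [hpt]
  have hmem : ∀ x, 0 < x → x ≤ 2 → pt x ∈ stripRegion := fun x h0 h2 ↦
    ⟨by rw [hptre]; linarith, by rw [hptre]; linarith, by rwa [hptim]⟩
  have hlh : ∀ x, logHeight (pt x) = ℓ := fun x ↦ by rw [hℓ, logHeight, logHeight, hptim]
  have main : ∀ x, 0 < x → x ≤ 2 →
      x ^ 3 ≤ A ^ 3 * P * ‖LSeries (fun n ↦ χ n) (pt x)‖ ^ 4 := by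
    intro x h0 hx2
    have h := χ.norm_LSeries_product_ge_one h0 s.im
    rw [norm_mul, norm_mul, norm_pow, norm_pow] at h
    have e2 : ‖LSeries (fun n ↦ (χ ^ 2) n) (1 + x + 2 * Complex.I * s.im)‖ ≤ P := by
      refine hL2 s ⟨hs1, hs3, hst⟩ _ ⟨?_, ?_, ?_⟩ ?_
      · simpa using h0
      · simp; linarith
      · simp [abs_mul]; linarith
      · simp
    have e1 : ‖LSeries (fun n ↦ (1 : DirichletCharacter ℂ N) n) (1 + x)‖ ≤ A / x :=
      (h1 x h0 hx2).trans (by gcongr)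
    have : 1 ≤ (A / x) ^ 3 * ‖LSeries (fun n ↦ χ n) (pt x)‖ ^ 4 * P := by
      refine h.le.trans ?_
      gcongr
    rw [div_pow, div_mul_eq_mul_div, div_mul_eq_mul_div, one_le_div (by positivity)] at this
    linarith
  set x₀ : ℝ := 1 / (16 * A ^ 8 * (ℓ ^ B) ^ 5) with hx₀
  have hx₀0 : 0 < x₀ := by positivity
  have hx₀1 : x₀ ≤ 1 := by
    rw [hx₀]
    refine (div_le_one (by positivity)).2 ?_
    have := one_le_pow₀ hA1 (n := 8)
    have := one_le_pow₀ hℓB (n := 5)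
    nlinarith
  set m₀ : ℝ := 2 * P * x₀ with hm₀
  have hm₀0 : 0 < m₀ := by positivity
  have hm4 : A ^ 3 * P * m₀ ^ 4 = x₀ ^ 3 := by
    rw [hm₀, hP, hx₀]; field_simp; norm_num
  have hbig : ∀ x, x₀ ≤ x → x ≤ 2 → m₀ ≤ ‖LSeries (fun n ↦ χ n) (pt x)‖ := by
    intro x hx hx2
    have h4 : m₀ ^ 4 ≤ ‖LSeries (fun n ↦ χ n) (pt x)‖ ^ 4 := by
      have : A ^ 3 * P * m₀ ^ 4 ≤ A ^ 3 * P * ‖LSeries (fun n ↦ χ n) (pt x)‖ ^ 4 := by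
        rw [hm4]
        exact (pow_le_pow_left₀ hx₀0.le hx 3).trans (main x (hx₀0.trans_le hx) hx2)
      exact le_of_mul_le_mul_left this (by positivity)
    exact (pow_le_pow_iff_left₀ hm₀0.le (norm_nonneg _) (by norm_num)).1 h4
  have hall : ∀ x, 0 < x → x ≤ 2 → m₀ / 2 ≤ ‖LSeries (fun n ↦ χ n) (pt x)‖ := by
    intro x h0 hx2
    rcases le_total x₀ x with h | h
    · linarith [hbig x h hx2]
    · have hb := hbig x₀ le_rfl (by linarith)
      set S : Set ℂ := {z | z.im = s.im} ∩ {z | 1 < z.re} ∩ {z | z.re ≤ 3} with hS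
      have hconv : Convex ℝ S := by
        refine (Convex.inter ?_ (convex_halfSpace_re_gt 1)).inter (convex_halfSpace_re_le 3)
        exact convex_hyperplane (f := Complex.imLm) Complex.imLm.isLinear _
      have hin : ∀ y, 0 < y → y ≤ 2 → pt y ∈ S := fun y h0 h2 ↦
        ⟨⟨hptim y, (hmem y h0 h2).1⟩, (hmem y h0 h2).2.1⟩
      have hmv := Convex.norm_image_sub_le_of_norm_deriv_le (f := LSeries fun n ↦ χ n)
        (s := S) (C := P) (x := pt x) (y := pt x₀)
        (fun z hz ↦ (hdiff z hz.1.2).differentiableAt (isOpen_one_lt_re.mem_nhds hz.1.2))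
        (fun z hz ↦ by
          have e : logHeight z = ℓ := by rw [hℓ, logHeight, logHeight, hz.1.1]
          rw [hP, ← e]
          exact hL' z ⟨hz.1.2, hz.2, by rw [hz.1.1]; exact hst⟩)
        hconv (hin x h0 hx2) (hin x₀ hx₀0 (by linarith))
      have hd : ‖pt x₀ - pt x‖ ≤ x₀ := by
        have : pt x₀ - pt x = ((x₀ - x : ℝ) : ℂ) := by simp [hpt]
        rw [this, Complex.norm_real, Real.norm_eq_abs, abs_of_nonneg (by linarith)]
        linarith
      have h6 : P * ‖pt x₀ - pt x‖ ≤ P * x₀ := by gcongr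
      have h7 := norm_sub_norm_le (LSeries (fun n ↦ χ n) (pt x₀)) (LSeries (fun n ↦ χ n) (pt x))
      linarith
  have hfin := hall (s.re - 1) (by linarith) (by linarith)
  have hps : pt (s.re - 1) = s := by
    apply Complex.ext
    · rw [hptre]; ring
    · rw [hptim]
  rw [hps] at hfin
  rw [Pi.inv_apply, norm_inv]
  calc _ ≤ (m₀ / 2)⁻¹ := by gcongr
    _ = 16 * A ^ 7 * ℓ ^ (4 * B) := by
      rw [hm₀, hP, hx₀, mul_comm 4 B, pow_mul]; field_simp

lemma isTame_logDeriv_LSeries {N : ℕ} [NeZero N] (χ : DirichletCharacter ℂ N) :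
    IsTame (fun s ↦ -deriv (LSeries fun n ↦ χ n) s / LSeries (fun n ↦ χ n) s) := by
  have h := isTame_LSeries_dirichletCharacter χ
  refine (h.deriv.neg.mul (h.inv (fun s hs ↦ χ.LSeries_ne_zero_of_one_lt_re hs)
    (polyLogBdd_inv_LSeries χ))).congr fun s _ ↦ ?_
  simp [div_eq_mul_inv]

end LowerBound

section VonMangoldt

open scoped Classical in
/-- The residue at `1` of the negative logarithmic derivative of the `L`-function of `χ`. -/
noncomputable def trivialIndicator {N : ℕ} (χ : DirichletCharacter ℂ N) : ℝ :=
  if χ = 1 then 1 else 0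

/-- The twisted von Mangoldt function, normalised to have mean value zero. -/
noncomputable def centredMangoldt {N : ℕ} (χ : DirichletCharacter ℂ N) (n : ℕ) : ℂ :=
  χ n * (ArithmeticFunction.vonMangoldt n : ℂ) - trivialIndicator χ

variable {N : ℕ} (χ : DirichletCharacter ℂ N)

lemma lseriesSummable_centredMangoldt {s : ℂ} (hs : 1 < s.re) :
    LSeriesSummable (centredMangoldt χ) s := by
  have h1 := χ.LSeriesSummable_twist_vonMangoldt hs
  have h2 : LSeriesSummable ((trivialIndicator χ : ℂ) • (1 : ℕ → ℂ)) s :=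
    (LSeriesSummable_one_iff.2 hs).smul _
  convert h1.sub h2 using 1
  ext n
  simp [centredMangoldt]

lemma LSeries_centredMangoldt {s : ℂ} (hs : 1 < s.re) :
    LSeries (centredMangoldt χ) s = -deriv (LSeries fun n ↦ χ n) s / LSeries (fun n ↦ χ n) s
      - (trivialIndicator χ : ℂ) * LSeries 1 s := by
  have h1 := χ.LSeriesSummable_twist_vonMangoldt hs
  have h2 : LSeriesSummable ((trivialIndicator χ : ℂ) • (1 : ℕ → ℂ)) s :=
    (LSeriesSummable_one_iff.2 hs).smul _
  rw [← χ.LSeries_twist_vonMangoldt_eq hs, ← LSeries_smul, ← LSeries_sub h1 h2]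
  congr 1
  ext n
  simp [centredMangoldt]

variable [NeZero N]

lemma isTame_LSeries_centredMangoldt : IsTame (LSeries (centredMangoldt χ)) := by
  refine ((isTame_logDeriv_LSeries χ).add
    (isTame_LSeries_one.const_mul (-(trivialIndicator χ : ℂ)))).congr fun s hs ↦ ?_
  rw [LSeries_centredMangoldt χ hs]
  simp only [Pi.add_apply]
  ring

lemma deriv_LFunction_eq_deriv_LSeries {s : ℂ} (hs : 1 < s.re) :
    deriv χ.LFunction s = deriv (LSeries fun n ↦ χ n) s :=
  Filter.EventuallyEq.deriv_eq <| by
    filter_upwards [isOpen_one_lt_re.mem_nhds hs] with z hz using χ.LFunction_eq_LSeries hz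

lemma exists_analyticAt_extension : ∃ G : ℂ → ℂ, (∀ s : ℂ, 1 ≤ s.re → AnalyticAt ℂ G s) ∧
    ∀ s : ℂ, 1 < s.re → LSeries (centredMangoldt χ) s = G s := by
  by_cases hχ : χ = 1
  · subst hχ
    set E := DirichletCharacter.LFunctionTrivChar₁ N with hE
    set Z := DirichletCharacter.LFunctionTrivChar₁ 1 with hZ
    have hEd : Differentiable ℂ E := DirichletCharacter.differentiable_LFunctionTrivChar₁ N
    have hZd : Differentiable ℂ Z := DirichletCharacter.differentiable_LFunctionTrivChar₁ 1
    have hZs : Differentiable ℂ (dslope Z 1) := by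
      rw [← differentiableOn_univ] at hZd ⊢
      exact (Complex.differentiableOn_dslope Filter.univ_mem).2 hZd
    have hE0 : ∀ s : ℂ, 1 ≤ s.re → E s ≠ 0 := by
      intro s hs
      rcases eq_or_ne s 1 with rfl | h1
      · exact DirichletCharacter.LFunctionTrivChar₁_apply_one_ne_zero N
      · rw [hE, DirichletCharacter.LFunctionTrivChar₁, Function.update_of_ne h1]
        exact mul_ne_zero (sub_ne_zero.2 h1)
          (DirichletCharacter.LFunction_ne_zero_of_one_le_re _ (Or.inr h1) hs)
    refine ⟨fun s ↦ -deriv E s / E s - dslope Z 1 s, fun s hs ↦ ?_, fun s hs ↦ ?_⟩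
    · exact ((hEd.analyticAt s).deriv.neg.div (hEd.analyticAt s) (hE0 s hs)).sub (hZs.analyticAt s)
    · have h1 : s ≠ 1 := fun h ↦ by simp [h] at hs
      have h1' := sub_ne_zero.2 h1
      have hL0 := (1 : DirichletCharacter ℂ N).LSeries_ne_zero_of_one_lt_re hs
      have eE : E s = (s - 1) * LSeries (fun n ↦ (1 : DirichletCharacter ℂ N) n) s := by
        rw [hE, DirichletCharacter.LFunctionTrivChar₁, Function.update_of_ne h1,
          ← DirichletCharacter.LFunction_eq_LSeries _ hs]
      have eE' : deriv E s =
          (s - 1) * deriv (LSeries (fun n ↦ (1 : DirichletCharacter ℂ N) n)) s +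
            LSeries (fun n ↦ (1 : DirichletCharacter ℂ N) n) s := by
        rw [hE, DirichletCharacter.deriv_LFunctionTrivChar₁_apply_of_ne_one N h1,
          ← DirichletCharacter.LFunction_eq_LSeries _ hs, ← deriv_LFunction_eq_deriv_LSeries _ hs]
      have eZ : dslope Z 1 s = LSeries 1 s - 1 / (s - 1) := by
        rw [dslope_of_ne _ h1, slope_def_field, LSeries_one_eq_riemannZeta hs]
        have a1 : Z 1 = 1 := by simp [hZ, DirichletCharacter.LFunctionTrivChar₁]
        have a2 : Z s = (s - 1) * riemannZeta s := by
          rw [hZ, DirichletCharacter.LFunctionTrivChar₁, Function.update_of_ne h1,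
            DirichletCharacter.LFunctionTrivChar_eq_mul_riemannZeta h1]
          simp
        rw [a1, a2]
        field_simp
      beta_reduce
      rw [LSeries_centredMangoldt _ hs, eE, eE', eZ, trivialIndicator, if_pos rfl,
        Complex.ofReal_one, one_mul]
      field_simp
      ring
  · refine ⟨fun s ↦ -deriv χ.LFunction s / χ.LFunction s, fun s hs ↦ ?_, fun s hs ↦ ?_⟩
    · have hd := DirichletCharacter.differentiable_LFunction hχ
      exact (hd.analyticAt s).deriv.neg.div (hd.analyticAt s)
        (χ.LFunction_ne_zero_of_one_le_re (Or.inl hχ) hs)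
    · beta_reduce
      rw [LSeries_centredMangoldt _ hs, trivialIndicator, if_neg hχ,
        Complex.ofReal_zero, zero_mul, sub_zero, χ.LFunction_eq_LSeries hs,
        deriv_LFunction_eq_deriv_LSeries χ hs]

lemma exists_norm_iteratedDeriv_centredMangoldt_le_of_abs_im_le (k : ℕ) :
    ∃ C : ℝ, ∀ s : ℂ, 1 < s.re → s.re ≤ 3 → |s.im| ≤ 1 →
      ‖iteratedDeriv k (LSeries (centredMangoldt χ)) s‖ ≤ C := by
  obtain ⟨G, hG, hFG⟩ := exists_analyticAt_extension χ
  have hc : IsCompact (Set.Icc (1 : ℝ) 3 ×ℂ Set.Icc (-1 : ℝ) 1) :=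
    isCompact_Icc.reProdIm isCompact_Icc
  obtain ⟨C, hC⟩ := hc.exists_bound_of_continuousOn (f := iteratedDeriv k G) fun s hs ↦ by
    rw [iteratedDeriv_eq_iterate]
    exact ((hG s hs.1.1).iterated_deriv k).continuousAt.continuousWithinAt
  refine ⟨C, fun s h1 h3 ht ↦ ?_⟩
  rw [iteratedDeriv_congr_half_plane hFG k h1]
  exact hC s ⟨⟨h1.le, h3⟩, abs_le.1 ht⟩

lemma exists_norm_iteratedDeriv_centredMangoldt_le (k : ℕ) :
    ∃ C : ℝ, 0 ≤ C ∧ ∀ s : ℂ, 1 < s.re → s.re ≤ 3 →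
      ‖iteratedDeriv k (LSeries (centredMangoldt χ)) s‖ ≤ C * (1 + s.im ^ 2) ^ (1 / 4 : ℝ) := by
  obtain ⟨C₁, h1⟩ := exists_norm_iteratedDeriv_centredMangoldt_le_of_abs_im_le χ k
  obtain ⟨C₂, B, hC₂, h2⟩ := (isTame_LSeries_centredMangoldt χ).2 k
  set ε : ℝ := 1 / (2 * (B + 1)) with hε
  have hε0 : 0 < ε := by positivity
  set C₃ : ℝ := C₂ * ((1 / ε) ^ B * (121 : ℝ) ^ (1 / 4 : ℝ)) with hC₃
  have hC₃0 : 0 ≤ C₃ := by positivity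
  refine ⟨max C₁ C₃, le_max_of_le_right hC₃0, fun s hs1 hs3 ↦ ?_⟩
  have hone : 1 ≤ (1 + s.im ^ 2) ^ (1 / 4 : ℝ) :=
    Real.one_le_rpow (by nlinarith) (by norm_num)
  rcases le_total |s.im| 1 with ht | ht
  · calc _ ≤ C₁ := h1 s hs1 hs3 ht
      _ ≤ max C₁ C₃ := le_max_left _ _
      _ ≤ _ := le_mul_of_one_le_right (le_max_of_le_right hC₃0) hone
  · have hx1 : 1 ≤ |s.im| + 10 := by linarith
    have hx0 : 0 ≤ |s.im| + 10 := by linarith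
    have hl := one_le_logHeight s
    have hlog : logHeight s ≤ (|s.im| + 10) ^ ε / ε := Real.log_le_rpow_div hx0 hε0
    have hpow : logHeight s ^ B ≤ (1 / ε) ^ B * (|s.im| + 10) ^ (1 / 2 : ℝ) := by
      calc _ ≤ ((|s.im| + 10) ^ ε / ε) ^ B := by gcongr
        _ = (1 / ε) ^ B * (|s.im| + 10) ^ (ε * B) := by
          rw [Real.rpow_mul_natCast hx0, ← mul_pow]; ring
        _ ≤ _ := by
          gcongr
          rw [hε, one_div_mul_eq_div, div_le_div_iff₀ (by positivity) (by norm_num)]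
          linarith
    have hsq : (|s.im| + 10) ^ (1 / 2 : ℝ) ≤
        (121 : ℝ) ^ (1 / 4 : ℝ) * (1 + s.im ^ 2) ^ (1 / 4 : ℝ) := by
      rw [← Real.mul_rpow (by norm_num) (by positivity)]
      have : (|s.im| + 10) ^ (1 / 2 : ℝ) = ((|s.im| + 10) ^ 2) ^ (1 / 4 : ℝ) := by
        rw [← Real.rpow_natCast_mul hx0]; norm_num
      rw [this]
      gcongr
      rw [← sq_abs s.im]
      nlinarith
    calc _ ≤ C₂ * logHeight s ^ B := h2 s ⟨hs1, hs3, ht⟩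
      _ ≤ C₂ * ((1 / ε) ^ B * ((121 : ℝ) ^ (1 / 4 : ℝ) * (1 + s.im ^ 2) ^ (1 / 4 : ℝ))) := by
        gcongr
        exact hpow.trans (by gcongr)
      _ = C₃ * (1 + s.im ^ 2) ^ (1 / 4 : ℝ) := by rw [hC₃]; ring
      _ ≤ _ := by gcongr; exact le_max_right _ _

end VonMangoldt

section Perron

/-- The Mellin transform of `u ↦ max (1 - u) 0`. -/
noncomputable def rampMellin (s : ℂ) : ℂ := 1 / s - 1 / (s + 1)

lemma hasMellin_ramp {s : ℂ} (hs : 0 < s.re) :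
    HasMellin (fun u : ℝ ↦ ((max (1 - u) 0 : ℝ) : ℂ)) s (rampMellin s) := by
  have h1 := hasMellin_one_Ioc hs
  have h2 := hasMellin_cpow_Ioc 1 (s := s) (by simp; linarith)
  have h := hasMellin_sub h1.1 h2.1
  rw [h1.2, h2.2] at h
  have e : Set.EqOn (fun t : ℝ ↦ (t : ℂ) ^ (s - 1) • ((Set.Ioc 0 1).indicator (fun _ ↦ (1 : ℂ)) t -
      (Set.Ioc 0 1).indicator (fun t : ℝ ↦ (t : ℂ) ^ (1 : ℂ)) t))
      (fun t : ℝ ↦ (t : ℂ) ^ (s - 1) • ((max (1 - t) 0 : ℝ) : ℂ)) (Set.Ioi 0) := by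
    intro t ht
    beta_reduce
    congr 1
    by_cases h1 : t ≤ 1
    · have hm : t ∈ Set.Ioc (0 : ℝ) 1 := ⟨ht, h1⟩
      rw [Set.indicator_of_mem hm, Set.indicator_of_mem hm, Complex.cpow_one,
        max_eq_left (by linarith)]
      simp
    · rw [Set.indicator_of_notMem (fun h ↦ h1 h.2), Set.indicator_of_notMem (fun h ↦ h1 h.2),
        max_eq_right (by linarith)]
      simp
  refine ⟨h.1.congr_fun e measurableSet_Ioi, ?_⟩
  rw [rampMellin, ← h.2]
  exact (MeasureTheory.setIntegral_congr_fun measurableSet_Ioi e).symm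

lemma norm_rampMellin_le {σ : ℝ} (hσ : 1 ≤ σ) (t : ℝ) :
    ‖rampMellin (σ + t * Complex.I)‖ ≤ (1 + t ^ 2)⁻¹ := by
  set s : ℂ := σ + t * Complex.I with hs
  have hre : s.re = σ := by simp [hs]
  have him : s.im = t := by simp [hs]
  have h0 : s ≠ 0 := fun h ↦ by rw [h] at hre; simp at hre; linarith
  have h1 : s + 1 ≠ 0 := fun h ↦ by
    have := congrArg Complex.re h
    simp [hre] at this; linarith
  have e : rampMellin s = (s * (s + 1))⁻¹ := by rw [rampMellin]; field_simp; ring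
  rw [e, norm_inv, norm_mul]
  have n1 : √(1 + t ^ 2) ≤ ‖s‖ := by
    rw [Complex.norm_eq_sqrt_sq_add_sq, hre, him]
    apply Real.sqrt_le_sqrt; nlinarith
  have n2 : √(1 + t ^ 2) ≤ ‖s + 1‖ := by
    rw [Complex.norm_eq_sqrt_sq_add_sq, Complex.add_re, Complex.add_im, hre, him]
    apply Real.sqrt_le_sqrt
    simp only [Complex.one_re, Complex.one_im]
    nlinarith
  have n3 : 1 + t ^ 2 = √(1 + t ^ 2) * √(1 + t ^ 2) := (Real.mul_self_sqrt (by positivity)).symm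
  have : 1 + t ^ 2 ≤ ‖s‖ * ‖s + 1‖ := by rw [n3]; gcongr
  exact inv_anti₀ (by positivity) this

lemma continuous_rampMellin {σ : ℝ} (hσ : 1 ≤ σ) :
    Continuous fun t : ℝ ↦ rampMellin (σ + t * Complex.I) := by
  have h0 : ∀ t : ℝ, (σ : ℂ) + t * Complex.I ≠ 0 := fun t h ↦ by
    have := congrArg Complex.re h
    simp at this; linarith
  have h1 : ∀ t : ℝ, (σ : ℂ) + t * Complex.I + 1 ≠ 0 := fun t h ↦ by
    have := congrArg Complex.re h
    simp at this; linarith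
  unfold rampMellin
  exact (continuous_const.div (by fun_prop) h0).sub (continuous_const.div (by fun_prop) h1)

lemma integrable_rampMellin {σ : ℝ} (hσ : 1 ≤ σ) :
    MeasureTheory.Integrable fun t : ℝ ↦ rampMellin (σ + t * Complex.I) :=
  integrable_inv_one_add_sq.mono' (continuous_rampMellin hσ).aestronglyMeasurable
    (MeasureTheory.ae_of_all _ (norm_rampMellin_le hσ))

lemma integral_cpow_mul_rampMellin {σ y : ℝ} (hσ : 1 ≤ σ) (hy : 0 < y) :
    ∫ t : ℝ, (y : ℂ) ^ (-(σ + t * Complex.I)) * rampMellin (σ + t * Complex.I) =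
      2 * π * ((max (1 - y) 0 : ℝ) : ℂ) := by
  have hre : ∀ t : ℝ, 0 < ((σ : ℂ) + t * Complex.I).re := fun t ↦ by simp; linarith
  have hm : ∀ t : ℝ, mellin (fun u : ℝ ↦ ((max (1 - u) 0 : ℝ) : ℂ)) (σ + t * Complex.I) =
      rampMellin (σ + t * Complex.I) := fun t ↦ (hasMellin_ramp (hre t)).2
  have h := mellinInv_mellin_eq σ (fun u : ℝ ↦ ((max (1 - u) 0 : ℝ) : ℂ)) hy
    (hasMellin_ramp (by simp; linarith)).1 (by
      unfold Complex.VerticalIntegrable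
      simp_rw [hm]
      exact integrable_rampMellin hσ) (by fun_prop)
  rw [mellinInv] at h
  simp_rw [hm, smul_eq_mul] at h
  rw [← h, Complex.real_smul]
  have hpi : (2 * π : ℂ) ≠ 0 := by exact_mod_cast Real.two_pi_pos.ne'
  push_cast
  rw [← mul_assoc, mul_one_div_cancel hpi, one_mul]

lemma ofReal_div_cpow_neg {a b : ℝ} (ha : 0 < a) (hb : 0 < b) (s : ℂ) :
    ((a / b : ℝ) : ℂ) ^ (-s) = (a : ℂ) ^ (-s) * (b : ℂ) ^ s := by
  have hb' : (b : ℂ) ≠ 0 := by exact_mod_cast hb.ne'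
  have h := Complex.mul_cpow_ofReal_nonneg (div_pos ha hb).le hb.le (-s)
  rw [← Complex.ofReal_mul, div_mul_cancel₀ _ hb.ne'] at h
  rw [h, mul_assoc, ← Complex.cpow_add _ _ hb', neg_add_cancel, Complex.cpow_zero, mul_one]

lemma tsum_mul_ramp_eq_integral {b : ℕ → ℂ} {σ x : ℝ} (hσ : 1 ≤ σ) (hx : 0 < x)
    (hb : LSeriesSummable b σ) (hb0 : b 0 = 0) :
    ∑' n, b n * (2 * π * ((max (1 - n / x) 0 : ℝ) : ℂ)) =
      ∫ t : ℝ, LSeries b (σ + t * Complex.I) *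
        ((x : ℂ) ^ ((σ : ℂ) + t * Complex.I) * rampMellin (σ + t * Complex.I)) := by
  set k : ℝ → ℂ := fun t ↦ (x : ℂ) ^ ((σ : ℂ) + t * Complex.I) * rampMellin (σ + t * Complex.I)
    with hk
  have hxc : (x : ℂ) ≠ 0 := by exact_mod_cast hx.ne'
  have hkn : ∀ t, ‖k t‖ = x ^ σ * ‖rampMellin (σ + t * Complex.I)‖ := fun t ↦ by
    rw [hk]; simp [Complex.norm_cpow_eq_rpow_re_of_pos hx]
  have hkc : Continuous k := by
    refine Continuous.mul ?_ (continuous_rampMellin hσ)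
    exact Continuous.const_cpow (by fun_prop) (Or.inl hxc)
  have hki : MeasureTheory.Integrable k := by
    refine ((integrable_rampMellin hσ).norm.const_mul (x ^ σ)).mono' hkc.aestronglyMeasurable
      (MeasureTheory.ae_of_all _ fun t ↦ (hkn t).le)
  have hterm : ∀ n (t : ℝ), ‖LSeries.term b (σ + t * Complex.I) n‖ = ‖LSeries.term b σ n‖ := by
    intro n t
    rw [LSeries.norm_term_eq, LSeries.norm_term_eq]; simp
  have hFi : ∀ n, MeasureTheory.Integrable
      fun t : ℝ ↦ LSeries.term b (σ + t * Complex.I) n * k t := by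
    intro n
    refine (hki.norm.const_mul ‖LSeries.term b σ n‖).mono' ?_
      (MeasureTheory.ae_of_all _ fun t ↦ by rw [norm_mul, hterm])
    refine Continuous.aestronglyMeasurable (Continuous.mul ?_ hkc)
    rcases eq_or_ne n 0 with rfl | hn
    · simp only [LSeries.term_zero]; exact continuous_const
    · have hnc : (n : ℂ) ≠ 0 := by exact_mod_cast hn
      simp_rw [LSeries.term_of_ne_zero hn]
      refine continuous_const.div (Continuous.const_cpow (by fun_prop) (Or.inl hnc)) fun t ↦ ?_
      simp [Complex.cpow_eq_zero_iff, hnc]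
  have hsum : Summable fun n ↦ ∫ t : ℝ, ‖LSeries.term b (σ + t * Complex.I) n * k t‖ := by
    simp_rw [norm_mul, hterm, MeasureTheory.integral_const_mul]
    exact hb.norm.mul_right _
  have h := MeasureTheory.hasSum_integral_of_summable_integral_norm hFi hsum
  simp_rw [tsum_mul_right] at h
  rw [show (fun t : ℝ ↦ LSeries b (σ + t * Complex.I) * k t) =
    fun t : ℝ ↦ (∑' n, LSeries.term b (σ + t * Complex.I) n) * k t from rfl, ← h.tsum_eq]
  refine tsum_congr fun n ↦ ?_
  rcases eq_or_ne n 0 with rfl | hn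
  · simp [hb0]
  · have hn0 : (0 : ℝ) < n := by exact_mod_cast Nat.pos_of_ne_zero hn
    rw [← integral_cpow_mul_rampMellin hσ (div_pos hn0 hx), ← MeasureTheory.integral_const_mul]
    congr 1
    ext t
    rw [LSeries.term_of_ne_zero hn, hk, ofReal_div_cpow_neg hn0 hx, Complex.cpow_neg,
      Complex.ofReal_natCast]
    ring

lemma norm_sum_mul_one_sub_le {b : ℕ → ℂ} {σ x C : ℝ} (hσ : 1 ≤ σ) (hx : 0 < x)
    (hb : LSeriesSummable b σ) (hb0 : b 0 = 0) (hC0 : 0 ≤ C)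
    (hC : ∀ t : ℝ, ‖LSeries b (σ + t * Complex.I)‖ ≤ C * (1 + t ^ 2) ^ (1 / 4 : ℝ)) :
    ‖∑ n ∈ Finset.Icc 1 ⌊x⌋₊, b n * ((1 - n / x : ℝ) : ℂ)‖ ≤
      C * x ^ σ * ∫ t : ℝ, (1 + t ^ 2) ^ (-(3 / 2 : ℝ) / 2) := by
  have hint : MeasureTheory.Integrable fun t : ℝ ↦ (1 + t ^ 2) ^ (-(3 / 2 : ℝ) / 2) := by
    have := integrable_rpow_neg_one_add_norm_sq (E := ℝ) (μ := MeasureTheory.volume)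
      (r := 3 / 2) (by norm_num)
    simpa using this
  have h := tsum_mul_ramp_eq_integral hσ hx hb hb0
  have e : ∑' n, b n * (2 * π * ((max (1 - n / x) 0 : ℝ) : ℂ)) =
      2 * π * ∑ n ∈ Finset.Icc 1 ⌊x⌋₊, b n * ((1 - n / x : ℝ) : ℂ) := by
    rw [tsum_eq_sum (s := Finset.Icc 1 ⌊x⌋₊), Finset.mul_sum]
    · refine Finset.sum_congr rfl fun n hn ↦ ?_
      have : (n : ℝ) / x ≤ 1 := by
        rw [div_le_one hx]
        exact (Nat.le_floor_iff hx.le).1 (Finset.mem_Icc.1 hn).2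
      rw [max_eq_left (by linarith)]
      ring
    · intro n hn
      rcases eq_or_ne n 0 with rfl | hn0
      · simp [hb0]
      · have hlt : x < n := by
          rw [Finset.mem_Icc, not_and_or] at hn
          rcases hn with hn | hn
          · omega
          · rw [Nat.le_floor_iff hx.le] at hn; exact not_le.1 hn
        rw [max_eq_right]
        · simp
        · have : 1 ≤ (n : ℝ) / x := by rw [one_le_div hx]; exact hlt.le
          linarith
  have hI : ‖∫ t : ℝ, LSeries b (σ + t * Complex.I) *
        ((x : ℂ) ^ ((σ : ℂ) + t * Complex.I) * rampMellin (σ + t * Complex.I))‖ ≤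
      C * x ^ σ * ∫ t : ℝ, (1 + t ^ 2) ^ (-(3 / 2 : ℝ) / 2) := by
    rw [← MeasureTheory.integral_const_mul]
    refine MeasureTheory.norm_integral_le_of_norm_le (hint.const_mul _)
      (MeasureTheory.ae_of_all _ fun t ↦ ?_)
    rw [norm_mul, norm_mul, Complex.norm_cpow_eq_rpow_re_of_pos hx]
    have hre : ((σ : ℂ) + t * Complex.I).re = σ := by simp
    rw [hre]
    have hp : (0 : ℝ) < 1 + t ^ 2 := by positivity
    calc _ ≤ (C * (1 + t ^ 2) ^ (1 / 4 : ℝ)) * (x ^ σ * (1 + t ^ 2)⁻¹) := by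
          gcongr
          · exact hC t
          · exact norm_rampMellin_le hσ t
      _ = C * x ^ σ * ((1 + t ^ 2) ^ (1 / 4 : ℝ) * (1 + t ^ 2) ^ (-1 : ℝ)) := by
          rw [Real.rpow_neg_one]; ring
      _ = _ := by rw [← Real.rpow_add hp]; norm_num
  rw [← h, e, norm_mul] at hI
  refine le_trans ?_ hI
  have : (1 : ℝ) ≤ ‖(2 * π : ℂ)‖ := by
    rw [norm_mul, Complex.norm_real, Real.norm_eq_abs, abs_of_pos Real.pi_pos, Complex.norm_ofNat]
    linarith [Real.pi_gt_three]
  exact le_mul_of_one_le_left (norm_nonneg _) this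

end Perron

section Desmoothing

variable {N : ℕ} (χ : DirichletCharacter ℂ N)

lemma iterate_logMul_apply (a : ℕ → ℂ) (k n : ℕ) :
    LSeries.logMul^[k] a n = a n * ((Real.log n ^ k : ℝ) : ℂ) := by
  induction k generalizing a with
  | zero => simp
  | succ k ih =>
    rw [Function.iterate_succ_apply, ih]
    simp only [LSeries.logMul]
    rw [← Complex.ofReal_natCast, ← Complex.ofReal_log (Nat.cast_nonneg n)]
    push_cast
    ring

lemma abscissaOfAbsConv_centredMangoldt_le : LSeries.abscissaOfAbsConv (centredMangoldt χ) ≤ 1 :=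
  LSeries.abscissaOfAbsConv_le_of_forall_lt_LSeriesSummable' fun y hy ↦
    lseriesSummable_centredMangoldt χ (by rw [Complex.ofReal_re]; exact_mod_cast hy)

lemma trivialIndicator_nonneg : 0 ≤ trivialIndicator χ := by
  unfold trivialIndicator; split_ifs <;> norm_num

lemma trivialIndicator_le_one : trivialIndicator χ ≤ 1 := by
  unfold trivialIndicator; split_ifs <;> norm_num

lemma norm_centredMangoldt_le (n : ℕ) : ‖centredMangoldt χ n‖ ≤ Real.log n + 1 := by
  unfold centredMangoldt
  refine (norm_sub_le _ _).trans (add_le_add ?_ ?_)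
  · rw [norm_mul, Complex.norm_real, Real.norm_eq_abs,
      abs_of_nonneg ArithmeticFunction.vonMangoldt_nonneg]
    calc _ ≤ 1 * Real.log n := by
          gcongr
          · exact χ.norm_le_one _
          · exact ArithmeticFunction.vonMangoldt_le_log
      _ = _ := one_mul _
  · rw [Complex.norm_real, Real.norm_eq_abs, abs_of_nonneg (trivialIndicator_nonneg χ)]
    exact trivialIndicator_le_one χ

lemma exists_norm_sum_mul_one_sub_le [NeZero N] (k : ℕ) (hk : k ≠ 0) :
    ∃ C : ℝ, 0 ≤ C ∧ ∀ x : ℝ, 1 ≤ x →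
      ‖∑ n ∈ Finset.Icc 1 ⌊x⌋₊, centredMangoldt χ n * ((Real.log n ^ k : ℝ) : ℂ) *
        ((1 - n / x : ℝ) : ℂ)‖ ≤ C * x := by
  obtain ⟨C, hC0, hC⟩ := exists_norm_iteratedDeriv_centredMangoldt_le χ k
  set J := ∫ t : ℝ, (1 + t ^ 2) ^ (-(3 / 2 : ℝ) / 2) with hJ
  have hJ0 : 0 ≤ J := MeasureTheory.integral_nonneg fun t ↦ by positivity
  refine ⟨C * Real.exp 1 * J, by positivity, fun x hx ↦ ?_⟩
  have hx0 : 0 < x := by linarith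
  have hl : 0 ≤ Real.log x := Real.log_nonneg hx
  set σ : ℝ := 1 + 1 / (1 + Real.log x) with hσ
  have hinv : 1 / (1 + Real.log x) ≤ 1 := by
    rw [div_le_one (by linarith)]; linarith
  have hinv0 : 0 < 1 / (1 + Real.log x) := by positivity
  have hσ1 : 1 < σ := by linarith
  have habs : ∀ s : ℂ, 1 < s.re → LSeries.abscissaOfAbsConv (centredMangoldt χ) < s.re :=
    fun s hs ↦ (abscissaOfAbsConv_centredMangoldt_le χ).trans_lt (by exact_mod_cast hs)
  have hsumm : LSeriesSummable (LSeries.logMul^[k] (centredMangoldt χ)) σ := by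
    refine LSeriesSummable_of_abscissaOfAbsConv_lt_re ?_
    rw [LSeries.absicssaOfAbsConv_logPowMul]
    exact habs _ (by simpa using hσ1)
  have hb0 : LSeries.logMul^[k] (centredMangoldt χ) 0 = 0 := by
    rw [iterate_logMul_apply]; simp [hk]
  have hbd : ∀ t : ℝ, ‖LSeries (LSeries.logMul^[k] (centredMangoldt χ)) (σ + t * Complex.I)‖ ≤
      C * (1 + t ^ 2) ^ (1 / 4 : ℝ) := by
    intro t
    have hre : ((σ : ℂ) + t * Complex.I).re = σ := by simp
    have him : ((σ : ℂ) + t * Complex.I).im = t := by simp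
    have h := hC (σ + t * Complex.I) (by rw [hre]; exact hσ1) (by rw [hre]; linarith)
    rw [LSeries_iteratedDeriv k (habs _ (by rw [hre]; exact hσ1)), him] at h
    simpa using h
  have h := norm_sum_mul_one_sub_le hσ1.le hx0 hsumm hb0 hC0 hbd
  simp_rw [iterate_logMul_apply] at h
  refine h.trans ?_
  have hxσ : x ^ σ ≤ Real.exp 1 * x := by
    rw [hσ, Real.rpow_add hx0, Real.rpow_one, mul_comm]
    gcongr
    rw [Real.rpow_def_of_pos hx0, Real.exp_le_exp, mul_one_div, div_le_one (by linarith)]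
    linarith
  calc _ ≤ C * (Real.exp 1 * x) * J := by gcongr
    _ = _ := by ring

lemma exists_norm_sum_mul_log_pow_le [NeZero N] (j : ℕ) :
    ∃ C : ℝ, 0 ≤ C ∧ ∀ x : ℝ, 1 ≤ x →
      ‖∑ n ∈ Finset.Icc 1 ⌊x⌋₊, centredMangoldt χ n * ((Real.log n ^ (2 * j + 1) : ℝ) : ℂ)‖ ≤
        C * x * (1 + Real.log x) ^ (j + 1) := by
  obtain ⟨C, hC0, hC⟩ := exists_norm_sum_mul_one_sub_le χ (2 * j + 1) (by omega)
  set b : ℕ → ℂ := fun n ↦ centredMangoldt χ n * ((Real.log n ^ (2 * j + 1) : ℝ) : ℂ) with hb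
  have hS : ∀ x : ℝ, 1 ≤ x → ‖∑ n ∈ Finset.Icc 1 ⌊x⌋₊, b n * ((x - n : ℝ) : ℂ)‖ ≤ C * x ^ 2 := by
    intro x hx
    have hx0 : x ≠ 0 := by linarith
    have e : ∑ n ∈ Finset.Icc 1 ⌊x⌋₊, b n * ((x - n : ℝ) : ℂ) =
        x * ∑ n ∈ Finset.Icc 1 ⌊x⌋₊, b n * ((1 - n / x : ℝ) : ℂ) := by
      rw [Finset.mul_sum]
      refine Finset.sum_congr rfl fun n _ ↦ ?_
      have : x - n = x * (1 - n / x) := by field_simp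
      rw [this]; push_cast; ring
    rw [e, norm_mul, Complex.norm_real, Real.norm_eq_abs, abs_of_nonneg (by linarith)]
    nlinarith [hC x hx]
  set D : ℝ := 1 + Real.exp 1 * (j + 1).factorial with hD
  refine ⟨5 * C + 2 * D, by positivity, fun x hx ↦ ?_⟩
  have hx0 : 0 < x := by linarith
  set ℓ := 1 + Real.log x with hℓ
  have hℓ1 : 1 ≤ ℓ := by linarith [Real.log_nonneg hx]
  have hP1 : 1 ≤ ℓ ^ (j + 1) := one_le_pow₀ hℓ1
  set P := ℓ ^ (j + 1) with hP
  set h := x / P with hh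
  have hh0 : 0 < h := by positivity
  have hhx : h ≤ x := div_le_self hx0.le hP1
  have hhP : h * P = x := by rw [hh]; field_simp
  have hone : 1 ≤ (D - 1) * h := by
    have h1 := Real.pow_div_factorial_le_exp ℓ (by linarith) (j + 1)
    rw [hℓ, Real.exp_add, Real.exp_log hx0, ← hℓ, div_le_iff₀ (by positivity)] at h1
    rw [hD, hh, add_sub_cancel_left, mul_div_assoc', one_le_div (by positivity)]
    linarith
  have hfl : ⌊x⌋₊ ≤ ⌊x + h⌋₊ := Nat.floor_mono (by linarith)
  have hsplit : (h : ℂ) * ∑ n ∈ Finset.Icc 1 ⌊x⌋₊, b n =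
      ∑ n ∈ Finset.Icc 1 ⌊x + h⌋₊, b n * ((x + h - n : ℝ) : ℂ)
        - ∑ n ∈ Finset.Icc 1 ⌊x⌋₊, b n * ((x - n : ℝ) : ℂ)
        - ∑ n ∈ Finset.Icc 1 ⌊x + h⌋₊ \ Finset.Icc 1 ⌊x⌋₊, b n * ((x + h - n : ℝ) : ℂ) := by
    have e : (h : ℂ) * ∑ n ∈ Finset.Icc 1 ⌊x⌋₊, b n =
        ∑ n ∈ Finset.Icc 1 ⌊x⌋₊, b n * ((x + h - n : ℝ) : ℂ) -
          ∑ n ∈ Finset.Icc 1 ⌊x⌋₊, b n * ((x - n : ℝ) : ℂ) := by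
      rw [Finset.mul_sum, ← Finset.sum_sub_distrib]
      refine Finset.sum_congr rfl fun n _ ↦ ?_
      push_cast; ring
    rw [← Finset.sum_sdiff (Finset.Icc_subset_Icc_right hfl), e]
    ring
  have hcard : ((Finset.Icc 1 ⌊x + h⌋₊ \ Finset.Icc 1 ⌊x⌋₊).card : ℝ) ≤ D * h := by
    rw [Finset.card_sdiff_of_subset (Finset.Icc_subset_Icc_right hfl), Nat.card_Icc, Nat.card_Icc,
      Nat.add_sub_cancel, Nat.add_sub_cancel, Nat.cast_sub hfl]
    have := Nat.floor_le (show 0 ≤ x + h by linarith)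
    have := Nat.lt_floor_add_one x
    linarith
  have hsm : ‖∑ n ∈ Finset.Icc 1 ⌊x + h⌋₊ \ Finset.Icc 1 ⌊x⌋₊, b n * ((x + h - n : ℝ) : ℂ)‖ ≤
      D * h * (2 * P ^ 2 * h) := by
    calc _ ≤ ∑ n ∈ Finset.Icc 1 ⌊x + h⌋₊ \ Finset.Icc 1 ⌊x⌋₊, 2 * P ^ 2 * h := by
          refine norm_sum_le_of_le _ fun n hn ↦ ?_
          rw [Finset.mem_sdiff, Finset.mem_Icc, Finset.mem_Icc] at hn
          obtain ⟨⟨hn1, hn2⟩, hn3⟩ := hn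
          have hxn : x < n := by
            by_contra! hc
            exact hn3 ⟨hn1, Nat.le_floor hc⟩
          have hnx : (n : ℝ) ≤ x + h := (Nat.le_floor_iff (by linarith)).1 hn2
          have hlog0 : 0 ≤ Real.log n := Real.log_natCast_nonneg n
          have hlog : Real.log n ≤ ℓ := by
            calc Real.log n ≤ Real.log (2 * x) := Real.log_le_log (by linarith) (by linarith)
              _ = Real.log 2 + Real.log x := Real.log_mul (by norm_num) hx0.ne'
              _ ≤ ℓ := by linarith [Real.log_two_lt_d9]
          rw [norm_mul, hb, norm_mul, Complex.norm_real, Complex.norm_real, Real.norm_eq_abs,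
            Real.norm_eq_abs, abs_of_nonneg (show 0 ≤ x + h - n by linarith),
            abs_of_nonneg (by positivity)]
          calc _ ≤ (2 * ℓ) * ℓ ^ (2 * j + 1) * h := by
                gcongr
                · linarith [norm_centredMangoldt_le χ n]
                · linarith
            _ = 2 * P ^ 2 * h := by rw [hP]; ring
      _ = ((Finset.Icc 1 ⌊x + h⌋₊ \ Finset.Icc 1 ⌊x⌋₊).card : ℝ) * (2 * P ^ 2 * h) := by
          rw [Finset.sum_const, nsmul_eq_mul]
      _ ≤ _ := by gcongr
  have hfin : h * ‖∑ n ∈ Finset.Icc 1 ⌊x⌋₊, b n‖ ≤ h * ((5 * C + 2 * D) * x * P) := by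
    have e1 : h * ‖∑ n ∈ Finset.Icc 1 ⌊x⌋₊, b n‖ = ‖(h : ℂ) * ∑ n ∈ Finset.Icc 1 ⌊x⌋₊, b n‖ := by
      rw [norm_mul, Complex.norm_real, Real.norm_eq_abs, abs_of_pos hh0]
    rw [e1, hsplit]
    refine (norm_sub_le _ _).trans ((add_le_add ((norm_sub_le _ _).trans
      (add_le_add (hS _ (by linarith)) (hS x hx))) hsm).trans ?_)
    have e2 : C * (x + h) ^ 2 ≤ C * (4 * x ^ 2) := by gcongr; nlinarith
    have e3 : h * ((5 * C + 2 * D) * x * P) = (5 * C + 2 * D) * x ^ 2 := by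
      linear_combination ((5 * C + 2 * D) * x) * hhP
    have e4 : D * h * (2 * P ^ 2 * h) = 2 * D * x ^ 2 := by
      linear_combination (2 * D * (h * P + x)) * hhP
    rw [e3, e4]
    linarith
  exact le_of_mul_le_mul_left hfin hh0

end Desmoothing

section PartialSummation

lemma one_third_le_log {t : ℝ} (ht : 3 / 2 ≤ t) : 1 / 3 ≤ Real.log t := by
  have h := Real.one_sub_inv_le_log_of_pos (show (0 : ℝ) < 3 / 2 by norm_num)
  have := Real.log_le_log (by norm_num) ht
  norm_num at h
  linarith

lemma exists_inv_log_pow_le (r : ℕ) :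
    ∃ C : ℝ, 0 ≤ C ∧ ∀ t x : ℝ, 3 / 2 ≤ t → t ≤ x →
      (Real.log t ^ r)⁻¹ ≤ C * (x / t) ^ (1 / 2 : ℝ) * (Real.log x ^ r)⁻¹ := by
  refine ⟨6 ^ r * r.factorial * Real.exp (1 / 2), by positivity, fun t x ht htx ↦ ?_⟩
  have hl := one_third_le_log ht
  have hlx : Real.log t ≤ Real.log x := Real.log_le_log (by linarith) htx
  have ht0 : 0 < t := by linarith
  have hx0 : 0 < x := by linarith
  set v := 1 + (Real.log x - Real.log t) with hv
  have hv0 : 0 ≤ v / 2 := by linarith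
  have hle : Real.log x ≤ Real.log t * (3 * v) := by nlinarith
  have hpow : v ^ r ≤ 2 ^ r * r.factorial * Real.exp (1 / 2) * (x / t) ^ (1 / 2 : ℝ) := by
    have h1 := Real.pow_div_factorial_le_exp (v / 2) hv0 r
    rw [div_le_iff₀ (by positivity), div_pow, div_le_iff₀ (by positivity)] at h1
    have h2 : Real.exp (v / 2) = Real.exp (1 / 2) * (x / t) ^ (1 / 2 : ℝ) := by
      rw [Real.rpow_def_of_pos (by positivity), Real.log_div hx0.ne' ht0.ne', ← Real.exp_add]
      congr 1
      rw [hv]; ring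
    rw [h2] at h1
    linarith
  rw [inv_le_iff_one_le_mul₀ (by positivity)]
  have hLx : 0 < Real.log x ^ r := by have := hl.trans hlx; positivity
  rw [mul_assoc, mul_comm _ (Real.log t ^ r), ← mul_assoc, ← div_eq_mul_inv, one_le_div hLx]
  calc Real.log x ^ r ≤ (Real.log t * (3 * v)) ^ r := by
        gcongr; linarith
    _ = 3 ^ r * v ^ r * Real.log t ^ r := by rw [mul_pow, mul_pow]; ring
    _ ≤ 3 ^ r * (2 ^ r * r.factorial * Real.exp (1 / 2) * (x / t) ^ (1 / 2 : ℝ)) *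
        Real.log t ^ r := by
        gcongr
    _ = _ := by
        rw [show (6 : ℝ) = 3 * 2 by norm_num, mul_pow]; ring

lemma integral_sqrt_div_le (x : ℝ) (hx : 2 ≤ x) :
    MeasureTheory.IntegrableOn (fun t ↦ (x / t) ^ (1 / 2 : ℝ)) (Set.Ioc 2 x) ∧
      ∫ t in Set.Ioc 2 x, (x / t) ^ (1 / 2 : ℝ) ≤ 2 * x := by
  have hx0 : 0 ≤ x := by linarith
  have he : Set.EqOn (fun t : ℝ ↦ (x / t) ^ (1 / 2 : ℝ))
      (fun t ↦ x ^ (1 / 2 : ℝ) * t ^ (-(1 / 2) : ℝ)) (Set.Ioc 2 x) := by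
    intro t ht
    have ht0 : 0 ≤ t := by linarith [ht.1]
    simp only
    rw [Real.div_rpow hx0 ht0, Real.rpow_neg ht0, div_eq_mul_inv]
  have hint : IntervalIntegrable (fun t : ℝ ↦ t ^ (-(1 / 2) : ℝ)) MeasureTheory.volume 2 x :=
    intervalIntegral.intervalIntegrable_rpow' (by norm_num)
  constructor
  · rw [MeasureTheory.integrableOn_congr_fun he measurableSet_Ioc]
    exact ((intervalIntegrable_iff_integrableOn_Ioc_of_le hx).1 hint).const_mul _
  · rw [MeasureTheory.setIntegral_congr_fun measurableSet_Ioc he,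
      ← intervalIntegral.integral_of_le hx, intervalIntegral.integral_const_mul,
      integral_rpow (Or.inl (by norm_num))]
    have h1 : x ^ (1 / 2 : ℝ) * x ^ (1 / 2 : ℝ) = x := by
      rw [← Real.rpow_add' hx0 (by norm_num)]; norm_num
    have h2 : (0 : ℝ) ≤ 2 ^ (1 / 2 : ℝ) := by positivity
    have h3 : (0 : ℝ) ≤ x ^ (1 / 2 : ℝ) := by positivity
    norm_num at h1 h2 h3 ⊢
    nlinarith [mul_nonneg h2 h3]

lemma exists_norm_sum_inv_log_pow_mul_le {b : ℕ → ℂ} (hb0 : b 0 = 0) (hb1 : b 1 = 0) (j : ℕ)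
    {C : ℝ} (hC0 : 0 ≤ C) (hC : ∀ x : ℝ, 1 ≤ x →
      ‖∑ n ∈ Finset.Icc 1 ⌊x⌋₊, b n‖ ≤ C * x * (1 + Real.log x) ^ (j + 1)) :
    ∃ C' : ℝ, 0 ≤ C' ∧ ∀ x : ℝ, 2 ≤ x →
      ‖∑ n ∈ Finset.Icc 0 ⌊x⌋₊, (((Real.log n ^ (2 * j + 2))⁻¹ : ℝ) : ℂ) * b n‖ ≤
        C' * x * (Real.log x ^ (j + 1))⁻¹ := by
  obtain ⟨K, hK0, hK⟩ := exists_inv_log_pow_le (j + 1)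
  set A := C * 4 ^ (j + 1) with hA
  have hA0 : 0 ≤ A := by positivity
  have hlog : ∀ t : ℝ, 2 ≤ t → 1 / 3 ≤ Real.log t := fun t ht ↦ one_third_le_log (by linarith)
  have hB : ∀ t : ℝ, 2 ≤ t → ‖∑ n ∈ Finset.Icc 0 ⌊t⌋₊, b n‖ ≤ A * t * Real.log t ^ (j + 1) := by
    intro t ht
    have hl := hlog t ht
    have e : ∑ n ∈ Finset.Icc 0 ⌊t⌋₊, b n = ∑ n ∈ Finset.Icc 1 ⌊t⌋₊, b n := by
      refine (Finset.sum_subset (Finset.Icc_subset_Icc_left (by norm_num)) fun n hn hn' ↦ ?_).symm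
      have : n = 0 := by simp only [Finset.mem_Icc] at hn hn'; omega
      rw [this, hb0]
    rw [e]
    refine (hC t (by linarith)).trans ?_
    calc C * t * (1 + Real.log t) ^ (j + 1) ≤ C * t * (4 * Real.log t) ^ (j + 1) := by
          gcongr; linarith
      _ = _ := by rw [hA, mul_pow]; ring
  set f : ℝ → ℂ := fun t ↦ (((Real.log t ^ (2 * j + 2))⁻¹ : ℝ) : ℂ) with hf
  set f' : ℝ → ℝ := fun t ↦
    -((2 * j + 2 : ℕ) * Real.log t ^ (2 * j + 1) * t⁻¹) / (Real.log t ^ (2 * j + 2)) ^ 2 with hf'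
  have hder : ∀ t : ℝ, 2 ≤ t → HasDerivAt f (f' t) t := by
    intro t ht
    have hl := hlog t ht
    have h1 : HasDerivAt (fun y ↦ (Real.log y ^ (2 * j + 2))⁻¹) (f' t) t :=
      ((Real.hasDerivAt_log (by linarith)).fun_pow (2 * j + 2)).fun_inv (by positivity)
    exact h1.ofReal_comp
  have hf'le : ∀ t : ℝ, 2 ≤ t →
      |f' t| ≤ 3 * (2 * j + 2) * t⁻¹ * (Real.log t ^ (j + 1))⁻¹ * (Real.log t ^ (j + 1))⁻¹ := by
    intro t ht
    have hl := hlog t ht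
    have hl0 : Real.log t ≠ 0 := by linarith
    have ht0 : t ≠ 0 := by linarith
    have : 0 < t := by linarith
    have hl0' : 0 < Real.log t := by linarith
    rw [hf', abs_div, abs_neg, abs_of_nonneg (by positivity), abs_of_nonneg (by positivity),
      div_le_iff₀ (by positivity)]
    have e : 3 * (2 * j + 2) * t⁻¹ * (Real.log t ^ (j + 1))⁻¹ * (Real.log t ^ (j + 1))⁻¹ *
        (Real.log t ^ (2 * j + 2)) ^ 2 =
        (2 * j + 2) * Real.log t ^ (2 * j + 1) * t⁻¹ * (3 * Real.log t) := by
      field_simp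
      ring
    rw [e]
    push_cast
    refine le_mul_of_one_le_right (by positivity) (by linarith)
  have hcont : ContinuousOn f' (Set.Ici 2) := by
    have hne : ∀ t ∈ Set.Ici (2 : ℝ), Real.log t ≠ 0 := fun t ht ↦ by linarith [hlog t ht]
    have hne' : ∀ t ∈ Set.Ici (2 : ℝ), t ≠ 0 := fun t ht ↦ by linarith [Set.mem_Ici.1 ht]
    refine ContinuousOn.div ?_ ?_ fun t ht ↦ pow_ne_zero _ (pow_ne_zero _ (hne t ht))
    · exact ((continuousOn_const.mul ((continuousOn_id.log hne').pow _)).mul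
        (continuousOn_id.inv₀ hne')).neg
    · exact ((continuousOn_id.log hne').pow _).pow _
  refine ⟨A + 6 * (2 * j + 2) * A * K, by positivity, fun x hx ↦ ?_⟩
  have hxl := hlog x hx
  have hint : MeasureTheory.IntegrableOn (deriv f) (Set.Icc 2 x) MeasureTheory.volume := by
    rw [MeasureTheory.integrableOn_congr_fun (g := fun t ↦ (f' t : ℂ))
      (fun t ht ↦ (hder t ht.1).deriv) measurableSet_Icc]
    exact (Complex.continuous_ofReal.comp_continuousOn
      (hcont.mono Set.Icc_subset_Ici_self)).integrableOn_Icc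
  have habel := sum_mul_eq_sub_integral_mul₁ b hb0 hb1 x
    (fun t ht ↦ (hder t ht.1).differentiableAt) hint
  obtain ⟨hI, hI'⟩ := integral_sqrt_div_le x hx
  have hbound : ∀ t ∈ Set.Ioc 2 x, ‖deriv f t * ∑ k ∈ Finset.Icc 0 ⌊t⌋₊, b k‖ ≤
      3 * (2 * j + 2) * A * K * (Real.log x ^ (j + 1))⁻¹ * (x / t) ^ (1 / 2 : ℝ) := by
    intro t ht
    have ht2 : 2 ≤ t := ht.1.le
    have hl := hlog t ht2
    have ht0 : 0 < t := by linarith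
    have hl0 : Real.log t ≠ 0 := by linarith
    have hl0' : 0 < Real.log t := by linarith
    rw [norm_mul, (hder t ht2).deriv, Complex.norm_real, Real.norm_eq_abs]
    calc _ ≤ (3 * (2 * j + 2) * t⁻¹ * (Real.log t ^ (j + 1))⁻¹ * (Real.log t ^ (j + 1))⁻¹) *
          (A * t * Real.log t ^ (j + 1)) := by
          gcongr
          · exact hf'le t ht2
          · exact hB t ht2
      _ = 3 * (2 * j + 2) * A * (Real.log t ^ (j + 1))⁻¹ := by field_simp
      _ ≤ 3 * (2 * j + 2) * A * (K * (x / t) ^ (1 / 2 : ℝ) * (Real.log x ^ (j + 1))⁻¹) := by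
          gcongr
          exact hK t x (by linarith) ht.2
      _ = _ := by ring
  have hintbd : ‖∫ t in Set.Ioc 2 x, deriv f t * ∑ k ∈ Finset.Icc 0 ⌊t⌋₊, b k‖ ≤
      3 * (2 * j + 2) * A * K * (Real.log x ^ (j + 1))⁻¹ * (2 * x) := by
    refine (MeasureTheory.norm_integral_le_of_norm_le (hI.const_mul _)
      ((MeasureTheory.ae_restrict_iff' measurableSet_Ioc).2 (Eventually.of_forall hbound))).trans ?_
    rw [MeasureTheory.integral_const_mul]
    gcongr
  have hmain : ‖f x * ∑ k ∈ Finset.Icc 0 ⌊x⌋₊, b k‖ ≤ A * x * (Real.log x ^ (j + 1))⁻¹ := by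
    have hl0 : Real.log x ≠ 0 := by linarith
    have hl0' : 0 < Real.log x := by linarith
    rw [norm_mul, hf, Complex.norm_real, Real.norm_eq_abs, abs_of_nonneg (by positivity)]
    calc _ ≤ (Real.log x ^ (2 * j + 2))⁻¹ * (A * x * Real.log x ^ (j + 1)) := by
          gcongr
          exact hB x hx
      _ = _ := by field_simp; ring
  rw [habel]
  refine (norm_sub_le _ _).trans ((add_le_add hmain hintbd).trans (le_of_eq ?_))
  ring

lemma exists_norm_sum_centredMangoldt_div_log_le {N : ℕ} [NeZero N] (χ : DirichletCharacter ℂ N)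
    (j : ℕ) : ∃ C : ℝ, 0 ≤ C ∧ ∀ x : ℝ, 2 ≤ x →
      ‖∑ n ∈ Finset.Icc 0 ⌊x⌋₊, centredMangoldt χ n * (((Real.log n)⁻¹ : ℝ) : ℂ)‖ ≤
        C * x * (Real.log x ^ (j + 1))⁻¹ := by
  obtain ⟨C, hC0, hC⟩ := exists_norm_sum_mul_log_pow_le χ j
  obtain ⟨C', hC'0, hC'⟩ := exists_norm_sum_inv_log_pow_mul_le
    (b := fun n ↦ centredMangoldt χ n * ((Real.log n ^ (2 * j + 1) : ℝ) : ℂ))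
    (by simp) (by simp) j hC0 hC
  refine ⟨C', hC'0, fun x hx ↦ ?_⟩
  convert hC' x hx using 3 with n hn
  rw [mul_left_comm, ← Complex.ofReal_mul]
  congr 2
  rcases eq_or_ne (Real.log n) 0 with h | h
  · simp [h]
  · field_simp
    ring

end PartialSummation

section PrimeSums

lemma exists_sqrt_le_mul_inv_log_pow (r : ℕ) :
    ∃ C : ℝ, 0 ≤ C ∧ ∀ x : ℝ, 2 ≤ x → √x ≤ C * x * (Real.log x ^ r)⁻¹ := by
  obtain ⟨C, hC0, hC⟩ := exists_inv_log_pow_le r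
  have hl := one_third_le_log le_rfl
  have hl0 : 0 < Real.log (3 / 2) := by linarith
  refine ⟨Real.log (3 / 2) ^ r * C, by positivity, fun x hx ↦ ?_⟩
  have hx0 : 0 ≤ x := by linarith
  have h := hC (3 / 2) x le_rfl (by linarith)
  have h1 : (x / (3 / 2)) ^ (1 / 2 : ℝ) ≤ √x := by
    rw [Real.sqrt_eq_rpow]
    gcongr
    exact div_le_self hx0 (by norm_num)
  have hlx : 0 < Real.log x := Real.log_pos (by linarith)
  have h2 : 1 ≤ Real.log (3 / 2) ^ r * (C * √x * (Real.log x ^ r)⁻¹) := by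
    rw [← inv_le_iff_one_le_mul₀' (by positivity)]
    refine h.trans ?_
    gcongr
  calc √x = √x * 1 := (mul_one _).symm
    _ ≤ √x * (Real.log (3 / 2) ^ r * (C * √x * (Real.log x ^ r)⁻¹)) := by gcongr
    _ = Real.log (3 / 2) ^ r * C * (√x * √x) * (Real.log x ^ r)⁻¹ := by ring
    _ = _ := by rw [Real.mul_self_sqrt hx0]

lemma inv_log_le_two {t : ℝ} (ht : 2 ≤ t) : (Real.log t)⁻¹ ≤ 2 := by
  have h := Real.log_two_gt_d9
  have := Real.log_le_log (by norm_num) ht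
  rw [inv_le_comm₀ (by linarith) (by norm_num)]
  linarith

lemma abs_sum_inv_log_sub_integral_le (x : ℝ) (hx : 2 ≤ x) :
    |∑ n ∈ Finset.Icc 0 ⌊x⌋₊, (Real.log n)⁻¹ - ∫ t in (2 : ℝ)..x, 1 / Real.log t| ≤ 4 := by
  have hM : 2 ≤ ⌊x⌋₊ := Nat.le_floor hx
  have hM' : (2 : ℝ) ≤ ⌊x⌋₊ := by exact_mod_cast hM
  have hMx : (⌊x⌋₊ : ℝ) ≤ x := Nat.floor_le (by linarith)
  have hxM : x < ⌊x⌋₊ + 1 := Nat.lt_floor_add_one x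
  simp_rw [one_div]
  have hanti : AntitoneOn (fun t ↦ (Real.log t)⁻¹) (Set.Ici 2) := by
    intro s hs t ht hst
    have hs' : 2 ≤ s := hs
    have : 0 < Real.log s := Real.log_pos (by linarith)
    exact inv_anti₀ this (Real.log_le_log (by linarith) hst)
  have hii : ∀ a b : ℝ, 2 ≤ a → a ≤ b →
      IntervalIntegrable (fun t ↦ (Real.log t)⁻¹) MeasureTheory.volume a b := fun a b ha hab ↦
    (hanti.mono (by rw [Set.uIcc_of_le hab]; exact fun t ht ↦ ha.trans ht.1)).intervalIntegrable
  have hsub : Set.Icc ((2 : ℕ) : ℝ) (⌊x⌋₊ : ℝ) ⊆ Set.Ici 2 := fun t ht ↦ by simpa using ht.1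
  have h1 := AntitoneOn.integral_le_sum_Ico hM (hanti.mono hsub)
  have h2 := AntitoneOn.sum_le_integral_Ico hM (hanti.mono hsub)
  rw [Nat.cast_ofNat] at h1 h2
  have hadd := intervalIntegral.integral_add_adjacent_intervals
    (hii 2 ⌊x⌋₊ le_rfl hM') (hii ⌊x⌋₊ x hM' hMx)
  have h3 : 0 ≤ ∫ t in (⌊x⌋₊ : ℝ)..x, (Real.log t)⁻¹ :=
    intervalIntegral.integral_nonneg hMx fun t ht ↦
      inv_nonneg.2 (Real.log_nonneg (by linarith [ht.1]))
  have h4 : ∫ t in (⌊x⌋₊ : ℝ)..x, (Real.log t)⁻¹ ≤ 2 := by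
    calc _ ≤ ∫ t in (⌊x⌋₊ : ℝ)..x, (2 : ℝ) :=
          intervalIntegral.integral_mono_on hMx (hii _ _ hM' hMx) (by simp)
            fun t ht ↦ inv_log_le_two (hM'.trans ht.1)
      _ ≤ 2 := by rw [intervalIntegral.integral_const, smul_eq_mul]; linarith
  have e0 : ∑ n ∈ Finset.Icc 0 ⌊x⌋₊, (Real.log n)⁻¹ =
      ∑ n ∈ Finset.Ico 2 (⌊x⌋₊ + 1), (Real.log n)⁻¹ := by
    refine (Finset.sum_subset (fun n hn ↦ ?_) fun n hn hn' ↦ ?_).symm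
    · simp only [Finset.mem_Ico, Finset.mem_Icc] at hn ⊢; omega
    · simp only [Finset.mem_Ico, Finset.mem_Icc] at hn hn'
      have : n = 0 ∨ n = 1 := by omega
      rcases this with rfl | rfl <;> simp
  have e1 := Finset.sum_Ico_succ_top hM (fun n : ℕ ↦ (Real.log n)⁻¹)
  have e2 := Finset.sum_eq_sum_Ico_succ_bot (show 2 < ⌊x⌋₊ + 1 by omega)
    (fun n : ℕ ↦ (Real.log n)⁻¹)
  have e3 : ∑ i ∈ Finset.Ico 2 ⌊x⌋₊, (Real.log ((i + 1 : ℕ) : ℝ))⁻¹ =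
      ∑ n ∈ Finset.Ico (2 + 1) (⌊x⌋₊ + 1), (Real.log n)⁻¹ :=
    Finset.sum_Ico_add' (fun n : ℕ ↦ (Real.log n)⁻¹) 2 ⌊x⌋₊ 1
  have b1 := inv_log_le_two hM'
  have b2 := inv_log_le_two (le_refl (2 : ℝ))
  have b3 : 0 ≤ (Real.log (⌊x⌋₊ : ℝ))⁻¹ := inv_nonneg.2 (Real.log_natCast_nonneg _)
  rw [Nat.cast_ofNat] at e2
  rw [abs_le]
  constructor <;> linarith

lemma exists_norm_sum_not_prime_le {N : ℕ} (χ : DirichletCharacter ℂ N) :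
    ∃ C : ℝ, 0 ≤ C ∧ ∀ x : ℝ,
      ‖∑ n ∈ Finset.Icc 0 ⌊x⌋₊ with ¬ n.Prime,
        χ n * (ArithmeticFunction.vonMangoldt n : ℂ) * (((Real.log n)⁻¹ : ℝ) : ℂ)‖ ≤ C * √x := by
  obtain ⟨C, hC⟩ := Chebyshev.psi_sub_theta_le_mul_sqrt
  refine ⟨2 * max C 0, by positivity, fun x ↦ ?_⟩
  have hC' := hC x
  rw [Chebyshev.psi_sub_theta_eq_sum_not_prime] at hC'
  have e : ∑ n ∈ Finset.Icc 0 ⌊x⌋₊ with ¬ n.Prime, ArithmeticFunction.vonMangoldt n =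
      ∑ n ∈ Finset.Ioc 0 ⌊x⌋₊ with ¬ n.Prime, ArithmeticFunction.vonMangoldt n := by
    refine (Finset.sum_subset (fun n hn ↦ ?_) fun n hn hn' ↦ ?_).symm
    · simp only [Finset.mem_filter, Finset.mem_Ioc, Finset.mem_Icc] at hn ⊢
      exact ⟨⟨hn.1.1.le, hn.1.2⟩, hn.2⟩
    · simp only [Finset.mem_filter, Finset.mem_Ioc, Finset.mem_Icc] at hn hn'
      have : n = 0 := by
        by_contra h0
        exact hn' ⟨⟨Nat.pos_of_ne_zero h0, hn.1.2⟩, hn.2⟩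
      simp [this]
  calc _ ≤ ∑ n ∈ Finset.Icc 0 ⌊x⌋₊ with ¬ n.Prime, ArithmeticFunction.vonMangoldt n * 2 := by
        refine norm_sum_le_of_le _ fun n _ ↦ ?_
        have hΛ : 0 ≤ ArithmeticFunction.vonMangoldt n := ArithmeticFunction.vonMangoldt_nonneg
        have hinv : (Real.log n)⁻¹ ≤ 2 := by
          rcases lt_or_ge n 2 with h | h
          · interval_cases n <;> simp
          · exact inv_log_le_two (by exact_mod_cast h)
        have hinv0 : 0 ≤ (Real.log n)⁻¹ := inv_nonneg.2 (Real.log_natCast_nonneg n)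
        rw [norm_mul, norm_mul, Complex.norm_real, Complex.norm_real, Real.norm_eq_abs,
          Real.norm_eq_abs, abs_of_nonneg hΛ, abs_of_nonneg hinv0]
        calc _ ≤ 1 * ArithmeticFunction.vonMangoldt n * 2 := by
              gcongr
              exact χ.norm_le_one _
          _ = _ := by rw [one_mul]
    _ ≤ C * √x * 2 := by
        rw [← Finset.sum_mul, e]
        gcongr
    _ ≤ max C 0 * √x * 2 := by
        gcongr
        exact le_max_left _ _
    _ = _ := by ring

theorem exists_norm_sum_prime_sub_le {N : ℕ} [NeZero N] (χ : DirichletCharacter ℂ N) (m : ℕ) :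
    ∃ C : ℝ, 0 ≤ C ∧ ∀ x : ℝ, 2 ≤ x →
      ‖∑ p ∈ Finset.Icc 0 ⌊x⌋₊ with p.Prime, χ p -
        ((trivialIndicator χ * ∫ t in (2 : ℝ)..x, 1 / Real.log t : ℝ) : ℂ)‖ ≤
        C * x * (Real.log x ^ m)⁻¹ := by
  obtain ⟨C₁, hC₁, h₁⟩ := exists_norm_sum_centredMangoldt_div_log_le χ m
  obtain ⟨C₂, hC₂, h₂⟩ := exists_norm_sum_not_prime_le χ
  obtain ⟨C₃, hC₃, h₃⟩ := exists_sqrt_le_mul_inv_log_pow m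
  refine ⟨2 * C₁ + (C₂ + 4) * C₃, by positivity, fun x hx ↦ ?_⟩
  have hx0 : 0 < x := by linarith
  have hlx : 0 < Real.log x := Real.log_pos (by linarith)
  set I := ∫ t in (2 : ℝ)..x, 1 / Real.log t
  have hsplit : ∑ p ∈ Finset.Icc 0 ⌊x⌋₊ with p.Prime, χ p - ((trivialIndicator χ * I : ℝ) : ℂ) =
      ∑ n ∈ Finset.Icc 0 ⌊x⌋₊, centredMangoldt χ n * (((Real.log n)⁻¹ : ℝ) : ℂ)
      - ∑ n ∈ Finset.Icc 0 ⌊x⌋₊ with ¬ n.Prime,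
        χ n * (ArithmeticFunction.vonMangoldt n : ℂ) * (((Real.log n)⁻¹ : ℝ) : ℂ)
      + ((trivialIndicator χ * (∑ n ∈ Finset.Icc 0 ⌊x⌋₊, (Real.log n)⁻¹ - I) : ℝ) : ℂ) := by
    have e1 : ∑ n ∈ Finset.Icc 0 ⌊x⌋₊, centredMangoldt χ n * (((Real.log n)⁻¹ : ℝ) : ℂ) =
        ∑ n ∈ Finset.Icc 0 ⌊x⌋₊,
          χ n * (ArithmeticFunction.vonMangoldt n : ℂ) * (((Real.log n)⁻¹ : ℝ) : ℂ) -
        ((trivialIndicator χ * ∑ n ∈ Finset.Icc 0 ⌊x⌋₊, (Real.log n)⁻¹ : ℝ) : ℂ) := by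
      rw [Complex.ofReal_mul, Complex.ofReal_sum, Finset.mul_sum, ← Finset.sum_sub_distrib]
      refine Finset.sum_congr rfl fun n _ ↦ ?_
      rw [centredMangoldt, sub_mul]
    have e2 : ∑ n ∈ Finset.Icc 0 ⌊x⌋₊ with n.Prime,
        χ n * (ArithmeticFunction.vonMangoldt n : ℂ) * (((Real.log n)⁻¹ : ℝ) : ℂ) =
        ∑ p ∈ Finset.Icc 0 ⌊x⌋₊ with p.Prime, χ p := by
      refine Finset.sum_congr rfl fun n hn ↦ ?_
      have hp := (Finset.mem_filter.1 hn).2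
      have hl : Real.log n ≠ 0 := (Real.log_pos (by exact_mod_cast hp.one_lt)).ne'
      rw [ArithmeticFunction.vonMangoldt_apply_prime hp, mul_assoc, ← Complex.ofReal_mul,
        mul_inv_cancel₀ hl, Complex.ofReal_one, mul_one]
    rw [e1, ← e2, ← Finset.sum_filter_add_sum_filter_not (Finset.Icc 0 ⌊x⌋₊) Nat.Prime fun n : ℕ ↦
      χ n * (ArithmeticFunction.vonMangoldt n : ℂ) * (((Real.log n)⁻¹ : ℝ) : ℂ)]
    push_cast
    ring
  have hone : 1 ≤ √x := Real.one_le_sqrt.2 (by linarith)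
  have hb1 : C₁ * x * (Real.log x ^ (m + 1))⁻¹ ≤ 2 * C₁ * x * (Real.log x ^ m)⁻¹ := by
    rw [pow_succ, mul_inv]
    calc _ ≤ C₁ * x * ((Real.log x ^ m)⁻¹ * 2) := by
          gcongr
          exact inv_log_le_two hx
      _ = _ := by ring
  have hb2 : C₂ * √x ≤ C₂ * (C₃ * x * (Real.log x ^ m)⁻¹) := by
    gcongr
    exact h₃ x hx
  have hb3 : ‖((trivialIndicator χ * (∑ n ∈ Finset.Icc 0 ⌊x⌋₊, (Real.log n)⁻¹ - I) : ℝ) : ℂ)‖ ≤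
      4 * (C₃ * x * (Real.log x ^ m)⁻¹) := by
    rw [Complex.norm_real, Real.norm_eq_abs, abs_mul, abs_of_nonneg (trivialIndicator_nonneg χ)]
    calc _ ≤ 1 * (4 : ℝ) := by
          gcongr
          · exact trivialIndicator_le_one χ
          · exact abs_sum_inv_log_sub_integral_le x hx
      _ ≤ 4 * (C₃ * x * (Real.log x ^ m)⁻¹) := by linarith [h₃ x hx]
  rw [hsplit]
  refine (norm_add_le _ _).trans ?_
  have := norm_sub_le (∑ n ∈ Finset.Icc 0 ⌊x⌋₊, centredMangoldt χ n * (((Real.log n)⁻¹ : ℝ) : ℂ))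
    (∑ n ∈ Finset.Icc 0 ⌊x⌋₊ with ¬ n.Prime,
        χ n * (ArithmeticFunction.vonMangoldt n : ℂ) * (((Real.log n)⁻¹ : ℝ) : ℂ))
  have := h₁ x hx
  have := h₂ x
  linarith

end PrimeSums

section QuadraticCharacter

lemma isSquare_or_exists_odd_prime_power {n : ℕ} (hn : n ≠ 0) :
    IsSquare n ∨ ∃ q e M : ℕ, q.Prime ∧ ¬ q ∣ M ∧ n = q ^ (2 * e + 1) * M := by
  obtain ⟨a, b, hab, ha⟩ := Nat.sq_mul_squarefree n
  have hb0 : b ≠ 0 := by rintro rfl; simp at hab; omega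
  rcases eq_or_ne a 1 with rfl | ha1
  · exact Or.inl ⟨b, by rw [← hab]; ring⟩
  · obtain ⟨q, hq, a', rfl⟩ := Nat.exists_prime_and_dvd ha1
    obtain ⟨e, b', hb', rfl⟩ := Nat.exists_eq_pow_mul_and_not_dvd hb0 q hq.ne_one
    refine Or.inr ⟨q, e, a' * b' ^ 2, hq, fun h ↦ ?_, by rw [← hab]; ring⟩
    rcases (Nat.Prime.dvd_mul hq).1 h with h | h
    · exact hq.ne_one (Nat.isUnit_iff.1 (ha q (mul_dvd_mul_left q h)))
    · exact hb' (hq.dvd_of_dvd_pow h)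

lemma exists_odd_jacobiSym_prime_eq_neg_one {q M : ℕ} (hq : q.Prime) (hqM : ¬ q ∣ M) :
    ∃ b : ℕ, b ≡ 1 [MOD 4 * M] ∧ Odd b ∧ jacobiSym q b = -1 := by
  have hodd : ∀ b : ℕ, b ≡ 1 [MOD 4] → b % 4 = 1 ∧ Odd b := fun b hb ↦ by
    have h1 : b % 4 = 1 := hb
    exact ⟨h1, Nat.odd_iff.2 (by omega)⟩
  have hcop : q.Coprime M := (Nat.Prime.coprime_iff_not_dvd hq).2 hqM
  rcases hq.eq_two_or_odd' with rfl | hqo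
  · have h8 : (8 : ℕ).Coprime M := Nat.Coprime.pow_left 3 hcop
    obtain ⟨b, hb8, hbM⟩ := Nat.chineseRemainder h8 5 1
    have hb8' : b % 8 = 5 := hb8
    have hb4 : b ≡ 1 [MOD 4] := by
      change b % 4 = 1 % 4
      omega
    refine ⟨b, (Nat.modEq_and_modEq_iff_modEq_mul (Nat.Coprime.pow_left 2 hcop)).1 ⟨hb4, hbM⟩,
      (hodd b hb4).2, ?_⟩
    rw [Nat.cast_ofNat, jacobiSym.at_two (hodd b hb4).2, ZMod.χ₈_nat_eq_if_mod_eight,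
      if_neg (by omega), if_neg (by omega)]
  · have : Fact q.Prime := ⟨hq⟩
    have h4 : (4 * M).Coprime q := by
      have h2 : (2 ^ 2).Coprime q := Nat.Coprime.pow_left 2 (Nat.coprime_two_left.2 hqo)
      exact Nat.Coprime.mul_left h2 hcop.symm
    obtain ⟨r, hr⟩ := FiniteField.exists_nonsquare (F := ZMod q)
      (by rw [ZMod.ringChar_zmod_n]; rintro rfl; exact absurd hqo (by decide))
    obtain ⟨b, hb1, hbq⟩ := Nat.chineseRemainder h4 1 r.val
    obtain ⟨hb4, hbo⟩ := hodd b (hb1.of_dvd (dvd_mul_right 4 M))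
    refine ⟨b, hb1, hbo, ?_⟩
    rw [← jacobiSym.quadratic_reciprocity_one_mod_four hb4 hqo,
      ← jacobiSym.legendreSym.to_jacobiSym, legendreSym.eq_neg_one_iff]
    have : ((b : ℤ) : ZMod q) = r := by
      rw [Int.cast_natCast, (ZMod.natCast_eq_natCast_iff _ _ _).2 hbq, ZMod.natCast_zmod_val]
    rwa [this]

lemma exists_odd_jacobiSym_eq_neg_one {D : ℤ} (hD : ¬ ∃ m : ℤ, D = m ^ 2) :
    ∃ b : ℕ, Odd b ∧ jacobiSym D b = -1 := by
  have hD0 : D ≠ 0 := by rintro rfl; exact hD ⟨0, by norm_num⟩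
  have hn0 : D.natAbs ≠ 0 := Int.natAbs_ne_zero.2 hD0
  rcases isSquare_or_exists_odd_prime_power hn0 with ⟨k, hk⟩ | ⟨q, e, M, hq, hqM, hn⟩
  · have hDk : D = -1 * (k : ℤ) ^ 2 := by
      rcases Int.natAbs_eq D with h | h
      · exact absurd ⟨(k : ℤ), by rw [h, hk]; push_cast; ring⟩ hD
      · rw [h, hk]; push_cast; ring
    have hk0 : k ≠ 0 := by rintro rfl; simp at hk; exact hD0 hk
    refine ⟨4 * k - 1, Nat.odd_iff.2 (by omega), ?_⟩
    have hcop : k.Coprime (4 * k - 1) := by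
      have h := Nat.gcd_dvd k (4 * k - 1)
      refine Nat.dvd_one.1 ?_
      have := Nat.dvd_sub (h.1.mul_left 4) h.2
      rwa [show 4 * k - (4 * k - 1) = 1 by omega] at this
    rw [hDk, jacobiSym.mul_left, jacobiSym.pow_left, jacobiSym.sq_one (by simpa using hcop),
      jacobiSym.at_neg_one (Nat.odd_iff.2 (by omega)), mul_one,
      ZMod.χ₄_nat_three_mod_four (by omega)]
  · obtain ⟨b, hb1, hbo, hbq⟩ := exists_odd_jacobiSym_prime_eq_neg_one hq hqM
    have hM0 : M ≠ 0 := by rintro rfl; exact hqM (dvd_zero q)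
    refine ⟨b, hbo, ?_⟩
    have hE : ∀ E : ℤ, E.natAbs = M → jacobiSym E b = 1 := fun E hE ↦ by
      rw [jacobiSym.mod_right E hbo, hE, hb1, Nat.mod_eq_of_lt (by omega), jacobiSym.one_right]
    have hfin : ∀ E : ℤ, E.natAbs = M → D = (q : ℤ) ^ (2 * e + 1) * E → jacobiSym D b = -1 := by
      intro E hEM h
      rw [h, jacobiSym.mul_left, jacobiSym.pow_left, hbq, hE E hEM, mul_one,
        Odd.neg_one_pow ⟨e, rfl⟩]
    rcases Int.natAbs_eq D with h | h
    · exact hfin M (Int.natAbs_natCast M) (by rw [h, hn]; push_cast; ring)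
    · exact hfin (-M) (by simp) (by rw [h, hn]; push_cast; ring)

open scoped Classical in
/-- The Dirichlet character modulo `4 * |D|` given on odd `b` coprime to `D` by the Jacobi symbol
`(D / b)`. -/
noncomputable def jacobiCharacter (D : ℤ) (hD : D ≠ 0) : DirichletCharacter ℂ (4 * D.natAbs) where
  toFun a := if IsUnit a then ((jacobiSym D a.val : ℤ) : ℂ) else 0
  map_one' := by
    have h : 1 < 4 * D.natAbs := by have := Int.natAbs_pos.2 hD; omega
    have : Fact (1 < 4 * D.natAbs) := ⟨h⟩
    rw [if_pos isUnit_one, ZMod.val_one, jacobiSym.one_right, Int.cast_one]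
  map_mul' a b := by
    have hpos := Int.natAbs_pos.2 hD
    have : NeZero (4 * D.natAbs) := ⟨by omega⟩
    have hodd : ∀ c : ZMod (4 * D.natAbs), IsUnit c → Odd c.val := fun c hc ↦ by
      rw [← ZMod.natCast_zmod_val c, ZMod.isUnit_iff_coprime] at hc
      exact Nat.coprime_two_right.1
        (Nat.Coprime.coprime_dvd_right (Dvd.intro (2 * D.natAbs) (by ring)) hc)
    by_cases ha : IsUnit a
    · by_cases hb : IsUnit b
      · have ha' := hodd a ha
        have hb' := hodd b hb
        rw [if_pos ha, if_pos hb, if_pos (ha.mul hb), ZMod.val_mul,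
          ← jacobiSym.mod_right D (ha'.mul hb'), jacobiSym.mul_right' D ha'.pos.ne' hb'.pos.ne',
          Int.cast_mul]
      · rw [if_neg hb, if_neg (fun h ↦ hb (isUnit_of_mul_isUnit_right h)), mul_zero]
    · rw [if_neg ha, if_neg (fun h ↦ ha (isUnit_of_mul_isUnit_left h)), zero_mul]
  map_nonunit' a ha := if_neg ha

open scoped Classical in
lemma jacobiCharacter_natCast {D : ℤ} (hD : D ≠ 0) {b : ℕ} (hb : b.Coprime (4 * D.natAbs)) :
    jacobiCharacter D hD b = jacobiSym D b := by
  have hodd : Odd b := Nat.coprime_two_right.1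
    (Nat.Coprime.coprime_dvd_right (Dvd.intro (2 * D.natAbs) (by ring)) hb)
  change (if IsUnit _ then _ else _) = _
  rw [if_pos ((ZMod.isUnit_iff_coprime _ _).2 hb), ZMod.val_natCast, ← jacobiSym.mod_right D hodd]

lemma jacobiCharacter_ne_one {D : ℤ} (hD : D ≠ 0) (hns : ¬ ∃ m : ℤ, D = m ^ 2) :
    jacobiCharacter D hD ≠ 1 := by
  obtain ⟨b, hbo, hb⟩ := exists_odd_jacobiSym_eq_neg_one hns
  intro h
  have : NeZero b := ⟨hbo.pos.ne'⟩
  have hcop : b.Coprime (4 * D.natAbs) := by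
    refine Nat.Coprime.mul_right (Nat.Coprime.pow_right 2 (Nat.coprime_two_right.2 hbo)) ?_
    have hg : D.gcd b = 1 := by
      by_contra hg
      rw [← ne_eq, ← jacobiSym.eq_zero_iff_not_coprime, hb] at hg
      norm_num at hg
    rw [Int.gcd_comm] at hg
    simpa [Int.gcd] using hg
  have h1 := jacobiCharacter_natCast hD hcop
  rw [h, MulChar.one_apply ((ZMod.isUnit_iff_coprime _ _).2 hcop), hb] at h1
  norm_num at h1

end QuadraticCharacter

section Density

lemma chiDp_eq_legendreSym (D : ℤ) {p : ℕ} [Fact p.Prime] (hp2 : p ≠ 2) :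
    chiDp D p = legendreSym p D := by
  rw [chiDp, if_neg hp2, dif_pos Fact.out]

lemma two_mul_indicator_eq {D : ℤ} (hD : D ≠ 0) {p : ℕ} (hp : p.Prime)
    (hpD : ¬ p ∣ 4 * D.natAbs) :
    2 * (if chiDp D p = 1 then (1 : ℂ) else 0) =
      jacobiCharacter D hD p + (1 : DirichletCharacter ℂ (4 * D.natAbs)) p := by
  have : Fact p.Prime := ⟨hp⟩
  have hcop : p.Coprime (4 * D.natAbs) := (Nat.Prime.coprime_iff_not_dvd hp).2 hpD
  have hp2 : p ≠ 2 := by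
    rintro rfl
    exact hpD (Dvd.intro (2 * D.natAbs) (by ring))
  rw [MulChar.one_apply ((ZMod.isUnit_iff_coprime _ _).2 hcop), jacobiCharacter_natCast hD hcop,
    chiDp_eq_legendreSym D hp2, jacobiSym.legendreSym.to_jacobiSym]
  have hg : D.gcd p = 1 := by
    rw [Int.gcd_comm]
    simpa [Int.gcd] using hcop.coprime_dvd_right (dvd_mul_left _ 4)
  rcases jacobiSym.eq_one_or_neg_one hg with h | h
  · rw [h]; norm_num
  · rw [h]; norm_num

lemma norm_two_mul_card_sub_le {D : ℤ} (hD : D ≠ 0) (s : Finset ℕ) (hs : ∀ p ∈ s, p.Prime) :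
    ‖2 * ((s.filter fun p ↦ chiDp D p = 1).card : ℂ) -
      (∑ p ∈ s, jacobiCharacter D hD p + ∑ p ∈ s, (1 : DirichletCharacter ℂ (4 * D.natAbs)) p)‖ ≤
      4 * (4 * D.natAbs : ℕ) := by
  have e : 2 * ((s.filter fun p ↦ chiDp D p = 1).card : ℂ) -
      (∑ p ∈ s, jacobiCharacter D hD p + ∑ p ∈ s, (1 : DirichletCharacter ℂ (4 * D.natAbs)) p) =
      ∑ p ∈ s, (2 * (if chiDp D p = 1 then (1 : ℂ) else 0) -
        (jacobiCharacter D hD p + (1 : DirichletCharacter ℂ (4 * D.natAbs)) p)) := by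
    rw [Finset.card_filter, Finset.sum_sub_distrib, Finset.sum_add_distrib, ← Finset.mul_sum]
    push_cast
    rfl
  rw [e]
  calc _ ≤ ∑ p ∈ s, if p ∣ 4 * D.natAbs then (4 : ℝ) else 0 := by
        refine norm_sum_le_of_le _ fun p hp ↦ ?_
        by_cases h : p ∣ 4 * D.natAbs
        · rw [if_pos h]
          have h1 : ‖2 * (if chiDp D p = 1 then (1 : ℂ) else 0)‖ ≤ 2 := by
            split_ifs <;> norm_num
          have h2 := (jacobiCharacter D hD).norm_le_one p
          have h3 := (1 : DirichletCharacter ℂ (4 * D.natAbs)).norm_le_one p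
          refine (norm_sub_le _ _).trans ?_
          have := norm_add_le (jacobiCharacter D hD p)
            ((1 : DirichletCharacter ℂ (4 * D.natAbs)) p)
          linarith
        · rw [if_neg h, two_mul_indicator_eq hD (hs p hp) h, sub_self, norm_zero]
    _ = 4 * ((s.filter (· ∣ 4 * D.natAbs)).card : ℝ) := by
        rw [← Finset.sum_filter, Finset.sum_const, nsmul_eq_mul, mul_comm]
    _ ≤ _ := by
        gcongr
        have hpos := Int.natAbs_pos.2 hD
        calc _ ≤ (Finset.Icc 1 (4 * D.natAbs)).card := by
              refine Finset.card_le_card fun p hp ↦ ?_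
              rw [Finset.mem_filter] at hp
              exact Finset.mem_Icc.2 ⟨(hs p hp.1).one_le, Nat.le_of_dvd (by omega) hp.2⟩
          _ = _ := by rw [Nat.card_Icc, Nat.add_sub_cancel]

lemma trivialIndicator_of_ne_one {N : ℕ} {χ : DirichletCharacter ℂ N} (h : χ ≠ 1) :
    trivialIndicator χ = 0 := if_neg h

lemma trivialIndicator_one {N : ℕ} : trivialIndicator (1 : DirichletCharacter ℂ N) = 1 := if_pos rfl

end Density

theorem stmt10 (D : ℤ) (hns : ¬ ∃ m : ℤ, D = m ^ 2) (hdisc : D % 4 = 0 ∨ D % 4 = 1) :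
    ∀ m : ℕ, ∃ Cm : ℝ, ∀ x : ℝ, 2 ≤ x →
      |(Set.ncard {p : ℕ | p.Prime ∧ (p : ℝ) ≤ x ∧ chiDp D p = 1} : ℝ) -
          (1 / 2) * ∫ t in (2 : ℝ)..x, 1 / Real.log t| ≤
        Cm * x / Real.log x ^ (m : ℝ) := by
  intro m
  have hD : D ≠ 0 := by rintro rfl; exact hns ⟨0, by norm_num⟩
  have hpos := Int.natAbs_pos.2 hD
  have : NeZero (4 * D.natAbs) := ⟨by omega⟩
  obtain ⟨C₁, -, h₁⟩ := exists_norm_sum_prime_sub_le (jacobiCharacter D hD) m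
  obtain ⟨C₂, -, h₂⟩ := exists_norm_sum_prime_sub_le (1 : DirichletCharacter ℂ (4 * D.natAbs)) m
  obtain ⟨C₃, -, h₃⟩ := exists_sqrt_le_mul_inv_log_pow m
  refine ⟨(C₁ + C₂ + 4 * (4 * D.natAbs : ℕ) * C₃) / 2, fun x hx ↦ ?_⟩
  have hfloor : ∀ p : ℕ, (p : ℝ) ≤ x ↔ p ≤ ⌊x⌋₊ := fun p ↦ (Nat.le_floor_iff (by linarith)).symm
  set s := (Finset.Icc 0 ⌊x⌋₊).filter Nat.Prime with hs
  set I := ∫ t in (2 : ℝ)..x, 1 / Real.log t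
  have hcard : Set.ncard {p : ℕ | p.Prime ∧ (p : ℝ) ≤ x ∧ chiDp D p = 1} =
      (s.filter fun p ↦ chiDp D p = 1).card := by
    rw [← Set.ncard_coe_finset]
    congr 1
    ext p
    simp [hs, hfloor, and_assoc, and_left_comm]
  have k₀ := norm_two_mul_card_sub_le hD s fun p hp ↦ (Finset.mem_filter.1 hp).2
  have k₁ := h₁ x hx
  have k₂ := h₂ x hx
  rw [trivialIndicator_of_ne_one (jacobiCharacter_ne_one hD hns), zero_mul, Complex.ofReal_zero,
    sub_zero] at k₁
  rw [trivialIndicator_one, one_mul] at k₂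
  have hone : 1 ≤ √x := Real.one_le_sqrt.2 (by linarith)
  have k₃ : (4 * (4 * D.natAbs : ℕ) : ℝ) * 1 ≤
      4 * (4 * D.natAbs : ℕ) * (C₃ * x * (Real.log x ^ m)⁻¹) := by
    gcongr
    exact hone.trans (h₃ x hx)
  rw [hcard, Real.rpow_natCast, div_eq_mul_inv _ (Real.log x ^ m)]
  set c := (s.filter fun p ↦ chiDp D p = 1).card
  have hnorm : 2 * |(c : ℝ) - 1 / 2 * I| = ‖(2 * (c : ℂ) -
      (∑ p ∈ s, jacobiCharacter D hD p + ∑ p ∈ s, (1 : DirichletCharacter ℂ (4 * D.natAbs)) p)) +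
      (∑ p ∈ s, jacobiCharacter D hD p +
        (∑ p ∈ s, (1 : DirichletCharacter ℂ (4 * D.natAbs)) p - (I : ℂ)))‖ := by
    have h2 : 2 * |(c : ℝ) - 1 / 2 * I| = |2 * (c - 1 / 2 * I)| := by rw [abs_mul, abs_two]
    rw [h2, ← Real.norm_eq_abs, ← Complex.norm_real]
    congr 1
    push_cast
    ring
  have t₁ := norm_add_le (2 * (c : ℂ) -
      (∑ p ∈ s, jacobiCharacter D hD p + ∑ p ∈ s, (1 : DirichletCharacter ℂ (4 * D.natAbs)) p))
      (∑ p ∈ s, jacobiCharacter D hD p +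
        (∑ p ∈ s, (1 : DirichletCharacter ℂ (4 * D.natAbs)) p - (I : ℂ)))
  have t₂ := norm_add_le (∑ p ∈ s, jacobiCharacter D hD p)
    (∑ p ∈ s, (1 : DirichletCharacter ℂ (4 * D.natAbs)) p - (I : ℂ))
  linarith
end

section
/- Let D < 0 be a discriminant and let n be a positive integer with gcd(n, D) = 1. Then n is represented by some primitive positive definite integral binary quadratic form of discriminant D if and only if for every prime p with χ_D(p) = -1, the exponent of p in the factorization of n is even. -/
open Filter Real

/-- If `D` is a nonresidue modulo `p`, then `x² - D y²` is anisotropic modulo `p`. -/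
theorem dvd_of_dvd_sq_sub_mul_sq {p : ℕ} [Fact p.Prime] {D x y : ℤ}
    (hD : legendreSym p D = -1) (h : (p : ℤ) ∣ x ^ 2 - D * y ^ 2) : (p : ℤ) ∣ y := by
  rw [legendreSym.eq_neg_one_iff] at hD
  by_contra hy
  apply hD
  have hy' : (y : ZMod p) ≠ 0 := by rwa [Ne, ZMod.intCast_zmod_eq_zero_iff_dvd]
  have h' : ((x ^ 2 - D * y ^ 2 : ℤ) : ZMod p) = 0 := by
    rwa [ZMod.intCast_zmod_eq_zero_iff_dvd]
  push_cast at h'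
  refine ⟨x / y, ?_⟩
  field_simp
  linear_combination -h'

/-- A form whose discriminant `D` satisfies `χ_D(p) = -1` is anisotropic modulo `p`. -/
theorem dvd_and_dvd_of_dvd_form {p : ℕ} (hp : p.Prime) {a b c u v : ℤ}
    (hdisc : (b ^ 2 - 4 * a * c) % 4 = 0 ∨ (b ^ 2 - 4 * a * c) % 4 = 1)
    (hchi : chiDp (b ^ 2 - 4 * a * c) p = -1)
    (h : (p : ℤ) ∣ a * u ^ 2 + b * u * v + c * v ^ 2) : (p : ℤ) ∣ u ∧ (p : ℤ) ∣ v := by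
  unfold chiDp at hchi
  split_ifs at hchi with h2 h2D h8
  · subst h2
    have hb : Odd b := by
      by_contra hb
      rw [Int.not_odd_iff_even] at hb
      obtain ⟨k, rfl⟩ := hb
      exact h2D ⟨2 * k ^ 2 - 2 * a * c, by ring⟩
    obtain ⟨j, hj⟩ := Int.eight_dvd_sq_sub_one_of_odd hb
    have hac : Odd (a * c) := by
      by_contra hac
      rw [Int.not_odd_iff_even] at hac
      obtain ⟨k, hk⟩ := hac
      have : b ^ 2 - 4 * a * c = 1 + 8 * (j - k) := by linear_combination hj - 4 * hk
      omega
    rw [Int.odd_mul] at hac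
    obtain ⟨ha, hc⟩ := hac
    push_cast at h ⊢
    rw [← even_iff_two_dvd] at h
    rw [← even_iff_two_dvd, ← even_iff_two_dvd]
    rw [← Int.not_even_iff_odd] at ha hb hc
    simp only [Int.even_add, Int.even_mul, Int.even_pow, ha, hb, hc] at h
    tauto
  · have : Fact p.Prime := ⟨hp⟩
    constructor
    · refine dvd_of_dvd_sq_sub_mul_sq (x := 2 * c * v + b * u) hchi ?_
      rw [show (2 * c * v + b * u) ^ 2 - (b ^ 2 - 4 * a * c) * u ^ 2 =
        4 * c * (a * u ^ 2 + b * u * v + c * v ^ 2) by ring]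
      exact h.mul_left _
    · refine dvd_of_dvd_sq_sub_mul_sq (x := 2 * a * u + b * v) hchi ?_
      rw [show (2 * a * u + b * v) ^ 2 - (b ^ 2 - 4 * a * c) * v ^ 2 =
        4 * a * (a * u ^ 2 + b * u * v + c * v ^ 2) by ring]
      exact h.mul_left _

theorem even_factorization_of_form {p : ℕ} (hp : p.Prime) {a b c : ℤ}
    (h : ∀ u v : ℤ, (p : ℤ) ∣ a * u ^ 2 + b * u * v + c * v ^ 2 → (p : ℤ) ∣ u ∧ (p : ℤ) ∣ v)
    (n : ℕ) (hn : 0 < n) (u v : ℤ) (huv : (n : ℤ) = a * u ^ 2 + b * u * v + c * v ^ 2) :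
    Even (n.factorization p) := by
  induction n using Nat.strong_induction_on generalizing u v with
  | _ n ih =>
    by_cases hpn : p ∣ n
    · obtain ⟨⟨x, rfl⟩, ⟨y, rfl⟩⟩ := h u v (huv ▸ Int.natCast_dvd_natCast.mpr hpn)
      have hfac : (n : ℤ) = ((p ^ 2 : ℕ) : ℤ) * (a * x ^ 2 + b * x * y + c * y ^ 2) := by
        rw [huv]; push_cast; ring
      obtain ⟨m, rfl⟩ : p ^ 2 ∣ n := Int.natCast_dvd_natCast.mp ⟨_, hfac⟩
      have hm : 0 < m := Nat.pos_of_mul_pos_left hn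
      have hp2 : 0 < p ^ 2 := pow_pos hp.pos 2
      have hmf : (m : ℤ) = a * x ^ 2 + b * x * y + c * y ^ 2 := by
        rw [Nat.cast_mul] at hfac
        exact mul_left_cancel₀ (by exact_mod_cast hp2.ne') hfac
      have hlt : m < p ^ 2 * m := by nlinarith [hp.two_le]
      have := ih m hlt hm x y hmf
      rw [Nat.factorization_mul hp2.ne' hm.ne', Finsupp.add_apply, hp.factorization_pow]
      simpa [Nat.even_add] using this
    · simp [Nat.factorization_eq_zero_of_not_dvd hpn]

theorem exists_mul_dvd_sq_sub {m k : ℕ} (hmk : m.Coprime k) {D : ℤ}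
    (hm : ∃ x : ℤ, (m : ℤ) ∣ x ^ 2 - D) (hk : ∃ x : ℤ, (k : ℤ) ∣ x ^ 2 - D) :
    ∃ x : ℤ, ((m * k : ℕ) : ℤ) ∣ x ^ 2 - D := by
  obtain ⟨x, hx⟩ := hm
  obtain ⟨y, hy⟩ := hk
  have hco : IsCoprime (m : ℤ) (k : ℤ) := Nat.isCoprime_iff_coprime.mpr hmk
  obtain ⟨r, s, hrs⟩ := id hco
  refine ⟨r * m * y + s * k * x, ?_⟩
  rw [Nat.cast_mul]
  set z := r * m * y + s * k * x with hz
  apply hco.mul_dvd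
  · have h1 : z - x = m * (r * (y - x)) := by rw [hz]; linear_combination x * hrs
    have : z ^ 2 - D = m * (r * (y - x) * (z + x)) + (x ^ 2 - D) := by
      linear_combination (z + x) * h1
    rw [this]
    exact dvd_add (dvd_mul_right _ _) hx
  · have h1 : z - y = k * (s * (x - y)) := by rw [hz]; linear_combination y * hrs
    have : z ^ 2 - D = k * (s * (x - y) * (z + y)) + (y ^ 2 - D) := by
      linear_combination (z + y) * h1
    rw [this]
    exact dvd_add (dvd_mul_right _ _) hy

theorem exists_dvd_sq_sub_of_squarefree {D : ℤ} (m : ℕ) (hm : Squarefree m)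
    (h : ∀ p : ℕ, p.Prime → p ∣ m → ∃ x : ℤ, (p : ℤ) ∣ x ^ 2 - D) :
    ∃ x : ℤ, (m : ℤ) ∣ x ^ 2 - D := by
  induction m using induction_on_primes with
  | zero => exact absurd hm not_squarefree_zero
  | one => exact ⟨0, by simp⟩
  | prime_mul p k hp ih =>
    exact exists_mul_dvd_sq_sub (Nat.coprime_of_squarefree_mul hm)
      (h p hp (dvd_mul_right p k))
      (ih (hm.of_mul_right) fun q hq hqk => h q hq (hqk.mul_left p))

theorem exists_dvd_sq_sub_of_chiDp_ne {D : ℤ} {p : ℕ} (hp : p.Prime) (hp2 : p ≠ 2)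
    (h : chiDp D p ≠ -1) : ∃ x : ℤ, (p : ℤ) ∣ x ^ 2 - D := by
  have : Fact p.Prime := ⟨hp⟩
  rw [chiDp, if_neg hp2, dif_pos hp, Ne, legendreSym.eq_neg_one_iff, not_not] at h
  obtain ⟨y, hy⟩ := h
  obtain ⟨x, rfl⟩ := ZMod.intCast_surjective y
  refine ⟨x, ?_⟩
  rw [← ZMod.intCast_zmod_eq_zero_iff_dvd]
  push_cast
  rw [hy]
  ring

theorem exists_four_mul_dvd_sq_sub {D : ℤ} (hdisc : D % 4 = 0 ∨ D % 4 = 1) {m : ℕ}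
    (hm : Squarefree m) (hcop : IsCoprime (m : ℤ) D)
    (h : ∀ p : ℕ, p.Prime → p ∣ m → chiDp D p ≠ -1) :
    ∃ x : ℤ, ((4 * m : ℕ) : ℤ) ∣ x ^ 2 - D := by
  have odd_case : ∀ k : ℕ, k ∣ m → ¬ 2 ∣ k → ∃ x : ℤ, (k : ℤ) ∣ x ^ 2 - D := by
    intro k hk hk2
    refine exists_dvd_sq_sub_of_squarefree k (hm.squarefree_of_dvd hk) fun p hp hpk => ?_
    exact exists_dvd_sq_sub_of_chiDp_ne hp (by rintro rfl; exact hk2 hpk)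
      (h p hp (hpk.trans hk))
  have two_coprime : ∀ k : ℕ, ¬ 2 ∣ k → Nat.Coprime 2 k := fun k hk =>
    (Nat.Prime.coprime_iff_not_dvd Nat.prime_two).mpr hk
  by_cases h2 : 2 ∣ m
  · have hchi := h 2 Nat.prime_two h2
    have h2D : ¬ (2 : ℤ) ∣ D := fun hd => by
      have := hcop.isUnit_of_dvd' (x := 2) (by exact_mod_cast h2) hd
      exact absurd this (by decide)
    have h8 : D % 8 = 1 := by
      by_contra h8
      simp [chiDp, h2D, h8] at hchi
    obtain ⟨k, rfl⟩ := h2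
    have hk2 : ¬ 2 ∣ k := (Nat.Prime.coprime_iff_not_dvd Nat.prime_two).mp
      (Nat.coprime_of_squarefree_mul hm)
    have := exists_mul_dvd_sq_sub (m := 8) (D := D)
      (by simpa using (two_coprime k hk2).pow_left 3) ⟨1, by push_cast; omega⟩
      (odd_case k (dvd_mul_left k 2) hk2)
    rwa [show 4 * (2 * k) = 8 * k by ring]
  · refine exists_mul_dvd_sq_sub (by simpa using (two_coprime m h2).pow_left 2) ?_
      (odd_case m dvd_rfl h2)
    rcases hdisc with h0 | h1
    · exact ⟨0, by push_cast; omega⟩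
    · exact ⟨1, by push_cast; omega⟩

theorem stmt11 (D : ℤ) (hD : D < 0) (hdisc : D % 4 = 0 ∨ D % 4 = 1)
    (n : ℕ) (hn : 0 < n) (hcop : Int.gcd (n : ℤ) D = 1) :
    (∃ a b c u v : ℤ, 0 < a ∧ Int.gcd (Int.gcd a b) c = 1 ∧ b ^ 2 - 4 * a * c = D ∧
        (n : ℤ) = a * u ^ 2 + b * u * v + c * v ^ 2) ↔
      ∀ p : ℕ, p.Prime → chiDp D p = -1 → Even (n.factorization p) := by
  constructor
  · rintro ⟨a, b, c, u, v, -, -, rfl, hrep⟩ p hp hchi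
    exact even_factorization_of_form hp
      (fun _ _ => dvd_and_dvd_of_dvd_form hp hdisc hchi) n hn u v hrep
  · intro h
    obtain ⟨m, s, rfl, hm⟩ := Nat.sq_mul_squarefree n
    have hs : s ≠ 0 := by rintro rfl; simp at hn
    have hmD : IsCoprime (m : ℤ) D := by
      have := Int.isCoprime_iff_gcd_eq_one.mpr hcop
      rw [Nat.cast_mul] at this
      exact this.of_mul_left_right
    obtain ⟨b, c, hc⟩ := exists_four_mul_dvd_sq_sub hdisc hm hmD fun p hp hpm hchi => by
      have := h p hp hchi
      rw [Nat.factorization_mul (pow_ne_zero 2 hs) hm.ne_zero, Finsupp.add_apply,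
        Nat.factorization_pow, Nat.factorization_eq_one_of_squarefree hm hp hpm] at this
      simp at this
    push_cast at hc
    refine ⟨m, b, c, s, 0, by exact_mod_cast Nat.pos_of_ne_zero hm.ne_zero, ?_,
      by linear_combination hc, by push_cast; ring⟩
    have hmb : IsCoprime (m : ℤ) (b ^ 2) := by
      have := hmD.add_mul_left_right (4 * c)
      rwa [show D + m * (4 * c) = b ^ 2 by linear_combination -hc] at this
    have hgcd : Int.gcd (m : ℤ) b = 1 :=
      Int.isCoprime_iff_gcd_eq_one.mp ((IsCoprime.pow_right_iff two_pos).mp hmb)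
    rw [hgcd]
    simp
end
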